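/- There exists a universal constant C > 0 such that for every n, every r ≥ 2, every isotropic log-concave random vector X in ℝⁿ, and every p ≥ 1, one has (E‖X‖_r^p)^{1/p} ≤ C·(r·n^{1/r} + σ_X(p)), where ‖x‖_r := (∑_{i=1}^n |x_i|^r)^{1/r} is the l_r-norm. -/

import Mathlib

open MeasureTheory ProbabilityTheory Real
open scoped Pointwise ENNReal RealInnerProductSpace

noncomputable section

variable {Ω : Type*} [MeasurableSpace Ω]

/-- A random vector `X` in `ℝⁿ` is log-concave: for all nonempty compact sets `K, L` and
`a ∈ [0,1]`, `P(X ∈ aK + (1-a)L) ≥ P(X ∈ K)^a * P(X ∈ L)^(1-a)`. -/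
def IsLogConcave {n : ℕ} (μ : Measure Ω) (X : Ω → EuclideanSpace ℝ (Fin n)) : Prop :=
  ∀ K L : Set (EuclideanSpace ℝ (Fin n)), K.Nonempty → L.Nonempty →
    IsCompact K → IsCompact L → ∀ a : ℝ, 0 ≤ a → a ≤ 1 →
      (μ (X ⁻¹' K)).toReal ^ a * (μ (X ⁻¹' L)).toReal ^ (1 - a) ≤
        (μ (X ⁻¹' (a • K + (1 - a) • L))).toReal

/-- `X` is isotropic: centered with identity covariance matrix. -/
def IsIsotropic {n : ℕ} (μ : Measure Ω) (X : Ω → EuclideanSpace ℝ (Fin n)) : Prop :=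
  (∀ i, ∫ ω, X ω i ∂μ = 0) ∧
  ∀ i j, ∫ ω, X ω i * X ω j ∂μ = if i = j then (1 : ℝ) else 0

/-- `σ_X(p) = sup_{|t| = 1} (E|⟨t,X⟩|^p)^(1/p)`. -/
def sigmaX {n : ℕ} (μ : Measure Ω) (X : Ω → EuclideanSpace ℝ (Fin n)) (p : ℝ) : ℝ :=
  ⨆ t : {t : EuclideanSpace ℝ (Fin n) // ‖t‖ = 1},
    (∫ ω, |⟪t.1, X ω⟫| ^ p ∂μ) ^ (1 / p)

/-- Generalized inverse of `σ_X`. -/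
def sigmaXInv {n : ℕ} (μ : Measure Ω) (X : Ω → EuclideanSpace ℝ (Fin n)) (s : ℝ) : ℝ :=
  sSup {p : ℝ | 1 ≤ p ∧ sigmaX μ X p ≤ s}

/-- The `l_r`-norm `‖x‖_r = (∑ᵢ |xᵢ|^r)^(1/r)`. -/
def lrNorm {n : ℕ} (r : ℝ) (x : EuclideanSpace ℝ (Fin n)) : ℝ :=
  (∑ i, |x i| ^ r) ^ (1 / r)

/-- Log-concavity of a measure, expressed through measurable sets. -/
def IsLogConcaveMeasure {E : Type*} [AddCommGroup E] [Module ℝ E] [MeasurableSpace E]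
    (ν : Measure E) : Prop :=
  ∀ ⦃A B C : Set E⦄, MeasurableSet A → MeasurableSet B → MeasurableSet C →
    ∀ a b : ℝ, 0 < a → 0 < b → a + b = 1 → (∀ x ∈ A, ∀ y ∈ B, a • x + b • y ∈ C) →
      ν A ^ a * ν B ^ b ≤ ν C

lemma ENNReal.mul_rpow_le_of_forall_lt {x y z : ℝ≥0∞} {a b : ℝ} (ha : 0 < a) (hb : 0 < b)
    (h : ∀ u < x, ∀ v < y, u ^ a * v ^ b ≤ z) : x ^ a * y ^ b ≤ z := by
  refine ENNReal.mul_le_of_forall_lt fun c hc d hd => ?_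
  have hc' : c ^ (1 / a) < x := by
    have := ENNReal.rpow_lt_rpow hc (z := 1 / a) (by positivity)
    rwa [← ENNReal.rpow_mul, mul_one_div_cancel ha.ne', ENNReal.rpow_one] at this
  have hd' : d ^ (1 / b) < y := by
    have := ENNReal.rpow_lt_rpow hd (z := 1 / b) (by positivity)
    rwa [← ENNReal.rpow_mul, mul_one_div_cancel hb.ne', ENNReal.rpow_one] at this
  have := h _ hc' _ hd'
  rwa [← ENNReal.rpow_mul, ← ENNReal.rpow_mul, one_div_mul_cancel ha.ne',
    one_div_mul_cancel hb.ne', ENNReal.rpow_one, ENNReal.rpow_one] at this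

lemma IsLogConcave.isLogConcaveMeasure_map {n : ℕ} {μ : Measure Ω} [IsProbabilityMeasure μ]
    {X : Ω → EuclideanSpace ℝ (Fin n)} (hX : Measurable X) (h : IsLogConcave μ X) :
    IsLogConcaveMeasure (μ.map X) := by
  intro A B C hA hB hC a b ha hb hab hABC
  have : IsProbabilityMeasure (μ.map X) := Measure.isProbabilityMeasure_map hX.aemeasurable
  refine ENNReal.mul_rpow_le_of_forall_lt ha hb fun u hu v hv => ?_
  rw [hA.measure_eq_iSup_isCompact] at hu
  rw [hB.measure_eq_iSup_isCompact] at hv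
  simp only [lt_iSup_iff] at hu hv
  obtain ⟨K, hKA, hK, hu⟩ := hu
  obtain ⟨L, hLB, hL, hv⟩ := hv
  have hKne : K.Nonempty := by
    rw [Set.nonempty_iff_ne_empty]; rintro rfl; simp at hu
  have hLne : L.Nonempty := by
    rw [Set.nonempty_iff_ne_empty]; rintro rfl; simp at hv
  obtain rfl : b = 1 - a := by linarith
  have key := h K L hKne hLne hK hL a ha.le (by linarith)
  rw [ENNReal.toReal_rpow, ENNReal.toReal_rpow, ← ENNReal.toReal_mul,
    ENNReal.toReal_le_toReal (by finiteness) (by finiteness)] at key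
  have hsub : a • K + (1 - a) • L ⊆ C := by
    rintro _ ⟨_, ⟨x, hx, rfl⟩, _, ⟨y, hy, rfl⟩, rfl⟩
    exact hABC x (hKA hx) y (hLB hy)
  rw [Measure.map_apply hX hK.measurableSet] at hu
  rw [Measure.map_apply hX hL.measurableSet] at hv
  rw [Measure.map_apply hX hC]
  calc u ^ a * v ^ (1 - a) ≤ _ := by gcongr
    _ ≤ _ := key
    _ ≤ _ := measure_mono (Set.preimage_mono hsub)

namespace IsLogConcaveMeasure

variable {E F : Type*} [AddCommGroup E] [Module ℝ E] [MeasurableSpace E]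
  [AddCommGroup F] [Module ℝ F] [MeasurableSpace F] {ν : Measure E}

lemma map (h : IsLogConcaveMeasure ν) (T : E →ₗ[ℝ] F) (hT : Measurable T) :
    IsLogConcaveMeasure (ν.map T) := by
  intro A B C hA hB hC a b ha hb hab hABC
  rw [Measure.map_apply hT hA, Measure.map_apply hT hB, Measure.map_apply hT hC]
  exact h (hT hA) (hT hB) (hT hC) a b ha hb hab fun x hx y hy => by
    simpa using hABC _ hx _ hy

lemma restrict (h : IsLogConcaveMeasure ν) {D : Set E} (hD : Convex ℝ D) (hDm : MeasurableSet D) :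
    IsLogConcaveMeasure (ν.restrict D) := by
  intro A B C hA hB hC a b ha hb hab hABC
  rw [Measure.restrict_apply hA, Measure.restrict_apply hB, Measure.restrict_apply hC]
  exact h (hA.inter hDm) (hB.inter hDm) (hC.inter hDm) a b ha hb hab fun x hx y hy =>
    ⟨hABC x hx.1 y hy.1, hD hx.2 hy.2 ha.le hb.le hab⟩

lemma smul (h : IsLogConcaveMeasure ν) (c : ℝ≥0∞) : IsLogConcaveMeasure (c • ν) := by
  intro A B C hA hB hC a b ha hb hab hABC
  simp only [Measure.smul_apply, smul_eq_mul]
  rw [ENNReal.mul_rpow_of_nonneg _ _ ha.le, ENNReal.mul_rpow_of_nonneg _ _ hb.le]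
  have hc : c ^ a * c ^ b = c := by
    rw [← ENNReal.rpow_add_of_nonneg _ _ ha.le hb.le, hab, ENNReal.rpow_one]
  calc _ = (c ^ a * c ^ b) * (ν A ^ a * ν B ^ b) := by ring
    _ ≤ c * ν C := by rw [hc]; gcongr; exact h hA hB hC a b ha hb hab hABC

lemma cond (h : IsLogConcaveMeasure ν) {D : Set E} (hD : Convex ℝ D) (hDm : MeasurableSet D) :
    IsLogConcaveMeasure (ProbabilityTheory.cond ν D) :=
  (h.restrict hD hDm).smul _

/-- Borell's lemma. -/
lemma measure_gt_mul_le (h : IsLogConcaveMeasure ν) [IsProbabilityMeasure ν] (N : Seminorm ℝ E)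
    (hN : Measurable N) {α s : ℝ} (hs : 1 < s) {ε : ℝ≥0∞} (hε : ε ≤ 1 / 2)
    (hle : ν {x | α < N x} ≤ ε) : ν {x | s * α < N x} ≤ (2 * ε) ^ (s / 2) := by
  have hm : ∀ t : ℝ, MeasurableSet {x | t < N x} := fun t => measurableSet_lt measurable_const hN
  have hθ : 1 / 2 ≤ ν {x | N x ≤ α} := by
    have hc : {x | N x ≤ α} = {x | α < N x}ᶜ := by ext; simp
    rw [hc, prob_compl_eq_one_sub (hm α)]
    calc (1 / 2 : ℝ≥0∞) = 1 - 1 / 2 := by simp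
      _ ≤ _ := tsub_le_tsub_left (hle.trans hε) _
  have hs1 : 0 < s + 1 := by linarith
  have key := h (hm (s * α)) (measurableSet_le hN measurable_const : MeasurableSet {x | N x ≤ α})
    (hm α) (2 / (s + 1)) ((s - 1) / (s + 1)) (by positivity) (div_pos (by linarith) hs1)
    (by field_simp; ring) (fun x hx y hy => by
      simp only [Set.mem_ofPred_eq] at hx hy ⊢
      have h1 := map_sub_le_add N ((2 / (s + 1)) • x + ((s - 1) / (s + 1)) • y)
        (((s - 1) / (s + 1)) • y)
      rw [add_sub_cancel_right, map_smul_eq_mul, map_smul_eq_mul,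
        Real.norm_of_nonneg (by positivity),
        Real.norm_of_nonneg (div_nonneg (by linarith) hs1.le)] at h1
      have h2 : 2 / (s + 1) * (s * α) < 2 / (s + 1) * N x := by gcongr
      have h3 : (s - 1) / (s + 1) * N y ≤ (s - 1) / (s + 1) * α :=
        mul_le_mul_of_nonneg_left hy (div_nonneg (by linarith) hs1.le)
      have h4 : 2 / (s + 1) * (s * α) - (s - 1) / (s + 1) * α = α := by field_simp; ring
      linarith)
  set T := ν {x | s * α < N x}
  have h5 : T ^ (2 / (s + 1)) ≤ 2 * ε := by
    have h6 : (1 / 2 : ℝ≥0∞) ≤ ν {x | N x ≤ α} ^ ((s - 1) / (s + 1)) := by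
      calc (1 / 2 : ℝ≥0∞) = (1 / 2) ^ (1 : ℝ) := by simp
        _ ≤ (1 / 2) ^ ((s - 1) / (s + 1)) :=
          ENNReal.rpow_le_rpow_of_exponent_ge (by simp) (by rw [div_le_one hs1]; linarith)
        _ ≤ _ := ENNReal.rpow_le_rpow hθ (div_nonneg (by linarith) hs1.le)
    calc T ^ (2 / (s + 1)) = 2 * (T ^ (2 / (s + 1)) * (1 / 2)) := by
          rw [mul_comm, mul_assoc, one_div, ENNReal.inv_mul_cancel (by simp) (by simp), mul_one]
      _ ≤ 2 * ε := by
        gcongr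
        exact (mul_le_mul_right h6 _).trans (key.trans hle)
  have h2ε : 2 * ε ≤ 1 := by
    calc 2 * ε ≤ 2 * (1 / 2) := by gcongr
      _ = 1 := by rw [one_div, ENNReal.mul_inv_cancel (by simp) (by simp)]
  calc T = (T ^ (2 / (s + 1))) ^ ((s + 1) / 2) := by
        rw [← ENNReal.rpow_mul, show 2 / (s + 1) * ((s + 1) / 2) = 1 by field_simp,
          ENNReal.rpow_one]
    _ ≤ (2 * ε) ^ ((s + 1) / 2) := ENNReal.rpow_le_rpow h5 (by positivity)
    _ ≤ (2 * ε) ^ (s / 2) := ENNReal.rpow_le_rpow_of_exponent_ge h2ε (by linarith)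

end IsLogConcaveMeasure

lemma rpow_le_rpow_mul_exp {y q : ℝ} (hy : 0 ≤ y) (hq : 0 < q) : y ^ q ≤ q ^ q * exp y := by
  have h1 : y / q ≤ exp (y / q) := by linarith [add_one_le_exp (y / q)]
  have h2 : (y / q) ^ q ≤ exp (y / q) ^ q := rpow_le_rpow (by positivity) h1 hq.le
  rw [← exp_mul, div_mul_cancel₀ _ hq.ne', div_rpow hy hq.le, div_le_iff₀ (by positivity)] at h2
  linarith

/-- Lyapunov's inequality. -/
lemma lintegral_rpow_le_of_exponent_le {α : Type*} [MeasurableSpace α] {ν : Measure α}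
    [IsProbabilityMeasure ν] {f : α → ℝ≥0∞} (hf : Measurable f) {p q : ℝ} (hp : 0 < p)
    (hpq : p ≤ q) {m : ℝ≥0∞} (h : ∫⁻ x, f x ^ q ∂ν ≤ m ^ q) : ∫⁻ x, f x ^ p ∂ν ≤ m ^ p := by
  have hq : 0 < q := hp.trans_le hpq
  have h1 := eLpNorm'_le_eLpNorm'_of_exponent_le hp hpq ν hf.aestronglyMeasurable
  simp only [eLpNorm', enorm_eq_self] at h1
  have h2 := ENNReal.rpow_le_rpow h1 hp.le
  rw [← ENNReal.rpow_mul, one_div_mul_cancel hp.ne', ENNReal.rpow_one] at h2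
  refine h2.trans (ENNReal.rpow_le_rpow ?_ hp.le)
  calc _ ≤ (m ^ q) ^ (1 / q) := ENNReal.rpow_le_rpow h (by positivity)
    _ = m := by rw [← ENNReal.rpow_mul, mul_one_div_cancel hq.ne', ENNReal.rpow_one]

namespace IsLogConcaveMeasure

variable {E : Type*} [AddCommGroup E] [Module ℝ E] [MeasurableSpace E] {ν : Measure E}

lemma measure_gt_nat_mul_le (h : IsLogConcaveMeasure ν) [IsProbabilityMeasure ν]
    (N : Seminorm ℝ E) (hN : Measurable N) {p m : ℝ} (hp : 1 ≤ p) (hm : 0 < m)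
    (hle : ∫⁻ x, ENNReal.ofReal (N x) ^ p ∂ν ≤ ENNReal.ofReal m ^ p) (j : ℕ) :
    ν {x | j * (2 * exp 2 * m) < N x} ≤ ENNReal.ofReal (exp (p - p * j)) := by
  have hA : 0 < 2 * exp 2 := by positivity
  have hε : ν {x | 2 * exp 2 * m < N x} ≤ ENNReal.ofReal ((2 * exp 2) ^ (-p)) := by
    have h1 := meas_ge_le_lintegral_div (μ := ν) (f := fun x => ENNReal.ofReal (N x) ^ p)
      (by fun_prop) (ε := ENNReal.ofReal (2 * exp 2 * m) ^ p)
      (ENNReal.rpow_pos (ENNReal.ofReal_pos.mpr (by positivity)) ENNReal.ofReal_ne_top).ne'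
      (by finiteness)
    have h2 : ν {x | 2 * exp 2 * m < N x} ≤
        ν {x | ENNReal.ofReal (2 * exp 2 * m) ^ p ≤ ENNReal.ofReal (N x) ^ p} := by
      refine measure_mono fun x hx => ?_
      simp only [Set.mem_ofPred_eq] at hx ⊢
      gcongr
    refine h2.trans (h1.trans ((ENNReal.div_le_div_right hle _).trans_eq ?_))
    rw [ENNReal.ofReal_rpow_of_pos hm, ENNReal.ofReal_rpow_of_pos (by positivity),
      ← ENNReal.ofReal_div_of_pos (by positivity), ← div_rpow hm.le (by positivity),
      rpow_neg hA.le, ← inv_rpow hA.le]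
    congr 2
    field_simp
  have hεr : 2 * (2 * exp 2) ^ (-p) ≤ exp (-2 * p) := by
    rw [mul_rpow (by norm_num) (exp_pos _).le, ← exp_mul, ← mul_assoc]
    have : (2 : ℝ) * 2 ^ (-p) ≤ 1 := by
      calc (2 : ℝ) * 2 ^ (-p) ≤ 2 * 2 ^ (-1 : ℝ) := by
            gcongr
            · norm_num
        _ = 1 := by rw [rpow_neg_one]; norm_num
    calc 2 * 2 ^ (-p) * exp (2 * -p) ≤ 1 * exp (2 * -p) := by gcongr
      _ = _ := by rw [one_mul]; ring_nf
  rcases Nat.lt_or_ge j 2 with hj | hj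
  · refine prob_le_one.trans ?_
    rw [ENNReal.one_le_ofReal]
    refine one_le_exp ?_
    have : (j : ℝ) ≤ 1 := by exact_mod_cast Nat.lt_succ_iff.mp hj
    nlinarith
  · have hj' : (2 : ℝ) ≤ j := by exact_mod_cast hj
    have h1 := h.measure_gt_mul_le N hN (s := j) (by linarith)
      (ε := ENNReal.ofReal ((2 * exp 2) ^ (-p))) (by
        rw [show (1 / 2 : ℝ≥0∞) = ENNReal.ofReal (1 / 2) by
          rw [ENNReal.ofReal_div_of_pos (by norm_num)]; simp]
        refine ENNReal.ofReal_le_ofReal ?_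
        have : exp (-2 * p) ≤ 1 := exp_le_one_iff.mpr (by linarith)
        linarith) hε
    refine h1.trans ?_
    rw [show (2 : ℝ≥0∞) = ENNReal.ofReal 2 by simp, ← ENNReal.ofReal_mul (by norm_num),
      ENNReal.ofReal_rpow_of_nonneg (by positivity) (by positivity)]
    refine ENNReal.ofReal_le_ofReal ?_
    calc (2 * (2 * exp 2) ^ (-p)) ^ ((j : ℝ) / 2) ≤ exp (-2 * p) ^ ((j : ℝ) / 2) :=
          rpow_le_rpow (by positivity) hεr (by positivity)
      _ = exp (-2 * p * (j / 2)) := by rw [← exp_mul]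
      _ ≤ _ := exp_le_exp.mpr (by linarith)

lemma lintegral_exp_le (h : IsLogConcaveMeasure ν) [IsProbabilityMeasure ν]
    (N : Seminorm ℝ E) (hN : Measurable N) {p m : ℝ} (hp : 1 ≤ p) (hm : 0 < m)
    (hle : ∫⁻ x, ENNReal.ofReal (N x) ^ p ∂ν ≤ ENNReal.ofReal m ^ p) :
    ∫⁻ x, ENNReal.ofReal (exp (p * (N x / (2 * exp 2 * m)) / 2)) ∂ν ≤
      ENNReal.ofReal (exp (3 * p)) := by
  set α := 2 * exp 2 * m with hα
  have hα0 : 0 < α := by positivity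
  have hms : ∀ j : ℕ, MeasurableSet {x | j * α < N x} :=
      fun j => measurableSet_lt measurable_const hN
  have hpt : ∀ x, ENNReal.ofReal (exp (p * (N x / α) / 2)) ≤ ENNReal.ofReal (exp (p / 2)) +
      ∑' j : ℕ, {x | j * α < N x}.indicator
        (fun _ => ENNReal.ofReal (exp (p * (j + 1) / 2))) x := by
    intro x
    rcases (apply_nonneg N x).eq_or_lt with h0 | h0
    · refine le_add_right (ENNReal.ofReal_le_ofReal (exp_le_exp.mpr ?_))
      rw [← h0]; simp; linarith
    · have hs : 0 < N x / α := by positivity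
      obtain ⟨j, hj⟩ : ∃ j : ℕ, ⌈N x / α⌉₊ = j + 1 :=
        Nat.exists_eq_succ_of_ne_zero (Nat.ceil_pos.mpr hs).ne'
      refine le_add_left (le_trans ?_ (ENNReal.le_tsum j))
      have h1 : (j : ℝ) < N x / α := Nat.lt_ceil.mp (by omega)
      have h2 : N x / α ≤ j + 1 := by exact_mod_cast hj ▸ Nat.le_ceil (N x / α)
      rw [Set.indicator_of_mem (by rwa [Set.mem_ofPred_eq, ← lt_div_iff₀ hα0])]
      refine ENNReal.ofReal_le_ofReal (exp_le_exp.mpr ?_)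
      gcongr
  calc _ ≤ ∫⁻ x, (ENNReal.ofReal (exp (p / 2)) + ∑' j : ℕ, {x | j * α < N x}.indicator
        (fun _ => ENNReal.ofReal (exp (p * (j + 1) / 2))) x) ∂ν := lintegral_mono hpt
    _ = ENNReal.ofReal (exp (p / 2)) +
        ∑' j : ℕ, ENNReal.ofReal (exp (p * (j + 1) / 2)) * ν {x | j * α < N x} := by
      rw [lintegral_add_left measurable_const, lintegral_const, measure_univ, mul_one,
        lintegral_tsum fun j => (measurable_const.indicator (hms j)).aemeasurable]
      simp_rw [fun j => lintegral_indicator_const (hms j) (μ := ν)]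
    _ ≤ ENNReal.ofReal (exp (p / 2)) +
        ∑' j : ℕ, ENNReal.ofReal (exp (3 * p / 2) * exp (-(1 / 2)) ^ j) := by
      gcongr with j
      calc _ ≤ ENNReal.ofReal (exp (p * (j + 1) / 2)) * ENNReal.ofReal (exp (p - p * j)) := by
            gcongr
            exact h.measure_gt_nat_mul_le N hN hp hm hle j
        _ ≤ _ := by
          rw [← ENNReal.ofReal_mul (exp_pos _).le, ← exp_add, ← exp_nat_mul, ← exp_add]
          refine ENNReal.ofReal_le_ofReal (exp_le_exp.mpr ?_)
          have : (0 : ℝ) ≤ j := j.cast_nonneg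
          nlinarith
    _ = ENNReal.ofReal (exp (p / 2) + exp (3 * p / 2) * (1 - exp (-(1 / 2)))⁻¹) := by
      have hr : exp (-(1 / 2)) < 1 := exp_lt_one_iff.mpr (by norm_num)
      rw [← ENNReal.ofReal_tsum_of_nonneg (fun j => by positivity)
        ((summable_geometric_of_lt_one (exp_pos _).le hr).mul_left _), tsum_mul_left,
        tsum_geometric_of_lt_one (exp_pos _).le hr, ← ENNReal.ofReal_add (exp_pos _).le]
      exact mul_nonneg (exp_pos _).le (inv_nonneg.mpr (by linarith))
    _ ≤ _ := by
      refine ENNReal.ofReal_le_ofReal ?_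
      have h1 : (3 / 2 : ℝ) ≤ exp (1 / 2) := by linarith [add_one_le_exp (1 / 2 : ℝ)]
      have h2 : (1 - exp (-(1 / 2)))⁻¹ ≤ 3 := by
        rw [exp_neg]
        have : (exp (1 / 2))⁻¹ ≤ (3 / 2 : ℝ)⁻¹ := inv_anti₀ (by norm_num) h1
        rw [inv_le_comm₀ (by norm_num at this ⊢; linarith) (by norm_num)]
        norm_num at this ⊢; linarith
      have h3 : exp (p / 2) ≤ exp (3 * p / 2) := exp_le_exp.mpr (by linarith)
      have h4 : (4 : ℝ) ≤ exp (3 * p / 2) := by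
        calc (4 : ℝ) ≤ (13 / 5) ^ (3 / 2 : ℝ) := by
              have : ((13 / 5 : ℝ) ^ (3 / 2 : ℝ)) ^ 2 = (13 / 5) ^ 3 := by
                rw [← rpow_natCast, ← rpow_mul (by norm_num)]; norm_num
              have h0 : (0 : ℝ) ≤ (13 / 5) ^ (3 / 2 : ℝ) := by positivity
              nlinarith
          _ ≤ exp 1 ^ (3 / 2 : ℝ) := by
            gcongr
            linarith [exp_one_gt_d9]
          _ = exp (3 / 2) := by rw [← exp_mul]; norm_num
          _ ≤ _ := exp_le_exp.mpr (by linarith)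
      calc exp (p / 2) + exp (3 * p / 2) * (1 - exp (-(1 / 2)))⁻¹
          ≤ exp (3 * p / 2) + exp (3 * p / 2) * 3 := by gcongr
        _ = 4 * exp (3 * p / 2) := by ring
        _ ≤ exp (3 * p / 2) * exp (3 * p / 2) := by gcongr
        _ = _ := by rw [← exp_add]; ring_nf

end IsLogConcaveMeasure

/-- The constant in the comparison of moments for log-concave measures. -/
def momentConst : ℝ := 4 * exp 5

lemma one_le_momentConst : 1 ≤ momentConst := by
  have : 1 ≤ exp 5 := one_le_exp (by norm_num)
  unfold momentConst; linarith

lemma momentConst_pos : 0 < momentConst := one_pos.trans_le one_le_momentConst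

namespace IsLogConcaveMeasure

variable {E : Type*} [AddCommGroup E] [Module ℝ E] [MeasurableSpace E] {ν : Measure E}

/-- Comparison of moments of seminorms of log-concave vectors. -/
lemma lintegral_rpow_le (h : IsLogConcaveMeasure ν) [IsProbabilityMeasure ν]
    (N : Seminorm ℝ E) (hN : Measurable N) {p q m : ℝ} (hp : 1 ≤ p) (hpq : p ≤ q) (hm : 0 ≤ m)
    (hle : ∫⁻ x, ENNReal.ofReal (N x) ^ p ∂ν ≤ ENNReal.ofReal m ^ p) :
    ∫⁻ x, ENNReal.ofReal (N x) ^ q ∂ν ≤ ENNReal.ofReal (momentConst * (q / p) * m) ^ q := by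
  have hp0 : 0 < p := by linarith
  have hq0 : 0 < q := by linarith
  rcases hm.eq_or_lt with rfl | hm
  · simp only [ENNReal.ofReal_zero, ENNReal.zero_rpow_of_pos hp0, nonpos_iff_eq_zero] at hle
    rw [lintegral_eq_zero_iff (by fun_prop)] at hle
    refine le_of_eq_of_le ?_ zero_le
    rw [lintegral_eq_zero_iff (by fun_prop)]
    filter_upwards [hle] with x hx
    simp only [Pi.zero_apply, ENNReal.rpow_eq_zero_iff] at hx ⊢
    simpa [hp0, hq0, hp0.not_gt, hq0.not_gt] using hx
  set α := 2 * exp 2 * m with hα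
  have hα0 : 0 < α := by positivity
  have hpt : ∀ x, ENNReal.ofReal (N x) ^ q ≤ ENNReal.ofReal ((2 * q / p * α) ^ q) *
      ENNReal.ofReal (exp (p * (N x / α) / 2)) := by
    intro x
    have h0 : 0 ≤ N x := apply_nonneg N x
    rw [ENNReal.ofReal_rpow_of_nonneg h0 hq0.le, ← ENNReal.ofReal_mul (by positivity)]
    refine ENNReal.ofReal_le_ofReal ?_
    have := rpow_le_rpow_mul_exp (y := p * (N x / α) / 2) (by positivity) hq0
    calc N x ^ q = (2 / p * α) ^ q * (p * (N x / α) / 2) ^ q := by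
          rw [← mul_rpow (by positivity) (by positivity)]; congr 1; field_simp
      _ ≤ (2 / p * α) ^ q * (q ^ q * exp (p * (N x / α) / 2)) := by gcongr
      _ = _ := by
        rw [← mul_assoc, ← mul_rpow (by positivity) (by positivity)]; congr 2; ring
  calc _ ≤ ∫⁻ x, ENNReal.ofReal ((2 * q / p * α) ^ q) *
      ENNReal.ofReal (exp (p * (N x / α) / 2)) ∂ν := lintegral_mono hpt
    _ ≤ ENNReal.ofReal ((2 * q / p * α) ^ q) * ENNReal.ofReal (exp (3 * q)) := by
      rw [lintegral_const_mul _ (by fun_prop)]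
      gcongr
      refine (h.lintegral_exp_le N hN hp hm hle).trans (ENNReal.ofReal_le_ofReal ?_)
      exact exp_le_exp.mpr (by linarith)
    _ = _ := by
      rw [← ENNReal.ofReal_mul (by positivity), exp_mul, ← mul_rpow (by positivity) (by positivity),
        ENNReal.ofReal_rpow_of_nonneg
          (mul_nonneg (mul_nonneg momentConst_pos.le (by positivity)) hm.le) hq0.le]
      congr 2
      rw [momentConst, hα, show (5 : ℝ) = 2 + 3 by norm_num, exp_add]
      ring

end IsLogConcaveMeasure

/-- A Paley–Zygmund inequality for `p`-th moments. -/
lemma paley_zygmund_rpow {α : Type*} [MeasurableSpace α] {ν : Measure α} {f : α → ℝ≥0∞}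
    (hf : Measurable f) [IsProbabilityMeasure ν] {p W K : ℝ} (hp : 1 ≤ p) (hW : 0 < W) (hK : 0 < K)
    (h1 : ENNReal.ofReal W ^ p ≤ ∫⁻ x, f x ^ p ∂ν)
    (h2 : ∫⁻ x, f x ^ (2 * p) ∂ν ≤ ENNReal.ofReal (K * W) ^ (2 * p)) :
    ENNReal.ofReal ((2 * K) ^ (-(2 * p))) ≤ ν {x | ENNReal.ofReal (W / 2) ≤ f x} := by
  have hp0 : 0 < p := by linarith
  set S := {x | ENNReal.ofReal (W / 2) ≤ f x} with hS
  have hSm : MeasurableSet S := measurableSet_le measurable_const hf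
  have hhalf : ENNReal.ofReal (W / 2) ^ p ≤ ENNReal.ofReal (W ^ p / 2) := by
    rw [ENNReal.ofReal_rpow_of_pos (by positivity)]
    refine ENNReal.ofReal_le_ofReal ?_
    rw [div_rpow hW.le (by norm_num)]
    gcongr
    simpa using rpow_le_rpow_of_exponent_le (one_le_two (α := ℝ)) hp
  have hA : ENNReal.ofReal (W ^ p / 2) ≤ ∫⁻ x in S, f x ^ p ∂ν := by
    have h3 : ∫⁻ x in Sᶜ, f x ^ p ∂ν ≤ ENNReal.ofReal (W ^ p / 2) := by
      calc _ ≤ ∫⁻ _ in Sᶜ, ENNReal.ofReal (W ^ p / 2) ∂ν := by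
            refine setLIntegral_mono measurable_const fun x hx => ?_
            refine (ENNReal.rpow_le_rpow ?_ hp0.le).trans hhalf
            simp only [hS, Set.mem_compl_iff, Set.mem_ofPred_eq, not_le] at hx
            exact hx.le
        _ ≤ _ := by
          rw [setLIntegral_const]
          exact mul_le_of_le_one_right' prob_le_one
    rw [← lintegral_add_compl _ hSm, ENNReal.ofReal_rpow_of_pos hW] at h1
    have h4 : ENNReal.ofReal (W ^ p / 2) + ENNReal.ofReal (W ^ p / 2) ≤
        ∫⁻ x in S, f x ^ p ∂ν + ENNReal.ofReal (W ^ p / 2) := by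
      rw [← ENNReal.ofReal_add (by positivity) (by positivity), add_halves]
      exact h1.trans (by gcongr)
    exact (ENNReal.add_le_add_iff_right ENNReal.ofReal_ne_top).mp h4
  have hB : (∫⁻ x in S, f x ^ p ∂ν) ^ (2 : ℝ) ≤ ENNReal.ofReal (K * W) ^ (2 * p) * ν S := by
    have h3 := ENNReal.lintegral_mul_le_Lp_mul_Lq (ν.restrict S) Real.HolderConjugate.two_two
      (f := fun x => f x ^ p) (g := 1) (by fun_prop) (by fun_prop)
    simp only [Pi.mul_apply, Pi.one_apply, mul_one, ENNReal.one_rpow, lintegral_const,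
      Measure.restrict_apply_univ, one_mul] at h3
    calc _ ≤ _ := ENNReal.rpow_le_rpow h3 (by norm_num)
      _ = (∫⁻ x in S, (f x ^ p) ^ (2 : ℝ) ∂ν) * ν S := by
        rw [ENNReal.mul_rpow_of_nonneg _ _ (by norm_num), ← ENNReal.rpow_mul, ← ENNReal.rpow_mul]
        norm_num
      _ ≤ _ := by
        gcongr
        refine (setLIntegral_le_lintegral _ _).trans (le_of_eq_of_le ?_ h2)
        simp_rw [← ENNReal.rpow_mul, mul_comm p 2]
  have hC := (ENNReal.rpow_le_rpow hA (by norm_num : (0 : ℝ) ≤ 2)).trans hB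
  have hνS : ν S = ENNReal.ofReal (ν S).toReal := (ENNReal.ofReal_toReal (by finiteness)).symm
  rw [hνS] at hC ⊢
  rw [ENNReal.ofReal_rpow_of_pos (by positivity), ENNReal.ofReal_rpow_of_pos (by positivity),
    ← ENNReal.ofReal_mul (by positivity), ENNReal.ofReal_le_ofReal_iff (by positivity)] at hC
  refine ENNReal.ofReal_le_ofReal ?_
  have e1 : (W ^ p / 2) ^ (2 : ℝ) = W ^ (2 * p) / 4 := by
    rw [div_rpow (by positivity) (by norm_num), ← rpow_mul hW.le, mul_comm p]; norm_num
  have e2 : (4 : ℝ) ≤ 2 ^ (2 * p) := by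
    calc (4 : ℝ) = 2 ^ (2 : ℝ) := by norm_num
      _ ≤ _ := rpow_le_rpow_of_exponent_le (by norm_num) (by linarith)
  rw [e1, mul_rpow hK.le hW.le, mul_assoc, mul_comm (W ^ (2 * p)), ← mul_assoc, div_eq_mul_inv,
    mul_comm] at hC
  have e3 := le_of_mul_le_mul_right hC (by positivity)
  rw [rpow_neg (by positivity), mul_rpow (by norm_num) hK.le,
    inv_le_iff_one_le_mul₀ (by positivity)]
  have e4 : 0 ≤ K ^ (2 * p) * (ν S).toReal := by positivity
  nlinarith

lemma IsLogConcaveMeasure.le_measure_half_le {E : Type*} [AddCommGroup E] [Module ℝ E]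
    [MeasurableSpace E] {ν : Measure E} (h : IsLogConcaveMeasure ν) [IsProbabilityMeasure ν]
    (N : Seminorm ℝ E) (hN : Measurable N) {p m : ℝ} (hp : 1 ≤ p) (hm : 0 < m)
    (h1 : ENNReal.ofReal m ^ p ≤ ∫⁻ x, ENNReal.ofReal (N x) ^ p ∂ν)
    (h2 : ∫⁻ x, ENNReal.ofReal (N x) ^ p ∂ν ≠ ∞) :
    ENNReal.ofReal ((4 * momentConst) ^ (-(2 * p))) ≤ ν {x | m / 2 ≤ N x} := by
  have hp0 : 0 < p := by linarith
  obtain ⟨W, hW0, hW⟩ : ∃ W : ℝ, 0 ≤ W ∧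
      ∫⁻ x, ENNReal.ofReal (N x) ^ p ∂ν = ENNReal.ofReal W ^ p := by
    refine ⟨((∫⁻ x, ENNReal.ofReal (N x) ^ p ∂ν) ^ (1 / p)).toReal, ENNReal.toReal_nonneg, ?_⟩
    rw [ENNReal.ofReal_toReal (by finiteness), ← ENNReal.rpow_mul, one_div_mul_cancel hp0.ne',
      ENNReal.rpow_one]
  have hmW : m ≤ W := by
    rw [hW, ENNReal.rpow_le_rpow_iff hp0] at h1
    exact (ENNReal.ofReal_le_ofReal_iff hW0).mp h1
  have h3 := h.lintegral_rpow_le N hN hp (q := 2 * p) (by linarith) hW0 hW.le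
  have e : 2 * p / p = 2 := by field_simp
  rw [e] at h3
  have h4 := paley_zygmund_rpow (f := fun x => ENNReal.ofReal (N x)) (by fun_prop) hp
    (hm.trans_le hmW) (mul_pos momentConst_pos two_pos) hW.ge h3
  rw [show 2 * (momentConst * 2) = 4 * momentConst by ring] at h4
  refine h4.trans (measure_mono fun x hx => ?_)
  simp only [Set.mem_ofPred_eq] at hx ⊢
  rw [ENNReal.ofReal_le_ofReal_iff (apply_nonneg N x)] at hx
  linarith

section GaussianConcentration

variable {E : Type*} [NormedAddCommGroup E] [InnerProductSpace ℝ E] [FiniteDimensional ℝ E]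
  [MeasurableSpace E] [BorelSpace E]

lemma stdGaussian_map_inner (w : E) :
    (stdGaussian E).map (fun x => ⟪w, x⟫) = gaussianReal 0 (‖w‖ ^ 2).toNNReal := by
  have h := IsGaussian.map_eq_gaussianReal (μ := stdGaussian E) (InnerProductSpace.toDualMap ℝ E w)
  rw [integral_strongDual_stdGaussian, variance_dual_stdGaussian,
    (InnerProductSpace.toDualMap ℝ E).norm_map] at h
  exact h

lemma lintegral_exp_inner_stdGaussian (w : E) :
    ∫⁻ x, ENNReal.ofReal (exp ⟪w, x⟫) ∂(stdGaussian E) = ENNReal.ofReal (exp (‖w‖ ^ 2 / 2)) := by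
  have h1 := integrable_exp_mul_gaussianReal (μ := 0) (v := (‖w‖ ^ 2).toNNReal) 1
  have h2 := mgf_gaussianReal (p := stdGaussian E) (stdGaussian_map_inner w) 1
  rw [← stdGaussian_map_inner w, integrable_map_measure (by fun_prop) (by fun_prop)] at h1
  simp only [one_mul, Function.comp_def] at h1
  rw [← ofReal_integral_eq_lintegral_ofReal h1 (ae_of_all _ fun x => (exp_pos _).le)]
  simp only [mgf, one_mul] at h2
  rw [h2]
  simp

lemma exists_lintegral_exp_norm_stdGaussian_le :
    ∃ ε : ℝ, 0 < ε ∧ ∫⁻ x, ENNReal.ofReal (exp (ε * ‖x‖)) ∂(stdGaussian E) ≤ 2 := by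
  obtain ⟨C, hC, hint⟩ := IsGaussian.exists_integrable_exp_sq (stdGaussian E)
  have hfin : ∫⁻ x, ENNReal.ofReal (exp (C * ‖x‖ ^ 2)) ∂(stdGaussian E) ≠ ∞ := by
    rw [← ofReal_integral_eq_lintegral_ofReal hint (ae_of_all _ fun x => (exp_pos _).le)]
    exact ENNReal.ofReal_ne_top
  have hfin' : ∫⁻ x, ENNReal.ofReal (exp ‖x‖) ∂(stdGaussian E) ≠ ∞ := by
    have : ∫⁻ x, ENNReal.ofReal (exp ‖x‖) ∂(stdGaussian E) ≤
        ∫⁻ x, ENNReal.ofReal (exp (1 / (4 * C))) * ENNReal.ofReal (exp (C * ‖x‖ ^ 2))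
          ∂(stdGaussian E) := by
      refine lintegral_mono fun x => ?_
      rw [← ENNReal.ofReal_mul (exp_pos _).le, ← exp_add]
      refine ENNReal.ofReal_le_ofReal (exp_le_exp.mpr ?_)
      have h0 : 1 / (4 * C) + C * ‖x‖ ^ 2 - ‖x‖ = (2 * C * ‖x‖ - 1) ^ 2 / (4 * C) := by
        field_simp; ring
      have : 0 ≤ (2 * C * ‖x‖ - 1) ^ 2 / (4 * C) := by positivity
      linarith
    refine ne_top_of_le_ne_top ?_ this
    rw [lintegral_const_mul _ (by fun_prop)]
    finiteness
  set I := ∫⁻ x, ENNReal.ofReal (exp ‖x‖) ∂(stdGaussian E) with hI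
  obtain ⟨n, hn⟩ := pow_unbounded_of_one_lt I.toReal (one_lt_two (α := ℝ))
  have hIle : I ≤ 2 ^ ((n : ℝ) + 1) := by
    rw [← ENNReal.ofReal_toReal hfin', show (2 : ℝ≥0∞) = ENNReal.ofReal 2 by simp,
      ENNReal.ofReal_rpow_of_pos two_pos]
    refine ENNReal.ofReal_le_ofReal (hn.le.trans ?_)
    rw [← rpow_natCast]
    exact rpow_le_rpow_of_exponent_le one_le_two (by linarith)
  have hn0 : (0 : ℝ) < n + 1 := by positivity
  refine ⟨1 / (n + 1), by positivity, ?_⟩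
  have := lintegral_rpow_le_of_exponent_le (ν := stdGaussian E) (p := 1) (q := n + 1) (m := 2)
    (f := fun x => ENNReal.ofReal (exp (1 / ((n : ℝ) + 1) * ‖x‖))) (by fun_prop) one_pos
    (by linarith [n.cast_nonneg (α := ℝ)]) (by
      refine le_of_eq_of_le ?_ hIle
      refine lintegral_congr fun x => ?_
      rw [ENNReal.ofReal_rpow_of_pos (exp_pos _), ← exp_mul]
      congr 2
      field_simp)
  simpa using this

/-- A Maurey–Pisier type inequality for a function which is the maximum of linear forms of
norm at most `σ`; `v` selects the maximizing form. -/
lemma lintegral_exp_sub_stdGaussian_le {h : E → ℝ} {v : E → E} (hh : Measurable h)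
    (hv : Measurable v) (h1 : ∀ w, h w = ⟪v w, w⟫) (h2 : ∀ w z, ⟪v w, z⟫ ≤ h z) {σ : ℝ}
    (h3 : ∀ w, ‖v w‖ ≤ σ) {l : ℝ} (hl : 0 ≤ l) :
    ∫⁻ x, ENNReal.ofReal (exp (l * (h x.2 - h x.1))) ∂((stdGaussian E).prod (stdGaussian E)) ≤
      2 * ENNReal.ofReal (exp (5 / 4 * l ^ 2 * σ ^ 2)) := by
  set γ := stdGaussian E with hγ
  have hσ : 0 ≤ σ := (norm_nonneg _).trans (h3 0)
  obtain ⟨ε, hε, hεle⟩ := exists_lintegral_exp_norm_stdGaussian_le (E := E)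
  obtain ⟨N, hN⟩ := exists_nat_gt (max 1 (l * π ^ 2 * σ / (8 * ε)))
  have hN1 : (1 : ℝ) < N := (le_max_left _ _).trans_lt hN
  have hN0 : (0 : ℝ) < N := by linarith
  have hN2 : l * π ^ 2 * σ / (8 * N) ≤ ε := by
    have := (le_max_right _ _).trans_lt hN
    rw [div_lt_iff₀ (by positivity)] at this
    rw [div_le_iff₀ (by positivity)]; linarith
  set δ := π / (2 * N) with hδ
  have hδ0 : 0 < δ := by positivity
  set R : ℕ → E × E → E × E := fun j => ContinuousLinearMap.rotation (j * δ) with hR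
  set Φ : E × E → ℝ := fun x => (1 - cos δ) * h x.1 + sin δ * ⟪v x.1, x.2⟫ with hΦ
  have hΦm : Measurable Φ := by fun_prop
  have hRm : ∀ j, Measurable (R j) := fun j => (ContinuousLinearMap.continuous _).measurable
  have hstep : ∀ j x, h (R (j + 1) x).1 - h (R j x).1 ≤ Φ (R (j + 1) x) := by
    intro j x
    have e1 : (R j x).1 = cos δ • (R (j + 1) x).1 - sin δ • (R (j + 1) x).2 := by
      have e2 : (j : ℝ) * δ = ((j + 1 : ℕ) : ℝ) * δ - δ := by push_cast; ring
      simp only [hR, ContinuousLinearMap.rotation_apply]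
      rw [e2, cos_sub, sin_sub]
      module
    have e3 := h2 (R (j + 1) x).1 (R j x).1
    rw [e1, inner_sub_right, inner_smul_right, inner_smul_right, ← h1, ← e1] at e3
    simp only [hΦ]; linarith
  have hsum : ∀ x : E × E, h x.2 - h x.1 ≤ ∑ j ∈ Finset.range N, Φ (R (j + 1) x) := by
    intro x
    have e0 : (R 0 x).1 = x.1 := by simp [hR, ContinuousLinearMap.rotation_apply]
    have eN : (R N x).1 = x.2 := by
      have : (N : ℝ) * δ = π / 2 := by rw [hδ]; field_simp
      simp [hR, ContinuousLinearMap.rotation_apply, this]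
    have := Finset.sum_range_sub (fun j => h (R j x).1) N
    rw [e0, eN] at this
    rw [← this]
    exact Finset.sum_le_sum fun j _ => hstep j x
  have hjensen : ∀ x : E × E, exp (l * (h x.2 - h x.1)) ≤
      ∑ j ∈ Finset.range N, (1 / N : ℝ) * exp (l * N * Φ (R (j + 1) x)) := by
    intro x
    have := convexOn_exp.map_sum_le (t := Finset.range N) (w := fun _ => (1 / N : ℝ))
      (p := fun j => l * N * Φ (R (j + 1) x)) (fun _ _ => by positivity)
      (by simp; field_simp) (fun _ _ => Set.mem_univ _)
    simp only [smul_eq_mul] at this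
    refine le_trans (exp_le_exp.mpr ?_) this
    rw [← Finset.mul_sum, ← Finset.mul_sum]
    have e4 : (1 / N : ℝ) * (l * N * ∑ j ∈ Finset.range N, Φ (R (j + 1) x)) =
      l * ∑ j ∈ Finset.range N, Φ (R (j + 1) x) := by field_simp
    rw [e4]
    exact mul_le_mul_of_nonneg_left (hsum x) hl
  have hN3 : N * (1 - cos δ) ≤ π ^ 2 / (8 * N) := by
    have := one_sub_sq_div_two_le_cos (x := δ)
    calc N * (1 - cos δ) ≤ N * (δ ^ 2 / 2) := by gcongr; linarith
      _ = _ := by rw [hδ]; field_simp; ring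
  have hsin : N * |sin δ| ≤ π / 2 := by
    calc N * |sin δ| ≤ N * |δ| := mul_le_mul_of_nonneg_left abs_sin_le_abs hN0.le
      _ = _ := by rw [abs_of_pos hδ0, hδ]; field_simp
  have hh_le : ∀ u, h u ≤ σ * ‖u‖ := fun u => by
    rw [h1]
    exact (real_inner_le_norm _ _).trans (by gcongr; exact h3 u)
  have hΦint : ∫⁻ x, ENNReal.ofReal (exp (l * N * Φ x)) ∂(γ.prod γ) ≤
      2 * ENNReal.ofReal (exp (5 / 4 * l ^ 2 * σ ^ 2)) := by
    rw [lintegral_prod _ (by fun_prop)]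
    calc _ ≤ ∫⁻ u, ENNReal.ofReal (exp (ε * ‖u‖)) *
          ENNReal.ofReal (exp (5 / 4 * l ^ 2 * σ ^ 2)) ∂γ := by
          refine lintegral_mono fun u => ?_
          have e5 : ∀ w, ENNReal.ofReal (exp (l * N * Φ (u, w))) =
              ENNReal.ofReal (exp (l * (N * (1 - cos δ)) * h u)) *
              ENNReal.ofReal (exp ⟪(l * N * sin δ) • v u, w⟫) := by
            intro w
            rw [← ENNReal.ofReal_mul (exp_pos _).le, ← exp_add, inner_smul_left]
            congr 2
            simp only [hΦ, conj_trivial]; ring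
          simp_rw [e5]
          rw [lintegral_const_mul _ (by fun_prop), lintegral_exp_inner_stdGaussian]
          refine mul_le_mul' (ENNReal.ofReal_le_ofReal (exp_le_exp.mpr ?_))
            (ENNReal.ofReal_le_ofReal (exp_le_exp.mpr ?_))
          · have hc : 0 ≤ 1 - cos δ := by linarith [cos_le_one δ]
            calc l * (N * (1 - cos δ)) * h u ≤ l * (N * (1 - cos δ)) * (σ * ‖u‖) := by
                  gcongr; exact hh_le u
              _ ≤ l * (π ^ 2 / (8 * N)) * (σ * ‖u‖) := by gcongr
              _ = l * π ^ 2 * σ / (8 * N) * ‖u‖ := by ring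
              _ ≤ _ := by gcongr
          · have : ‖(l * N * sin δ) • v u‖ ≤ l * (π / 2) * σ := by
              rw [norm_smul, norm_eq_abs, abs_mul, abs_of_nonneg (by positivity : 0 ≤ l * N)]
              calc l * N * |sin δ| * ‖v u‖ = l * (N * |sin δ|) * ‖v u‖ := by ring
                _ ≤ _ := by gcongr; exact h3 u
            have hpi : π ^ 2 ≤ 10 := by nlinarith [pi_lt_d2, pi_pos]
            calc ‖(l * N * sin δ) • v u‖ ^ 2 / 2 ≤ (l * (π / 2) * σ) ^ 2 / 2 := by gcongr
              _ = l ^ 2 * σ ^ 2 * π ^ 2 / 8 := by ring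
              _ ≤ l ^ 2 * σ ^ 2 * 10 / 8 := by gcongr
              _ = _ := by ring
      _ ≤ _ := by
        rw [lintegral_mul_const _ (by fun_prop)]
        gcongr
  calc _ ≤ ∫⁻ x, ∑ j ∈ Finset.range N, ENNReal.ofReal (1 / N : ℝ) *
        ENNReal.ofReal (exp (l * N * Φ (R (j + 1) x))) ∂(γ.prod γ) := by
        refine lintegral_mono fun x => ?_
        refine (ENNReal.ofReal_le_ofReal (hjensen x)).trans_eq ?_
        rw [ENNReal.ofReal_sum_of_nonneg fun j _ => by positivity]
        refine Finset.sum_congr rfl fun j _ => ?_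
        rw [← ENNReal.ofReal_mul (by positivity)]
    _ = ∑ j ∈ Finset.range N, ENNReal.ofReal (1 / N : ℝ) *
        ∫⁻ x, ENNReal.ofReal (exp (l * N * Φ x)) ∂(γ.prod γ) := by
      rw [lintegral_finsetSum _ fun j _ => by have := hRm (j + 1); fun_prop]
      refine Finset.sum_congr rfl fun j _ => ?_
      rw [lintegral_const_mul _ (by have := hRm (j + 1); fun_prop)]
      congr 1
      have hrot : (γ.prod γ).map (R (j + 1)) = γ.prod γ :=
        IsGaussian.map_rotation_eq_self (by simp [hγ]) _
      conv_rhs => rw [← hrot]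
      rw [lintegral_map (by fun_prop) (hRm _)]
    _ = ∫⁻ x, ENNReal.ofReal (exp (l * N * Φ x)) ∂(γ.prod γ) := by
      rw [Finset.sum_const, Finset.card_range, nsmul_eq_mul, ← mul_assoc, ← ENNReal.ofReal_natCast,
        ← ENNReal.ofReal_mul hN0.le, mul_one_div_cancel hN0.ne']
      simp
    _ ≤ _ := hΦint

/-- Deviation below a level for a maximum of linear forms of a Gaussian vector. -/
lemma stdGaussian_deviation {h : E → ℝ} {v : E → E} (hh : Measurable h)
    (hv : Measurable v) (h1 : ∀ w, h w = ⟪v w, w⟫) (h2 : ∀ w z, ⟪v w, z⟫ ≤ h z) {σ : ℝ}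
    (h3 : ∀ w, ‖v w‖ ≤ σ) {l : ℝ} (hl : 0 ≤ l) (a b : ℝ) :
    stdGaussian E {x | h x ≤ a} * stdGaussian E {x | b ≤ h x} ≤
      2 * ENNReal.ofReal (exp (5 / 4 * l ^ 2 * σ ^ 2 - l * (b - a))) := by
  set γ := stdGaussian E with hγ
  have hAm : MeasurableSet {x | h x ≤ a} := measurableSet_le hh measurable_const
  have hBm : MeasurableSet {x | b ≤ h x} := measurableSet_le measurable_const hh
  have key : ENNReal.ofReal (exp (l * (b - a))) * (γ {x | h x ≤ a} * γ {x | b ≤ h x}) ≤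
      2 * ENNReal.ofReal (exp (5 / 4 * l ^ 2 * σ ^ 2)) := by
    refine le_trans ?_ (lintegral_exp_sub_stdGaussian_le hh hv h1 h2 h3 hl)
    rw [← Measure.prod_prod, ← setLIntegral_const]
    refine le_trans (setLIntegral_mono (by fun_prop) fun x hx => ?_)
      (setLIntegral_le_lintegral _ _)
    refine ENNReal.ofReal_le_ofReal (exp_le_exp.mpr ?_)
    obtain ⟨hx1, hx2⟩ := hx
    simp only [Set.mem_ofPred_eq] at hx1 hx2
    gcongr
  calc _ = ENNReal.ofReal (exp (-(l * (b - a)))) *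
        (ENNReal.ofReal (exp (l * (b - a))) * (γ {x | h x ≤ a} * γ {x | b ≤ h x})) := by
        rw [← mul_assoc, ← ENNReal.ofReal_mul (exp_pos _).le, ← exp_add]; simp
    _ ≤ ENNReal.ofReal (exp (-(l * (b - a)))) *
        (2 * ENNReal.ofReal (exp (5 / 4 * l ^ 2 * σ ^ 2))) := by gcongr
    _ = _ := by
      rw [mul_left_comm, ← ENNReal.ofReal_mul (exp_pos _).le, ← exp_add]
      congr 3; ring

end GaussianConcentration

section GaussianMoments

/-- Absolute moments of a standard Gaussian variable. -/
def gaussMoment (p : ℝ) : ℝ≥0∞ := ∫⁻ x, ENNReal.ofReal |x| ^ p ∂(gaussianReal 0 1)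

/-- The constant in the lower bound for Gaussian moments. -/
def gaussMomentConst : ℝ := exp (-2) / 3

lemma gaussMomentConst_pos : 0 < gaussMomentConst := by unfold gaussMomentConst; positivity

lemma le_gaussMoment {p : ℝ} (hp : 1 ≤ p) :
    ENNReal.ofReal (gaussMomentConst * √p) ^ p ≤ gaussMoment p := by
  have hp0 : 0 < p := by linarith
  have hs : 1 ≤ √p := one_le_sqrt.mpr hp
  rw [gaussMoment, gaussianReal_of_var_ne_zero _ one_ne_zero,
    lintegral_withDensity_eq_lintegral_mul _ (by fun_prop) (by fun_prop)]
  calc _ ≤ ∫⁻ x in Set.Icc (√p) (2 * √p), ENNReal.ofReal (exp (-2 * p) / 3) *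
        ENNReal.ofReal (√p) ^ p := by
        rw [setLIntegral_const, volume_Icc, gaussMomentConst]
        calc _ ≤ ENNReal.ofReal (exp (-2 * p) / 3) * ENNReal.ofReal √p ^ p * 1 := by
              rw [mul_one, ENNReal.ofReal_rpow_of_pos (by positivity),
                ENNReal.ofReal_rpow_of_pos (by positivity), ← ENNReal.ofReal_mul (by positivity)]
              refine ENNReal.ofReal_le_ofReal ?_
              rw [mul_rpow (by positivity) (by positivity)]
              gcongr
              rw [div_rpow (exp_pos _).le (by norm_num), ← exp_mul]
              gcongr
              simpa using rpow_le_rpow_of_exponent_le (by norm_num : (1 : ℝ) ≤ 3) hp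
          _ ≤ _ := by
            gcongr
            rw [ENNReal.one_le_ofReal]
            linarith
    _ ≤ ∫⁻ x in Set.Icc (√p) (2 * √p), (gaussianPDF 0 1 * fun x => ENNReal.ofReal |x| ^ p) x := by
      refine setLIntegral_mono (by fun_prop) fun x hx => ?_
      simp only [Pi.mul_apply]
      obtain ⟨hx1, hx2⟩ := hx
      have hx0 : 0 ≤ x := (sqrt_nonneg p).trans hx1
      refine mul_le_mul' ?_ ?_
      · refine ENNReal.ofReal_le_ofReal ?_
        rw [gaussianPDFReal_def]
        have h1 : √(2 * π * ((1 : NNReal) : ℝ)) ≤ 3 := by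
          rw [sqrt_le_left (by norm_num)]
          simp; linarith [pi_lt_d2]
        have h2 : exp (-2 * p) ≤ exp (-(x - 0) ^ 2 / (2 * ((1 : NNReal) : ℝ))) := by
          refine exp_le_exp.mpr ?_
          have : x ^ 2 ≤ (2 * √p) ^ 2 := by gcongr
          rw [mul_pow, sq_sqrt hp0.le] at this
          simp; linarith
        have h4 : 0 < √(2 * π * ((1 : NNReal) : ℝ)) := by simp; positivity
        have h3 : (3 : ℝ)⁻¹ ≤ (√(2 * π * ((1 : NNReal) : ℝ)))⁻¹ := inv_anti₀ h4 h1
        calc exp (-2 * p) / 3 = 3⁻¹ * exp (-2 * p) := by ring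
          _ ≤ _ := mul_le_mul h3 h2 (exp_pos _).le (by positivity)
      · rw [abs_of_nonneg hx0]
        gcongr
    _ ≤ _ := setLIntegral_le_lintegral _ _

lemma gaussMoment_le {q : ℝ} (hq : 1 ≤ q) : gaussMoment q ≤ ENNReal.ofReal (3 * √q) ^ q := by
  have hq0 : 0 < q := by linarith
  have hpt : ∀ x : ℝ, ENNReal.ofReal |x| ^ q ≤
      ENNReal.ofReal ((√(2 * q)) ^ q) * ENNReal.ofReal (exp (x ^ 2 / 4)) := by
    intro x
    rw [ENNReal.ofReal_rpow_of_nonneg (abs_nonneg _) hq0.le, ← ENNReal.ofReal_mul (by positivity)]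
    refine ENNReal.ofReal_le_ofReal ?_
    have h1 := rpow_le_rpow_mul_exp (y := x ^ 2 / 4) (q := q / 2) (by positivity) (by positivity)
    have e1 : |x| ^ q = 4 ^ (q / 2) * (x ^ 2 / 4) ^ (q / 2) := by
      rw [← mul_rpow (by norm_num) (by positivity), mul_div_cancel₀ _ (by norm_num), ← sq_abs,
        ← rpow_natCast, ← rpow_mul (abs_nonneg _)]
      congr 1; push_cast; ring
    have e2 : √(2 * q) ^ q = 4 ^ (q / 2) * (q / 2) ^ (q / 2) := by
      rw [← mul_rpow (by norm_num) (by positivity), sqrt_eq_rpow, ← rpow_mul (by positivity)]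
      congr 1 <;> ring
    rw [e1, e2, mul_assoc]
    gcongr
  have hexp : ∫⁻ x : ℝ, ENNReal.ofReal (exp (x ^ 2 / 4)) ∂(gaussianReal 0 1) ≤
      ENNReal.ofReal (√2) := by
    rw [gaussianReal_of_var_ne_zero _ one_ne_zero,
      lintegral_withDensity_eq_lintegral_mul _ (by fun_prop) (by fun_prop)]
    have e3 : ∀ x : ℝ, (gaussianPDF 0 1 * fun x => ENNReal.ofReal (exp (x ^ 2 / 4))) x =
        ENNReal.ofReal ((√(2 * π))⁻¹ * exp (-(1 / 4) * x ^ 2)) := by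
      intro x
      simp only [Pi.mul_apply, gaussianPDF_def]
      rw [← ENNReal.ofReal_mul (gaussianPDFReal_nonneg _ _ _), gaussianPDFReal_def]
      simp only [NNReal.coe_one, mul_one, sub_zero]
      rw [mul_assoc, ← exp_add]
      congr 3; ring
    simp_rw [e3]
    rw [← ofReal_integral_eq_lintegral_ofReal
      ((integrable_exp_neg_mul_sq (by norm_num)).const_mul _) (ae_of_all _ fun x => by positivity),
      integral_const_mul, integral_gaussian]
    refine ENNReal.ofReal_le_ofReal (le_of_eq ?_)
    rw [← sqrt_inv, ← sqrt_mul (by positivity)]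
    congr 1
    field_simp; norm_num
  calc _ ≤ _ := lintegral_mono hpt
    _ ≤ ENNReal.ofReal ((√(2 * q)) ^ q) * ENNReal.ofReal (√2) := by
      rw [lintegral_const_mul _ (by fun_prop)]; gcongr
    _ ≤ _ := by
      rw [← ENNReal.ofReal_mul (by positivity), ENNReal.ofReal_rpow_of_pos (by positivity)]
      refine ENNReal.ofReal_le_ofReal ?_
      have h2 : √2 ≤ √2 ^ q := by
        simpa using rpow_le_rpow_of_exponent_le (one_le_sqrt.mpr one_le_two) hq
      calc √(2 * q) ^ q * √2 ≤ √(2 * q) ^ q * √2 ^ q := by gcongr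
        _ = (2 * √q) ^ q := by
          rw [← mul_rpow (by positivity) (by positivity), sqrt_mul (by norm_num)]
          congr 1
          have := mul_self_sqrt (by norm_num : (0 : ℝ) ≤ 2)
          linear_combination √q * this
        _ ≤ _ := by gcongr; norm_num

lemma lintegral_abs_inner_stdGaussian {E : Type*} [NormedAddCommGroup E] [InnerProductSpace ℝ E]
    [FiniteDimensional ℝ E] [MeasurableSpace E] [BorelSpace E] (w : E) {p : ℝ} (hp : 0 ≤ p) :
    ∫⁻ x, ENNReal.ofReal |⟪w, x⟫| ^ p ∂(stdGaussian E) =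
        ENNReal.ofReal ‖w‖ ^ p * gaussMoment p := by
  have h1 : (gaussianReal 0 1).map (‖w‖ * ·) = gaussianReal 0 (‖w‖ ^ 2).toNNReal := by
    rw [gaussianReal_map_const_mul]
    congr 1
    · simp
    · ext; simp
  have h2 : ∫⁻ x, ENNReal.ofReal |⟪w, x⟫| ^ p ∂(stdGaussian E) =
      ∫⁻ y, ENNReal.ofReal |y| ^ p ∂((stdGaussian E).map (fun x => ⟪w, x⟫)) := by
    rw [lintegral_map (by fun_prop) (by fun_prop)]
  rw [h2, stdGaussian_map_inner, ← h1, lintegral_map (by fun_prop) (by fun_prop), gaussMoment,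
    ← lintegral_const_mul _ (by fun_prop)]
  refine lintegral_congr fun x => ?_
  rw [abs_mul, abs_of_nonneg (norm_nonneg w), ENNReal.ofReal_mul (norm_nonneg w),
    ENNReal.mul_rpow_of_nonneg _ _ hp]

end GaussianMoments

section Geometry

open Metric Module

variable {F : Type*} [NormedAddCommGroup F] [InnerProductSpace ℝ F] [FiniteDimensional ℝ F]
  [MeasurableSpace F] [BorelSpace F]

lemma measurable_measure_closedBall (ρ : Measure F) [IsProbabilityMeasure ρ] (R : ℝ) :
    Measurable fun x => ρ (closedBall x R) :=
  measurable_measure_prodMk_left (s := {z : F × F | dist z.2 z.1 ≤ R})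
    (measurableSet_le (measurable_snd.dist measurable_fst) measurable_const)

lemma setLIntegral_measure_closedBall (ρ : Measure F) [IsProbabilityMeasure ρ] (R : ℝ) {S : Set F}
    (hS : MeasurableSet S) :
    ∫⁻ x in S, ρ (closedBall x R) = ∫⁻ y, volume (S ∩ closedBall y R) ∂ρ := by
  have hT : MeasurableSet {z : F × F | z.1 ∈ S ∧ dist z.2 z.1 ≤ R} :=
    (measurable_fst hS).inter (measurableSet_le (measurable_snd.dist measurable_fst) measurable_const)
  have h1 := Measure.prod_apply (μ := volume) (ν := ρ) hT
  rw [Measure.prod_apply_symm hT] at h1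
  rw [← lintegral_indicator hS]
  refine Eq.trans (lintegral_congr fun x => ?_) (h1.symm.trans (lintegral_congr fun y => ?_))
  · by_cases hx : x ∈ S
    · simp only [Set.indicator_of_mem hx, Set.preimage, Set.mem_ofPred_eq, hx, true_and]
      rfl
    · simp [Set.preimage, hx]
  · congr 1
    ext x
    simp [dist_comm]

lemma lintegral_measure_closedBall (ρ : Measure F) [IsProbabilityMeasure ρ] (R : ℝ) :
    ∫⁻ x, ρ (closedBall x R) = volume (closedBall (0 : F) R) := by
  have := setLIntegral_measure_closedBall ρ R MeasurableSet.univ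
  simp only [Measure.restrict_univ, Set.univ_inter] at this
  rw [this]
  simp_rw [fun y => Measure.addHaar_closedBall_center (volume : Measure F) y R]
  simp

omit [FiniteDimensional ℝ F] in
lemma IsLogConcaveMeasure.rpow_mul_measure_closedBall_le {ν : Measure F}
    (h : IsLogConcaveMeasure ν) (R : ℝ) (x y : F) {a b : ℝ} (ha : 0 < a) (hb : 0 < b)
    (hab : a + b = 1) :
    ν (closedBall x R) ^ a * ν (closedBall y R) ^ b ≤ ν (closedBall (a • x + b • y) R) := by
  refine h measurableSet_closedBall measurableSet_closedBall measurableSet_closedBall _ _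
    ha hb hab fun u hu w hw => ?_
  rw [mem_closedBall, dist_eq_norm] at hu hw ⊢
  have e : a • u + b • w - (a • x + b • y) = a • (u - x) + b • (w - y) := by module
  rw [e]
  calc _ ≤ ‖a • (u - x)‖ + ‖b • (w - y)‖ := norm_add_le _ _
    _ = a * ‖u - x‖ + b * ‖w - y‖ := by
      rw [norm_smul, norm_smul, norm_of_nonneg ha.le, norm_of_nonneg hb.le]
    _ ≤ a * R + b * R := by gcongr
    _ = R := by rw [← add_mul, hab, one_mul]

/-- The superlevel sets of a ball-averaged log-concave density carry most of the mass. -/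
lemma IsLogConcaveMeasure.setLIntegral_closedBall_le {ν : Measure F}
    (h : IsLogConcaveMeasure ν) [IsProbabilityMeasure ν] {R : ℝ}
    (h0 : 1 / 2 ≤ ν (closedBall 0 R)) (s : ℝ) :
    ∫⁻ x in {x | ν (closedBall x R) < ENNReal.ofReal (exp (-s))}, ν (closedBall x R) ≤
      ENNReal.ofReal (2 * exp (-s / 2) * 2 ^ finrank ℝ F) * volume (closedBall (0 : F) R) := by
  have hm := measurable_measure_closedBall ν R
  have hm' : Measurable fun x => ν (closedBall ((1 / 2 : ℝ) • x) R) :=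
    hm.comp (measurable_const_smul _)
  have hpt : ∀ x, ν (closedBall x R) ^ (1 / 2 : ℝ) ≤ 2 * ν (closedBall ((1 / 2 : ℝ) • x) R) := by
    intro x
    have h1 := h.rpow_mul_measure_closedBall_le R x 0 (a := 1 / 2) (b := 1 / 2) (by norm_num)
      (by norm_num) (by norm_num)
    rw [smul_zero, add_zero] at h1
    have h2 : (1 / 2 : ℝ≥0∞) ≤ ν (closedBall 0 R) ^ (1 / 2 : ℝ) := by
      refine h0.trans ?_
      conv_lhs => rw [← ENNReal.rpow_one (ν (closedBall 0 R))]
      exact ENNReal.rpow_le_rpow_of_exponent_ge prob_le_one (by norm_num)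
    calc ν (closedBall x R) ^ (1 / 2 : ℝ)
        = 2 * (ν (closedBall x R) ^ (1 / 2 : ℝ) * (1 / 2)) := by
          rw [mul_comm, mul_assoc, ENNReal.div_mul_cancel (by norm_num) (by norm_num), mul_one]
      _ ≤ _ := by
          gcongr
          refine le_trans ?_ h1
          gcongr
  calc _ ≤ ∫⁻ x in {x | ν (closedBall x R) < ENNReal.ofReal (exp (-s))},
        ENNReal.ofReal (2 * exp (-s / 2)) * ν (closedBall ((1 / 2 : ℝ) • x) R) := by
        refine setLIntegral_mono (hm'.const_mul _) fun x hx => ?_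
        simp only [Set.mem_ofPred_eq] at hx
        calc ν (closedBall x R) =
            ν (closedBall x R) ^ (1 / 2 : ℝ) * ν (closedBall x R) ^ (1 / 2 : ℝ) := by
              rw [← ENNReal.rpow_add_of_nonneg _ _ (by norm_num) (by norm_num)]; norm_num
          _ ≤ ENNReal.ofReal (exp (-s)) ^ (1 / 2 : ℝ) *
              (2 * ν (closedBall ((1 / 2 : ℝ) • x) R)) := by
              gcongr
              exact hpt x
          _ = _ := by
              rw [ENNReal.ofReal_rpow_of_pos (exp_pos _), ← exp_mul,
                ENNReal.ofReal_mul (by norm_num)]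
              simp only [ENNReal.ofReal_ofNat]
              rw [mul_left_comm, mul_assoc]
              congr 4; ring
    _ ≤ ∫⁻ x, ENNReal.ofReal (2 * exp (-s / 2)) * ν (closedBall ((1 / 2 : ℝ) • x) R) :=
      setLIntegral_le_lintegral _ _
    _ = _ := by
      rw [lintegral_const_mul _ hm']
      have h3 : ∫⁻ x : F, ν (closedBall ((1 / 2 : ℝ) • x) R) =
          ENNReal.ofReal (2 ^ finrank ℝ F) * volume (closedBall (0 : F) R) := by
        rw [← lintegral_measure_closedBall ν R, ← lintegral_map (μ := volume) hm (by fun_prop),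
          Measure.map_addHaar_smul _ (by norm_num), lintegral_smul_measure, smul_eq_mul]
        congr 2
        rw [abs_of_pos (by positivity)]
        simp
      rw [h3, ← mul_assoc, ← ENNReal.ofReal_mul (by positivity)]

omit [MeasurableSpace F] [BorelSpace F] in
/-- If a convex set containing the origin has support function at least `L` in each direction, its
closure contains the open ball of radius `L`. -/
lemma ball_subset_closure_of_forall_exists_inner {Q : Set F} (hQ : Convex ℝ Q)
    (h0 : (0 : F) ∈ Q) {L : ℝ}
    (h : ∀ t : F, ‖t‖ = 1 → ∃ q ∈ Q, L ≤ ⟪t, q⟫) : ball 0 L ⊆ closure Q := by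
  intro x hx
  by_contra hx'
  obtain ⟨φ, u, h1, h2⟩ := geometric_hahn_banach_closed_point hQ.closure isClosed_closure hx'
  obtain ⟨w, rfl⟩ := (InnerProductSpace.toDual ℝ F).surjective φ
  simp only [InnerProductSpace.toDual_apply_apply] at h1 h2
  rw [mem_ball_zero_iff] at hx
  rcases eq_or_ne w 0 with rfl | hw
  · have := h1 0 (subset_closure h0)
    simp at this h2; linarith
  have hw0 : 0 < ‖w‖ := norm_pos_iff.mpr hw
  obtain ⟨q, hq, hL⟩ := h (‖w‖⁻¹ • w) (by
    rw [norm_smul, norm_inv, norm_norm, inv_mul_cancel₀ hw0.ne'])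
  rw [inner_smul_left, conj_trivial, ← div_eq_inv_mul, le_div_iff₀ hw0] at hL
  have h3 := h1 q (subset_closure hq)
  have h4 := real_inner_le_norm w x
  nlinarith

/-- A log-concave probability measure which puts mass `1/2` on a ball of radius `R` has no
direction in which the `m`-tails are uniformly at least exponential in the dimension, unless `m`
is comparable to `R`. -/
theorem IsLogConcaveMeasure.le_of_forall_le_measure_inner {ν : Measure F}
    (h : IsLogConcaveMeasure ν) [IsProbabilityMeasure ν] (hF : 1 ≤ finrank ℝ F) {R m a : ℝ}
    (hR : 0 < R) (ha : 0 ≤ a) (h0 : 1 / 2 ≤ ν (closedBall 0 R))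
    (ht : ∀ t : F, ‖t‖ = 1 →
      ENNReal.ofReal (exp (-(a * finrank ℝ F))) ≤ ν {y | m ≤ |⟪t, y⟫|}) :
    m ≤ 5 * exp (4 * a + 8) * R := by
  set k := finrank ℝ F with hk
  have hk1 : (1 : ℝ) ≤ k := by exact_mod_cast hF
  have : Nontrivial F := nontrivial_of_finrank_pos (R := ℝ) (by omega)
  have hexp1 : 1 ≤ exp (4 * a + 8) := one_le_exp (by linarith)
  rcases le_or_gt m R with hmR | hmR
  · nlinarith
  set V := volume (closedBall (0 : F) R) with hV
  have hV0 : V ≠ 0 := (measure_closedBall_pos _ _ hR).ne'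
  have hVtop : V ≠ ∞ := measure_closedBall_lt_top.ne
  set s := (2 * a + 4) * k with hs
  set D := {x | ENNReal.ofReal (exp (-s)) ≤ ν (closedBall x R)} with hD
  have hfm := measurable_measure_closedBall ν R
  have hDc : Convex ℝ D := by
    refine convex_iff_forall_pos.mpr fun x hx y hy α β hα hβ hαβ => ?_
    refine le_trans ?_ (h.rpow_mul_measure_closedBall_le R x y hα hβ hαβ)
    calc ENNReal.ofReal (exp (-s)) = ENNReal.ofReal (exp (-s)) ^ (α + β) := by
          rw [hαβ, ENNReal.rpow_one]
      _ = ENNReal.ofReal (exp (-s)) ^ α * ENNReal.ofReal (exp (-s)) ^ β :=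
          ENNReal.rpow_add_of_nonneg _ _ hα.le hβ.le
      _ ≤ _ := by
          gcongr
          · exact hx
          · exact hy
  have hs4 : 4 ≤ s := by nlinarith
  have h0D : (0 : F) ∈ D := by
    refine le_trans ?_ h0
    rw [show (1 / 2 : ℝ≥0∞) = ENNReal.ofReal (1 / 2) by
      rw [ENNReal.ofReal_div_of_pos (by norm_num)]; simp]
    refine ENNReal.ofReal_le_ofReal ?_
    rw [exp_neg, inv_le_comm₀ (exp_pos _) (by norm_num)]
    linarith [add_one_le_exp s]
  have hsmall : ENNReal.ofReal (2 * exp (-s / 2) * 2 ^ k) < ENNReal.ofReal (exp (-(a * k))) := by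
    refine (ENNReal.ofReal_lt_ofReal_iff (exp_pos _)).mpr ?_
    have e1 : (2 : ℝ) < exp k := by
      have := exp_one_gt_d9
      have : exp 1 ≤ exp k := exp_le_exp.mpr hk1
      linarith
    have e2 : (2 : ℝ) ^ k ≤ exp k := by
      rw [← exp_one_pow k]
      gcongr
      linarith [exp_one_gt_d9]
    calc 2 * exp (-s / 2) * 2 ^ k ≤ 2 * exp (-s / 2) * exp k := by gcongr
      _ < exp k * exp (-s / 2) * exp k := by gcongr
      _ = _ := by
        rw [← exp_add, ← exp_add, hs]; congr 1; ring
  have hex : ∀ t : F, ‖t‖ = 1 → ∃ z ∈ D, m - R ≤ |⟪t, z⟫| := by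
    intro t ht1
    by_contra hcon
    push Not at hcon
    set S := {x : F | m - R ≤ |⟪t, x⟫|} with hS
    have hSm : MeasurableSet S := measurableSet_le measurable_const (by fun_prop)
    have hSD : S ⊆ {x | ν (closedBall x R) < ENNReal.ofReal (exp (-s))} := by
      intro x hx
      by_contra hx'
      rw [Set.mem_ofPred_eq, not_lt] at hx'
      exact absurd hx (not_le.mpr (hcon x hx'))
    have h1 : ENNReal.ofReal (exp (-(a * k))) * V ≤ ∫⁻ x in S, ν (closedBall x R) := by
      rw [setLIntegral_measure_closedBall ν R hSm]
      have hTm : MeasurableSet {y : F | m ≤ |⟪t, y⟫|} :=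
          measurableSet_le measurable_const (by fun_prop)
      calc _ ≤ ν {y | m ≤ |⟪t, y⟫|} * V := by gcongr; exact ht t ht1
        _ = ∫⁻ y in {y | m ≤ |⟪t, y⟫|}, V ∂ν := by rw [setLIntegral_const, mul_comm]
        _ = ∫⁻ y in {y | m ≤ |⟪t, y⟫|}, volume (S ∩ closedBall y R) ∂ν := by
          refine setLIntegral_congr_fun hTm fun y hy => ?_
          have hsub : closedBall y R ⊆ S := by
            intro x hx
            simp only [hS, Set.mem_ofPred_eq] at hy ⊢
            rw [mem_closedBall, dist_comm, dist_eq_norm] at hx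
            have e3 : |⟪t, y⟫| ≤ |⟪t, x⟫| + R := by
              have : ⟪t, y⟫ = ⟪t, x⟫ + ⟪t, y - x⟫ := by rw [inner_sub_right]; ring
              rw [this]
              refine (abs_add_le _ _).trans ?_
              gcongr
              refine (abs_real_inner_le_norm _ _).trans ?_
              rwa [ht1, one_mul]
            linarith
          simp only [Set.inter_eq_right.mpr hsub, hV, Measure.addHaar_closedBall_center]
        _ ≤ _ := setLIntegral_le_lintegral _ _
    have h2 := (h1.trans (lintegral_mono_set hSD)).trans (h.setLIntegral_closedBall_le h0 s)
    rw [← hk, ← hV, ENNReal.mul_le_mul_iff_left hV0 hVtop] at h2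
    exact absurd h2 (not_le.mpr hsmall)
  set Q := (fun x : F => (1 / 2 : ℝ) • x) '' (D - D) with hQ
  have hQc : Convex ℝ Q := (hDc.sub hDc).smul (1 / 2 : ℝ)
  have h0Q : (0 : F) ∈ Q := ⟨0, ⟨0, h0D, 0, h0D, by simp⟩, by simp⟩
  set L := (m - R) / 2 with hL
  have hLpos : 0 < L := by simp only [hL]; linarith
  have hball : ball 0 L ⊆ closure Q := by
    refine ball_subset_closure_of_forall_exists_inner hQc h0Q fun t ht1 => ?_
    obtain ⟨z, hz, hzm⟩ := hex t ht1
    rcases le_total 0 ⟪t, z⟫ with hs | hs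
    · refine ⟨(1 / 2 : ℝ) • (z - 0), ⟨z - 0, ⟨z, hz, 0, h0D, rfl⟩, rfl⟩, ?_⟩
      rw [abs_of_nonneg hs] at hzm
      rw [sub_zero, inner_smul_right, hL]; linarith
    · refine ⟨(1 / 2 : ℝ) • (0 - z), ⟨0 - z, ⟨0, h0D, z, hz, rfl⟩, rfl⟩, ?_⟩
      rw [abs_of_nonpos hs] at hzm
      rw [zero_sub, inner_smul_right, inner_neg_right, hL]; linarith
  set T : F × F → F := fun y => (1 / 2 : ℝ) • (y.1 - y.2) with hT
  have hTm : Measurable T := by fun_prop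
  set ρ := (ν.prod ν).map T with hρ
  have : IsProbabilityMeasure ρ := Measure.isProbabilityMeasure_map hTm.aemeasurable
  have hlow : ∀ x ∈ ball (0 : F) L, ENNReal.ofReal (exp (-(2 * s))) ≤ ρ (closedBall x (2 * R)) := by
    intro x hx
    obtain ⟨q, hq, hqx⟩ := Metric.mem_closure_iff.mp (hball hx) R hR
    obtain ⟨_, ⟨d, hd, d', hd', rfl⟩, rfl⟩ := hq
    rw [hρ, Measure.map_apply hTm measurableSet_closedBall]
    calc ENNReal.ofReal (exp (-(2 * s))) =
        ENNReal.ofReal (exp (-s)) * ENNReal.ofReal (exp (-s)) := by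
          rw [← ENNReal.ofReal_mul (exp_pos _).le, ← exp_add]; congr 2; ring
      _ ≤ ν (closedBall d R) * ν (closedBall d' R) := mul_le_mul' hd hd'
      _ = (ν.prod ν) (closedBall d R ×ˢ closedBall d' R) := (Measure.prod_prod _ _).symm
      _ ≤ _ := by
        refine measure_mono fun y hy => ?_
        obtain ⟨hy1, hy2⟩ := hy
        simp only [Set.mem_preimage, mem_closedBall, hT, dist_eq_norm] at hy1 hy2 hqx ⊢
        have e4 : (1 / 2 : ℝ) • (y.1 - y.2) - x =
            (1 / 2 : ℝ) • (y.1 - d) - (1 / 2 : ℝ) • (y.2 - d') - (x - (1 / 2 : ℝ) • (d - d')) := by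
          module
        rw [e4]
        calc _ ≤ ‖(1 / 2 : ℝ) • (y.1 - d)‖ + ‖(1 / 2 : ℝ) • (y.2 - d')‖ +
              ‖x - (1 / 2 : ℝ) • (d - d')‖ :=
              (norm_sub_le _ _).trans (by gcongr; exact norm_sub_le _ _)
          _ ≤ 1 / 2 * R + 1 / 2 * R + R := by
            rw [norm_smul, norm_smul, norm_of_nonneg (by norm_num : (0 : ℝ) ≤ 1 / 2)]
            gcongr
          _ = 2 * R := by ring
  have hvol : ENNReal.ofReal (exp (-(2 * s))) * volume (ball (0 : F) L) ≤
      volume (closedBall (0 : F) (2 * R)) := by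
    rw [← lintegral_measure_closedBall ρ (2 * R), ← setLIntegral_const]
    exact (setLIntegral_mono (measurable_measure_closedBall ρ _) hlow).trans
      (setLIntegral_le_lintegral _ _)
  rw [Measure.addHaar_ball _ _ hLpos.le, Measure.addHaar_closedBall _ _ (by positivity), ← hk,
    ← mul_assoc, ENNReal.mul_le_mul_iff_left (measure_ball_pos _ _ one_pos).ne'
      measure_ball_lt_top.ne, ← ENNReal.ofReal_mul (exp_pos _).le,
    ENNReal.ofReal_le_ofReal_iff (by positivity)] at hvol
  have e5 : exp (-(2 * s)) = exp (-(4 * a + 8)) ^ k := by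
    rw [← exp_nat_mul, hs]; congr 1; ring
  rw [e5, ← mul_pow, pow_le_pow_iff_left₀ (by positivity) (by positivity) (by omega), exp_neg,
    inv_mul_le_iff₀ (exp_pos _)] at hvol
  simp only [hL] at hvol
  nlinarith

end Geometry

section DirectionalMoment

set_option linter.unusedSectionVars false

variable {E : Type*} [NormedAddCommGroup E] [InnerProductSpace ℝ E] [FiniteDimensional ℝ E]
  [MeasurableSpace E] [BorelSpace E]

/-- The `L^p` norm of the linear functional `⟪z, ·⟫`. -/
def dirMoment (ν : Measure E) (p : ℝ) (z : E) : ℝ := (∫ x, |⟪z, x⟫| ^ p ∂ν) ^ (1 / p)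

/-- A subgradient of the directional moment. -/
def dirMomentGrad (ν : Measure E) (p : ℝ) (w : E) : E :=
  (dirMoment ν p w) ^ (1 - p) • ∫ x, (|⟪w, x⟫| ^ (p - 2) * ⟪w, x⟫) • x ∂ν

variable {ν : Measure E} {p : ℝ}

lemma dirMoment_nonneg (z : E) : 0 ≤ dirMoment ν p z :=
  rpow_nonneg (integral_nonneg fun _ => by positivity) _

lemma measurable_dirMoment [SFinite ν] : Measurable (dirMoment ν p) := by
  have h : StronglyMeasurable fun z : E => ∫ x, |⟪z, x⟫| ^ p ∂ν :=
    StronglyMeasurable.integral_prod_right' (f := fun y : E × E => |⟪y.1, y.2⟫| ^ p)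
      (Measurable.stronglyMeasurable (by fun_prop))
  exact h.measurable.pow_const _

lemma measurable_dirMomentGrad [SFinite ν] : Measurable (dirMomentGrad ν p) := by
  have h : StronglyMeasurable fun w : E => ∫ x, (|⟪w, x⟫| ^ (p - 2) * ⟪w, x⟫) • x ∂ν :=
    StronglyMeasurable.integral_prod_right'
      (f := fun y : E × E => (|⟪y.1, y.2⟫| ^ (p - 2) * ⟪y.1, y.2⟫) • y.2)
      (Measurable.stronglyMeasurable (by fun_prop))
  exact (measurable_dirMoment.pow_const _).smul h.measurable

lemma integrable_abs_inner_rpow (hp : 2 ≤ p)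
    (hint : Integrable (fun x => ‖x‖ ^ p) ν) (z : E) :
    Integrable (fun x => |⟪z, x⟫| ^ p) ν := by
  refine (hint.const_mul (‖z‖ ^ p)).mono' (Measurable.aestronglyMeasurable (by fun_prop))
      (ae_of_all _ fun x => ?_)
  rw [norm_of_nonneg (by positivity), ← mul_rpow (by positivity) (by positivity)]
  gcongr
  exact abs_real_inner_le_norm _ _

lemma ofReal_dirMoment_rpow (hp : 2 ≤ p) (hint : Integrable (fun x => ‖x‖ ^ p) ν) (z : E) :
    ENNReal.ofReal (dirMoment ν p z) ^ p = ∫⁻ x, ENNReal.ofReal |⟪z, x⟫| ^ p ∂ν := by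
  have hp0 : 0 < p := by linarith
  have h0 : 0 ≤ ∫ x, |⟪z, x⟫| ^ p ∂ν := integral_nonneg fun _ => by positivity
  rw [ENNReal.ofReal_rpow_of_nonneg (dirMoment_nonneg z) hp0.le, dirMoment, ← rpow_mul h0,
    one_div_mul_cancel hp0.ne', rpow_one,
    ofReal_integral_eq_lintegral_ofReal (integrable_abs_inner_rpow hp hint z)
      (ae_of_all _ fun _ => by positivity)]
  refine lintegral_congr fun x => ?_
  rw [ENNReal.ofReal_rpow_of_nonneg (by positivity) hp0.le]

lemma dirMoment_rpow (hp : 2 ≤ p) (z : E) : dirMoment ν p z ^ p = ∫ x, |⟪z, x⟫| ^ p ∂ν := by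
  have hp0 : 0 < p := by linarith
  rw [dirMoment, ← rpow_mul (integral_nonneg fun _ => by positivity), one_div_mul_cancel hp0.ne',
    rpow_one]

lemma dirMoment_smul (hp : 2 ≤ p) (c : ℝ) (z : E) :
    dirMoment ν p (c • z) = |c| * dirMoment ν p z := by
  have hp0 : 0 < p := by linarith
  simp only [dirMoment, inner_smul_left, conj_trivial, abs_mul]
  simp_rw [mul_rpow (abs_nonneg c) (abs_nonneg _)]
  rw [integral_const_mul, mul_rpow (by positivity) (integral_nonneg fun _ => by positivity),
    ← rpow_mul (abs_nonneg c), mul_one_div_cancel hp0.ne', rpow_one]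

lemma integrable_dirMomentGrad (hp : 2 ≤ p) (hint : Integrable (fun x => ‖x‖ ^ p) ν) (w : E) :
    Integrable (fun x => (|⟪w, x⟫| ^ (p - 2) * ⟪w, x⟫) • x) ν := by
  refine (hint.const_mul (‖w‖ ^ (p - 1))).mono' (Measurable.aestronglyMeasurable (by fun_prop))
      (ae_of_all _ fun x => ?_)
  have e1 : ‖(|⟪w, x⟫| ^ (p - 2) * ⟪w, x⟫) • x‖ = |⟪w, x⟫| ^ (p - 1) * ‖x‖ := by
    rw [norm_smul, norm_mul, norm_eq_abs, norm_eq_abs, abs_of_nonneg (by positivity :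
      0 ≤ |⟪w, x⟫| ^ (p - 2))]
    conv_lhs => enter [1, 2]; rw [← rpow_one |⟪w, x⟫|]
    rw [← rpow_add_of_nonneg (abs_nonneg _) (by linarith) (by norm_num)]
    congr 2; ring
  rw [e1]
  calc |⟪w, x⟫| ^ (p - 1) * ‖x‖ ≤ (‖w‖ * ‖x‖) ^ (p - 1) * ‖x‖ ^ (1 : ℝ) := by
        rw [rpow_one]
        gcongr
        · linarith
        · exact abs_real_inner_le_norm _ _
    _ = _ := by
      rw [mul_rpow (by positivity) (by positivity), mul_assoc,
        ← rpow_add_of_nonneg (norm_nonneg _) (by linarith) (by norm_num)]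
      congr 2; ring

lemma inner_dirMomentGrad (hp : 2 ≤ p) (hint : Integrable (fun x => ‖x‖ ^ p) ν) (w z : E) :
    ⟪dirMomentGrad ν p w, z⟫ = dirMoment ν p w ^ (1 - p) *
      ∫ x, |⟪w, x⟫| ^ (p - 2) * ⟪w, x⟫ * ⟪z, x⟫ ∂ν := by
  rw [dirMomentGrad, inner_smul_left, conj_trivial, real_inner_comm,
    ← integral_inner (integrable_dirMomentGrad hp hint w)]
  simp_rw [inner_smul_right]

lemma dirMoment_eq_inner (hp : 2 ≤ p) (hint : Integrable (fun x => ‖x‖ ^ p) ν) (w : E) :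
    dirMoment ν p w = ⟪dirMomentGrad ν p w, w⟫ := by
  rw [inner_dirMomentGrad hp hint]
  have e1 : ∀ x, |⟪w, x⟫| ^ (p - 2) * ⟪w, x⟫ * ⟪w, x⟫ = |⟪w, x⟫| ^ p := by
    intro x
    rw [mul_assoc, ← abs_mul_abs_self, ← pow_two, ← rpow_natCast,
      ← rpow_add_of_nonneg (abs_nonneg _) (by linarith) (by norm_num)]
    congr 1; push_cast; ring
  simp_rw [e1]
  rw [← dirMoment_rpow hp]
  rcases (dirMoment_nonneg (ν := ν) (p := p) w).eq_or_lt with h0 | h0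
  · rw [← h0, zero_rpow (by linarith), zero_mul]
  · rw [← rpow_add h0]; simp

lemma inner_dirMomentGrad_le (hp : 2 ≤ p) (hint : Integrable (fun x => ‖x‖ ^ p) ν) (w z : E) :
    ⟪dirMomentGrad ν p w, z⟫ ≤ dirMoment ν p z := by
  have hp0 : 0 < p := by linarith
  rw [inner_dirMomentGrad hp hint]
  rcases (dirMoment_nonneg (ν := ν) (p := p) w).eq_or_lt with h0 | h0
  · rw [← h0, zero_rpow (by linarith), zero_mul]
    exact dirMoment_nonneg z
  have hq : (p / (p - 1)).HolderConjugate p := by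
    refine (Real.holderConjugate_iff.mpr ⟨by linarith, ?_⟩).symm
    field_simp; ring
  have hpow : ∀ x : E, (|⟪w, x⟫| ^ (p - 1)) ^ (p / (p - 1)) = |⟪w, x⟫| ^ p := fun x => by
    rw [← rpow_mul (abs_nonneg _), mul_div_cancel₀ _ (by linarith)]
  have hH := integral_mul_le_Lp_mul_Lq_of_nonneg (μ := ν) hq (f := fun x => |⟪w, x⟫| ^ (p - 1))
    (g := fun x => |⟪z, x⟫|) (ae_of_all _ fun _ => by positivity)
    (ae_of_all _ fun _ => by positivity)
    (by
      rw [← integrable_norm_rpow_iff (Measurable.aestronglyMeasurable (by fun_prop))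
        (by simpa using hq.pos) ENNReal.ofReal_ne_top,
        ENNReal.toReal_ofReal hq.nonneg]
      refine (integrable_abs_inner_rpow hp hint w).congr (ae_of_all _ fun x => ?_)
      simp only [norm_eq_abs, abs_rpow_of_nonneg (abs_nonneg _), abs_abs, hpow])
    (by
      rw [← integrable_norm_rpow_iff (Measurable.aestronglyMeasurable (by fun_prop))
        (by simpa using hp0) ENNReal.ofReal_ne_top,
        ENNReal.toReal_ofReal hp0.le]
      refine (integrable_abs_inner_rpow hp hint z).congr (ae_of_all _ fun x => ?_)
      simp only [norm_eq_abs, abs_abs])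
  simp_rw [hpow] at hH
  have hle : ∫ x, |⟪w, x⟫| ^ (p - 2) * ⟪w, x⟫ * ⟪z, x⟫ ∂ν ≤
      ∫ x, |⟪w, x⟫| ^ (p - 1) * |⟪z, x⟫| ∂ν := by
    have hL : Integrable (fun x => |⟪w, x⟫| ^ (p - 2) * ⟪w, x⟫ * ⟪z, x⟫) ν := by
      simpa [inner_smul_right] using (integrable_dirMomentGrad hp hint w).const_inner (𝕜 := ℝ) z
    refine (integral_mono hL hL.abs fun x => le_abs_self _).trans_eq ?_
    refine integral_congr_ae (ae_of_all _ fun x => ?_)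
    simp only [abs_mul, abs_rpow_of_nonneg (abs_nonneg _), abs_abs]
    conv_lhs => enter [1, 2]; rw [← rpow_one |⟪w, x⟫|]
    rw [← rpow_add_of_nonneg (abs_nonneg _) (by linarith) (by norm_num)]
    congr 2; ring
  calc _ ≤ dirMoment ν p w ^ (1 - p) * ((∫ x, |⟪w, x⟫| ^ p ∂ν) ^ (1 / (p / (p - 1))) *
        dirMoment ν p z) := by
        gcongr
        exact hle.trans hH
    _ = _ := by
      rw [← dirMoment_rpow hp w, ← rpow_mul h0.le, ← mul_assoc, ← rpow_add h0]
      have : 1 - p + p * (1 / (p / (p - 1))) = 0 := by field_simp; ring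
      rw [this, rpow_zero, one_mul]

lemma norm_dirMomentGrad_le (hp : 2 ≤ p) (hint : Integrable (fun x => ‖x‖ ^ p) ν) {σ : ℝ}
    (hσ : ∀ z, dirMoment ν p z ≤ σ * ‖z‖) (hσ0 : 0 ≤ σ) (w : E) : ‖dirMomentGrad ν p w‖ ≤ σ := by
  have h1 := (inner_dirMomentGrad_le hp hint w (dirMomentGrad ν p w)).trans (hσ _)
  rw [real_inner_self_eq_norm_mul_norm] at h1
  rcases (norm_nonneg (dirMomentGrad ν p w)).eq_or_lt with h0 | h0
  · rwa [← h0]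
  · exact le_of_mul_le_mul_right h1 h0

lemma dirMoment_add_le (hp : 2 ≤ p) (hint : Integrable (fun x => ‖x‖ ^ p) ν) (z w : E) :
    dirMoment ν p (z + w) ≤ dirMoment ν p z + dirMoment ν p w := by
  rw [dirMoment_eq_inner hp hint (z + w), inner_add_right]
  exact add_le_add (inner_dirMomentGrad_le hp hint _ _) (inner_dirMomentGrad_le hp hint _ _)

end DirectionalMoment

section SmallBall

variable {E : Type*} [NormedAddCommGroup E] [InnerProductSpace ℝ E] [FiniteDimensional ℝ E]
  [MeasurableSpace E] [BorelSpace E] {ν : Measure E} [IsProbabilityMeasure ν] {p : ℝ}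

lemma lintegral_lintegral_inner_stdGaussian {q : ℝ} (hq : 0 ≤ q) :
    ∫⁻ z, ∫⁻ x, ENNReal.ofReal |⟪z, x⟫| ^ q ∂ν ∂(stdGaussian E) =
      gaussMoment q * ∫⁻ x, ENNReal.ofReal ‖x‖ ^ q ∂ν := by
  rw [lintegral_lintegral_swap (by fun_prop), ← lintegral_const_mul _ (by fun_prop)]
  refine lintegral_congr fun x => ?_
  rw [mul_comm, ← lintegral_abs_inner_stdGaussian x hq]
  simp_rw [real_inner_comm]

lemma lintegral_dirMoment_stdGaussian (hp : 2 ≤ p) (hint : Integrable (fun x => ‖x‖ ^ p) ν) :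
    ∫⁻ z, ENNReal.ofReal (dirMoment ν p z) ^ p ∂(stdGaussian E) =
      gaussMoment p * ∫⁻ x, ENNReal.ofReal ‖x‖ ^ p ∂ν := by
  rw [← lintegral_lintegral_inner_stdGaussian (by linarith)]
  simp_rw [ofReal_dirMoment_rpow hp hint]

lemma lintegral_dirMoment_two_mul_le (hp : 2 ≤ p) (hint : Integrable (fun x => ‖x‖ ^ p) ν) :
    ∫⁻ z, ENNReal.ofReal (dirMoment ν p z) ^ (2 * p) ∂(stdGaussian E) ≤
      gaussMoment (2 * p) * ∫⁻ x, ENNReal.ofReal ‖x‖ ^ (2 * p) ∂ν := by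
  have hp0 : 0 < p := by linarith
  rw [← lintegral_lintegral_inner_stdGaussian (by linarith)]
  refine lintegral_mono fun z => ?_
  set I := ∫⁻ x, ENNReal.ofReal |⟪z, x⟫| ^ (2 * p) ∂ν with hI
  have h1 := lintegral_rpow_le_of_exponent_le (ν := ν) (f := fun x => ENNReal.ofReal |⟪z, x⟫|)
    (by fun_prop) hp0 (by linarith : p ≤ 2 * p) (m := I ^ (1 / (2 * p)))
    (by rw [← ENNReal.rpow_mul, one_div_mul_cancel (by positivity), ENNReal.rpow_one])
  rw [← ofReal_dirMoment_rpow hp hint, ENNReal.rpow_le_rpow_iff hp0] at h1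
  refine (ENNReal.rpow_le_rpow h1 (by positivity : 0 ≤ 2 * p)).trans_eq ?_
  rw [← ENNReal.rpow_mul, one_div_mul_cancel (by positivity), ENNReal.rpow_one]

/-- The constant in the Paley–Zygmund bound for directional moments of Gaussian vectors. -/
def pzConst : ℝ := 18 * momentConst / gaussMomentConst

lemma pzConst_pos : 0 < pzConst :=
  div_pos (mul_pos (by norm_num) momentConst_pos) gaussMomentConst_pos

lemma le_stdGaussian_dirMoment (hν : IsLogConcaveMeasure ν) (hp : 2 ≤ p)
    (hint : Integrable (fun x => ‖x‖ ^ p) ν) {W : ℝ} (hW : 0 < W)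
    (hWeq : ∫⁻ x, ENNReal.ofReal ‖x‖ ^ p ∂ν = ENNReal.ofReal W ^ p) :
    ENNReal.ofReal (pzConst ^ (-(2 * p))) ≤
      stdGaussian E {z | gaussMomentConst * √p * W / 2 ≤ dirMoment ν p z} := by
  have hp0 : 0 < p := by linarith
  have hc := gaussMomentConst_pos
  have hm := momentConst_pos
  have h1 : ENNReal.ofReal (gaussMomentConst * √p * W) ^ p ≤
      ∫⁻ z, ENNReal.ofReal (dirMoment ν p z) ^ p ∂(stdGaussian E) := by
    rw [lintegral_dirMoment_stdGaussian hp hint, hWeq, ENNReal.ofReal_mul (by positivity),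
      ENNReal.mul_rpow_of_nonneg _ _ hp0.le]
    gcongr
    exact le_gaussMoment (by linarith)
  have h2 : ∫⁻ z, ENNReal.ofReal (dirMoment ν p z) ^ (2 * p) ∂(stdGaussian E) ≤
      ENNReal.ofReal (9 * momentConst / gaussMomentConst * (gaussMomentConst * √p * W)) ^
        (2 * p) := by
    have h3 := hν.lintegral_rpow_le (normSeminorm ℝ E) (by simpa using measurable_norm) (p := p)
      (q := 2 * p) (by linarith) (by linarith) hW.le hWeq.le
    rw [show 2 * p / p = 2 by field_simp] at h3
    refine (lintegral_dirMoment_two_mul_le hp hint).trans ?_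
    refine (mul_le_mul' (gaussMoment_le (by linarith)) h3).trans ?_
    rw [← ENNReal.mul_rpow_of_nonneg _ _ (by positivity), ← ENNReal.ofReal_mul (by positivity)]
    refine ENNReal.rpow_le_rpow (ENNReal.ofReal_le_ofReal ?_) (by positivity)
    have e1 : 9 * momentConst / gaussMomentConst * (gaussMomentConst * √p * W) =
        9 * momentConst * √p * W := by field_simp
    rw [e1, sqrt_mul (by norm_num)]
    have e2 : √2 ≤ 3 / 2 := by rw [sqrt_le_left (by norm_num)]; norm_num
    calc 3 * (√2 * √p) * (momentConst * 2 * W) = √2 * (6 * (√p * momentConst * W)) := by ring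
      _ ≤ 3 / 2 * (6 * (√p * momentConst * W)) := by gcongr
      _ = _ := by ring
  have h4 := paley_zygmund_rpow (ν := stdGaussian E)
    (f := fun z => ENNReal.ofReal (dirMoment ν p z)) (measurable_dirMoment.ennreal_ofReal)
    (by linarith) (by positivity) (by positivity) h1 h2
  rw [show 2 * (9 * momentConst / gaussMomentConst) = pzConst by rw [pzConst]; ring] at h4
  refine h4.trans (measure_mono fun z hz => ?_)
  simp only [Set.mem_ofPred_eq] at hz ⊢
  rwa [ENNReal.ofReal_le_ofReal_iff (dirMoment_nonneg z)] at hz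

lemma stdGaussian_dirMoment_le (hν : IsLogConcaveMeasure ν) (hp : 2 ≤ p)
    (hint : Integrable (fun x => ‖x‖ ^ p) ν) {W K : ℝ} (hW : 0 < W) (hK : 0 < K)
    (hWeq : ∫⁻ x, ENNReal.ofReal ‖x‖ ^ p ∂ν = ENNReal.ofReal W ^ p)
    (hσ : ∀ z, dirMoment ν p z ≤ W / K * ‖z‖) :
    stdGaussian E {z | dirMoment ν p z ≤ gaussMomentConst * √p * W / 4} ≤
      2 * ENNReal.ofReal (pzConst ^ (2 * p) * exp (-(gaussMomentConst ^ 2 * K ^ 2 / 80 * p))) := by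
  have hp0 : 0 < p := by linarith
  have hc := gaussMomentConst_pos
  have hz := pzConst_pos
  set M := gaussMomentConst * √p * W with hM
  have hdev := stdGaussian_deviation (l := M * K ^ 2 / (10 * W ^ 2)) measurable_dirMoment
    measurable_dirMomentGrad (dirMoment_eq_inner hp hint) (inner_dirMomentGrad_le hp hint)
    (norm_dirMomentGrad_le hp hint hσ (by positivity)) (by positivity) (M / 4) (M / 2)
  have e1 : 5 / 4 * (M * K ^ 2 / (10 * W ^ 2)) ^ 2 * (W / K) ^ 2 -
      M * K ^ 2 / (10 * W ^ 2) * (M / 2 - M / 4) = -(gaussMomentConst ^ 2 * K ^ 2 / 80 * p) := by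
    rw [hM]
    have : √p ^ 2 = p := sq_sqrt hp0.le
    field_simp
    rw [this]; ring
  rw [e1] at hdev
  have h2 := (mul_le_mul_right (le_stdGaussian_dirMoment hν hp hint hW hWeq)
    (stdGaussian E {z | dirMoment ν p z ≤ M / 4})).trans hdev
  calc _ = ENNReal.ofReal (pzConst ^ (2 * p)) * (stdGaussian E {z | dirMoment ν p z ≤ M / 4} *
        ENNReal.ofReal (pzConst ^ (-(2 * p)))) := by
        rw [mul_left_comm, ← ENNReal.ofReal_mul (by positivity), ← rpow_add hz]; simp
    _ ≤ ENNReal.ofReal (pzConst ^ (2 * p)) *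
        (2 * ENNReal.ofReal (exp (-(gaussMomentConst ^ 2 * K ^ 2 / 80 * p)))) := by gcongr
    _ = _ := by rw [mul_left_comm, ← ENNReal.ofReal_mul (by positivity)]

end SmallBall

section GaussianCombination

lemma exists_le_three_mul {α : Type*} [MeasurableSpace α] {P : Measure α} [IsProbabilityMeasure P]
    {f₁ f₂ f₃ : α → ℝ≥0∞} (h₁ : Measurable f₁) (h₂ : Measurable f₂) (h₃ : Measurable f₃)
    {a₁ a₂ a₃ : ℝ≥0∞} (e₁ : ∫⁻ x, f₁ x ∂P ≤ a₁) (e₂ : ∫⁻ x, f₂ x ∂P ≤ a₂)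
    (e₃ : ∫⁻ x, f₃ x ∂P ≤ a₃) (p₁ : a₁ ≠ 0) (p₂ : a₂ ≠ 0) (p₃ : a₃ ≠ 0)
    (t₁ : a₁ ≠ ∞) (t₂ : a₂ ≠ ∞) (t₃ : a₃ ≠ ∞) :
    ∃ x, f₁ x ≤ 3 * a₁ ∧ f₂ x ≤ 3 * a₂ ∧ f₃ x ≤ 3 * a₃ := by
  have key : ∫⁻ x, (f₁ x / a₁ + f₂ x / a₂ + f₃ x / a₃) ∂P ≤ 3 := by
    simp_rw [ENNReal.div_eq_inv_mul]
    rw [lintegral_add_right _ (by fun_prop), lintegral_add_right _ (by fun_prop),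
      lintegral_const_mul _ h₁, lintegral_const_mul _ h₂, lintegral_const_mul _ h₃]
    calc _ ≤ a₁⁻¹ * a₁ + a₂⁻¹ * a₂ + a₃⁻¹ * a₃ := by gcongr
      _ = 3 := by
        rw [ENNReal.inv_mul_cancel p₁ t₁, ENNReal.inv_mul_cancel p₂ t₂,
          ENNReal.inv_mul_cancel p₃ t₃]; norm_num
  obtain ⟨x, hx⟩ := exists_le_lintegral (μ := P)
    (f := fun x => f₁ x / a₁ + f₂ x / a₂ + f₃ x / a₃) (by fun_prop)
  have hx := hx.trans key
  refine ⟨x, ?_, ?_, ?_⟩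
  · rw [← ENNReal.div_le_iff p₁ t₁]; exact (le_self_add.trans le_self_add).trans hx
  · rw [← ENNReal.div_le_iff p₂ t₂]; exact (le_add_self.trans le_self_add).trans hx
  · rw [← ENNReal.div_le_iff p₃ t₃]; exact le_add_self.trans hx

variable {E : Type*} [NormedAddCommGroup E] [InnerProductSpace ℝ E] [FiniteDimensional ℝ E]
  [MeasurableSpace E] [BorelSpace E]

lemma map_sum_smul_pi_stdGaussian {k : ℕ} (t : EuclideanSpace ℝ (Fin k)) :
    (Measure.pi fun _ : Fin k => stdGaussian E).map (fun g => ∑ i, t i • g i) =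
      (stdGaussian E).map (‖t‖ • ·) := by
  have hm : Measurable fun g : Fin k → E => ∑ i, t i • g i := by fun_prop
  have := Measure.isProbabilityMeasure_map (μ := Measure.pi fun _ : Fin k => stdGaussian E)
    hm.aemeasurable
  have := Measure.isProbabilityMeasure_map (μ := stdGaussian E)
    (f := fun z : E => ‖t‖ • z) (by fun_prop)
  refine Measure.ext_of_charFun ?_
  ext u
  rw [charFun_map_smul, charFun_stdGaussian, charFun_apply, integral_map hm.aemeasurable
    (by fun_prop)]
  have h1 : ∀ g : Fin k → E, Complex.exp (⟪∑ i, t i • g i, u⟫ * Complex.I) =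
      ∏ i, Complex.exp (⟪g i, t i • u⟫ * Complex.I) := by
    intro g
    rw [← Complex.exp_sum, ← Finset.sum_mul]
    congr 2
    rw [sum_inner, Complex.ofReal_sum]
    simp [inner_smul_left, inner_smul_right]
  simp_rw [h1]
  rw [integral_fintype_prod_eq_prod (μ := fun _ : Fin k => stdGaussian E)
    (f := fun i z => Complex.exp (⟪z, t i • u⟫ * Complex.I))]
  simp_rw [← charFun_apply, charFun_stdGaussian]
  rw [← Complex.exp_sum]
  congr 1
  rw [← Finset.sum_div, Finset.sum_neg_distrib]
  congr 2
  simp_rw [norm_smul]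
  push_cast
  simp_rw [mul_pow]
  rw [← Finset.sum_mul]
  congr 1
  norm_cast
  rw [norm_norm, EuclideanSpace.real_norm_sq_eq]
  simp

lemma lintegral_comp_sum_smul_pi_stdGaussian {k : ℕ} (t : EuclideanSpace ℝ (Fin k))
    {f : E → ℝ≥0∞} (hf : Measurable f) :
    ∫⁻ g, f (∑ i, t i • g i) ∂(Measure.pi fun _ : Fin k => stdGaussian E) =
      ∫⁻ z, f (‖t‖ • z) ∂(stdGaussian E) := by
  rw [← lintegral_map hf (by fun_prop : Measurable fun g : Fin k → E => ∑ i, t i • g i),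
    map_sum_smul_pi_stdGaussian, lintegral_map hf (by fun_prop)]

end GaussianCombination

section GaussianSection

variable {E : Type*} [NormedAddCommGroup E] [InnerProductSpace ℝ E] [FiniteDimensional ℝ E]
  [MeasurableSpace E] [BorelSpace E] {ν : Measure E} [IsProbabilityMeasure ν] {p : ℝ}

lemma lintegral_sum_abs_inner_pi_stdGaussian_le (k : ℕ) {ρ : ℝ}
    (hρ : ∫⁻ x, ENNReal.ofReal ‖x‖ ^ (2 : ℝ) ∂ν ≤ ENNReal.ofReal ρ ^ (2 : ℝ)) :
    ∫⁻ g, ∫⁻ x, ∑ i, ENNReal.ofReal |⟪g i, x⟫| ^ (2 : ℝ) ∂ν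
        ∂(Measure.pi fun _ : Fin k => stdGaussian E) ≤
      k * (18 * ENNReal.ofReal ρ ^ (2 : ℝ)) := by
  have h1 : ∀ g : Fin k → E, ∫⁻ x, ∑ i, ENNReal.ofReal |⟪g i, x⟫| ^ (2 : ℝ) ∂ν =
      ∑ i, ∫⁻ x, ENNReal.ofReal |⟪g i, x⟫| ^ (2 : ℝ) ∂ν := fun g =>
    lintegral_finsetSum _ fun i _ => by fun_prop
  have hm : Measurable fun z : E => ∫⁻ x, ENNReal.ofReal |⟪z, x⟫| ^ (2 : ℝ) ∂ν :=
    Measurable.lintegral_prod_right' (f := fun y : E × E => ENNReal.ofReal |⟪y.1, y.2⟫| ^ (2 : ℝ))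
      (by fun_prop)
  simp_rw [h1]
  rw [lintegral_finsetSum (f := fun i (g : Fin k → E) => ∫⁻ x, ENNReal.ofReal |⟪g i, x⟫| ^ (2 : ℝ) ∂ν)
    _ fun i _ => hm.comp (measurable_pi_apply i)]
  have h2 : ∀ i : Fin k, ∫⁻ g, ∫⁻ x, ENNReal.ofReal |⟪g i, x⟫| ^ (2 : ℝ) ∂ν
      ∂(Measure.pi fun _ : Fin k => stdGaussian E) ≤ 18 * ENNReal.ofReal ρ ^ (2 : ℝ) := by
    intro i
    rw [(measurePreserving_eval (fun _ : Fin k => stdGaussian E) i).lintegral_comp hm,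
      lintegral_lintegral_inner_stdGaussian (by norm_num)]
    refine mul_le_mul' ((gaussMoment_le (by norm_num)).trans_eq ?_) hρ
    rw [ENNReal.ofReal_rpow_of_nonneg (by positivity) (by norm_num), rpow_two, mul_pow,
      sq_sqrt (by norm_num)]
    norm_num
  refine (Finset.sum_le_sum fun i _ => h2 i).trans_eq ?_
  simp

lemma exists_gaussian_section (hν : IsLogConcaveMeasure ν) (hp : 2 ≤ p)
    (hint : Integrable (fun x => ‖x‖ ^ p) ν) {W K ρ : ℝ} (hW : 0 < W) (hK : 0 < K)
    (hWeq : ∫⁻ x, ENNReal.ofReal ‖x‖ ^ p ∂ν = ENNReal.ofReal W ^ p)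
    (hσ : ∀ z, dirMoment ν p z ≤ W / K * ‖z‖) (hρ0 : 0 < ρ)
    (hρ : ∫⁻ x, ENNReal.ofReal ‖x‖ ^ (2 : ℝ) ∂ν ≤ ENNReal.ofReal ρ ^ (2 : ℝ)) {k : ℕ}
    (hk : k ≠ 0) :
    ∃ g : Fin k → E,
      ∫⁻ x, ∑ i, ENNReal.ofReal |⟪g i, x⟫| ^ (2 : ℝ) ∂ν ≤
        3 * (k * (18 * ENNReal.ofReal ρ ^ (2 : ℝ))) ∧
      volume {t : EuclideanSpace ℝ (Fin k) | t ∈ Metric.closedBall 0 2 ∧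
        dirMoment ν p (∑ i, t i • g i) ≤ gaussMomentConst * √p * W / 4 * ‖t‖} ≤
        3 * (2 * ENNReal.ofReal (pzConst ^ (2 * p) * exp (-(gaussMomentConst ^ 2 * K ^ 2 / 80 * p)))
          * volume (Metric.closedBall (0 : EuclideanSpace ℝ (Fin k)) 2)) ∧
      ∫⁻ t in Metric.closedBall (0 : EuclideanSpace ℝ (Fin k)) 2,
          ENNReal.ofReal (dirMoment ν p (∑ i, t i • g i)) ^ p ≤
        3 * (ENNReal.ofReal (6 * √p * W) ^ p *
          volume (Metric.closedBall (0 : EuclideanSpace ℝ (Fin k)) 2)) := by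
  have hp0 : 0 < p := by linarith
  have hc := gaussMomentConst_pos
  have hz := pzConst_pos
  set M := gaussMomentConst * √p * W with hM
  have : Nonempty (Fin k) := ⟨⟨0, Nat.pos_of_ne_zero hk⟩⟩
  set B : Set (EuclideanSpace ℝ (Fin k)) := Metric.closedBall 0 2 with hB
  have hB0 : volume B ≠ 0 :=
      (Metric.measure_closedBall_pos volume (0 : EuclideanSpace ℝ (Fin k)) two_pos).ne'
  have hBt : volume B ≠ ∞ := measure_closedBall_lt_top.ne
  have hBm : MeasurableSet B := Metric.isClosed_closedBall.measurableSet
  have hmh : Measurable (dirMoment ν p) := measurable_dirMoment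
  have hS : Measurable fun y : (Fin k → E) × EuclideanSpace ℝ (Fin k) => ∑ i, y.2 i • y.1 i := by
    fun_prop
  -- the bad set
  have hbm : MeasurableSet {y : (Fin k → E) × EuclideanSpace ℝ (Fin k) | y.2 ∈ B ∧
      dirMoment ν p (∑ i, y.2 i • y.1 i) ≤ M / 4 * ‖y.2‖} :=
    (measurable_snd hBm).inter (measurableSet_le (hmh.comp hS) (by fun_prop))
  set β := 2 * ENNReal.ofReal (pzConst ^ (2 * p) * exp (-(gaussMomentConst ^ 2 * K ^ 2 / 80 * p)))
    with hβ
  have e2 : ∫⁻ g, volume {t : EuclideanSpace ℝ (Fin k) | t ∈ B ∧ dirMoment ν p (∑ i, t i • g i) ≤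
      M / 4 * ‖t‖}
      ∂(Measure.pi fun _ : Fin k => stdGaussian E) ≤ β * volume B := by
    have h1 := (Measure.prod_apply (μ := Measure.pi fun _ : Fin k => stdGaussian E)
      (ν := (volume : Measure (EuclideanSpace ℝ (Fin k)))) hbm).symm.trans (Measure.prod_apply_symm hbm)
    refine h1.trans_le ?_
    calc _ ≤ ∫⁻ t : EuclideanSpace ℝ (Fin k), B.indicator (fun _ => β) t := by
          refine lintegral_mono_ae ?_
          filter_upwards [(volume : Measure (EuclideanSpace ℝ (Fin k))).ae_ne 0] with t ht
          by_cases htB : t ∈ B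
          · rw [Set.indicator_of_mem htB]
            have ht0 : 0 < ‖t‖ := norm_pos_iff.2 ht
            have hbz : MeasurableSet {z : E | dirMoment ν p z ≤ M / 4 * ‖t‖} :=
              measurableSet_le hmh measurable_const
            have h2 : (Measure.pi fun _ : Fin k => stdGaussian E)
                ((fun g => ∑ i, t i • g i) ⁻¹' {z : E | dirMoment ν p z ≤ M / 4 * ‖t‖}) =
                stdGaussian E {z | dirMoment ν p z ≤ M / 4} := by
              rw [← Measure.map_apply (by fun_prop) hbz, map_sum_smul_pi_stdGaussian,
                Measure.map_apply (by fun_prop) hbz]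
              congr 1
              ext z
              simp only [Set.mem_preimage, Set.mem_ofPred_eq]
              rw [dirMoment_smul hp, abs_of_pos ht0, mul_comm, mul_le_mul_iff_left₀ ht0]
            refine (measure_mono ?_).trans (h2.trans_le
              (stdGaussian_dirMoment_le hν hp hint hW hK hWeq hσ))
            intro g hg
            exact hg.2
          · rw [Set.indicator_of_notMem htB]
            refine (measure_mono_null (t := ∅) ?_ measure_empty).le
            intro g hg
            exact htB hg.1
      _ = β * volume B := by rw [lintegral_indicator_const hBm]
  have e3 : ∫⁻ g, ∫⁻ t in B, ENNReal.ofReal (dirMoment ν p (∑ i, t i • g i)) ^ p ∂volume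
      ∂(Measure.pi fun _ : Fin k => stdGaussian E) ≤
      ENNReal.ofReal (6 * √p * W) ^ p * volume B := by
    rw [lintegral_lintegral_swap ((((hmh.comp hS).ennreal_ofReal).pow_const p).aemeasurable),
      ← setLIntegral_const]
    refine setLIntegral_mono (by fun_prop) fun t ht => ?_
    rw [lintegral_comp_sum_smul_pi_stdGaussian t
      (f := fun z => ENNReal.ofReal (dirMoment ν p z) ^ p) (by fun_prop)]
    have ht2 : ‖t‖ ≤ 2 := by simpa [hB] using ht
    have h3 : ∀ z : E, ENNReal.ofReal (dirMoment ν p (‖t‖ • z)) ^ p ≤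
        ENNReal.ofReal 2 ^ p * ENNReal.ofReal (dirMoment ν p z) ^ p := by
      intro z
      rw [dirMoment_smul hp, abs_of_nonneg (norm_nonneg _), ← ENNReal.mul_rpow_of_nonneg _ _ hp0.le,
        ← ENNReal.ofReal_mul (by norm_num)]
      have := dirMoment_nonneg (ν := ν) (p := p) z
      gcongr
    refine (lintegral_mono h3).trans ?_
    rw [lintegral_const_mul _ (by fun_prop), lintegral_dirMoment_stdGaussian hp hint, hWeq]
    refine (mul_le_mul_right (mul_le_mul_left (gaussMoment_le (by linarith)) _) _).trans_eq ?_
    rw [← ENNReal.mul_rpow_of_nonneg _ _ hp0.le, ← ENNReal.mul_rpow_of_nonneg _ _ hp0.le,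
      ← ENNReal.ofReal_mul (by positivity), ← ENNReal.ofReal_mul (by positivity)]
    congr 2; ring
  refine exists_le_three_mul (P := Measure.pi fun _ : Fin k => stdGaussian E) ?_ ?_ ?_
    (lintegral_sum_abs_inner_pi_stdGaussian_le k hρ) e2 e3 ?_ ?_ ?_ ?_ ?_ ?_
  · exact Measurable.lintegral_prod_right'
      (f := fun y : (Fin k → E) × E => ∑ i, ENNReal.ofReal |⟪y.1 i, y.2⟫| ^ (2 : ℝ))
      (by fun_prop)
  · exact measurable_measure_prodMk_left hbm
  · exact Measurable.lintegral_prod_right'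
      (ν := (volume : Measure (EuclideanSpace ℝ (Fin k))).restrict B)
      (f := fun y : (Fin k → E) × EuclideanSpace ℝ (Fin k) =>
        ENNReal.ofReal (dirMoment ν p (∑ i, y.2 i • y.1 i)) ^ p)
      (((hmh.comp hS).ennreal_ofReal).pow_const p)
  · simp [hk, hρ0]
  · refine mul_ne_zero (mul_ne_zero (by norm_num) ?_) hB0
    rw [Ne, ENNReal.ofReal_eq_zero, not_le]; positivity
  · refine mul_ne_zero ?_ hB0
    rw [Ne, ENNReal.rpow_eq_zero_iff_of_pos hp0, ENNReal.ofReal_eq_zero, not_le]; positivity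
  · finiteness
  · finiteness
  · finiteness

end GaussianSection

section SeminormVolume

variable {F : Type*} [NormedAddCommGroup F] [InnerProductSpace ℝ F] [FiniteDimensional ℝ F]
  [MeasurableSpace F] [BorelSpace F]

lemma Seminorm.le_of_setLIntegral_le (N : Seminorm ℝ F) (hN : Measurable N) {p A : ℝ} (hp : 1 ≤ p)
    (hk : (Module.finrank ℝ F : ℝ) ≤ p) (hA : 0 ≤ A)
    (h : ∫⁻ t in Metric.closedBall (0 : F) 2, ENNReal.ofReal (N t) ^ p ≤
      3 * (ENNReal.ofReal A ^ p * volume (Metric.closedBall (0 : F) 2))) {t : F} (ht : ‖t‖ = 1) :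
    N t ≤ 12 * A := by
  have hp0 : 0 < p := by linarith
  set v := volume (Metric.ball (0 : F) 1) with hv
  have hv0 : v ≠ 0 := (Metric.measure_ball_pos volume (0 : F) one_pos).ne'
  have hvt : v ≠ ∞ := measure_ball_lt_top.ne
  have hB2 : volume (Metric.closedBall (0 : F) 2) ≤ ENNReal.ofReal 2 ^ p * v := by
    rw [Measure.addHaar_closedBall _ _ (by norm_num), ENNReal.ofReal_rpow_of_nonneg (by norm_num)
      hp0.le, ← rpow_natCast]
    gcongr
    norm_num
  have hpm : ∀ e : F → F, MeasurePreserving e volume volume → Measurable e →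
      (∀ s ∈ Metric.closedBall (0 : F) 1, e s ∈ Metric.closedBall (0 : F) 2) →
      ∫⁻ s in Metric.closedBall (0 : F) 1, ENNReal.ofReal (N (e s)) ^ p ≤
        ∫⁻ t in Metric.closedBall (0 : F) 2, ENNReal.ofReal (N t) ^ p := by
    intro e he hem hb
    have hBm : MeasurableSet (Metric.closedBall (0 : F) 2) :=
      Metric.isClosed_closedBall.measurableSet
    rw [← he.setLIntegral_comp_preimage hBm (by fun_prop)]
    exact lintegral_mono_set hb
  have h1 := hpm (t + ·) (measurePreserving_add_left volume t) (by fun_prop) fun s hs => by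
    simp only [mem_closedBall_zero_iff] at hs ⊢
    linarith [norm_add_le t s]
  have h2 := hpm (t - ·) (Measure.measurePreserving_sub_left volume t) (by fun_prop) fun s hs => by
    simp only [mem_closedBall_zero_iff] at hs ⊢
    linarith [norm_sub_le t s]
  have h3 : ENNReal.ofReal (N t) ^ p * v ≤ 2 * (3 * (ENNReal.ofReal A ^ p *
      volume (Metric.closedBall (0 : F) 2))) := by
    calc _ = ∫⁻ s in Metric.ball (0 : F) 1, ENNReal.ofReal (N t) ^ p := by rw [setLIntegral_const]
      _ ≤ ∫⁻ s in Metric.closedBall (0 : F) 1, ENNReal.ofReal (N t) ^ p :=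
        lintegral_mono_set Metric.ball_subset_closedBall
      _ ≤ ∫⁻ s in Metric.closedBall (0 : F) 1,
          (ENNReal.ofReal (N (t + s)) ^ p + ENNReal.ofReal (N (t - s)) ^ p) := by
          refine lintegral_mono fun s => ?_
          have h4 : 2 * N t ≤ N (t + s) + N (t - s) := by
            calc 2 * N t = N ((2 : ℝ) • t) := by rw [map_smul_eq_mul]; norm_num
              _ = N ((t + s) + (t - s)) := by congr 1; module
              _ ≤ _ := map_add_le_add _ _ _
          rcases le_total (N (t + s)) (N (t - s)) with h5 | h5
          · refine le_trans ?_ le_add_self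
            gcongr; linarith
          · refine le_trans ?_ le_self_add
            gcongr; linarith
      _ ≤ _ := by
          rw [lintegral_add_left (by fun_prop), two_mul]
          exact add_le_add (h1.trans h) (h2.trans h)
  have h6 : ENNReal.ofReal (N t) ^ p * v ≤ ENNReal.ofReal (12 * A) ^ p * v := by
    refine h3.trans ((mul_le_mul_right (mul_le_mul_right (mul_le_mul_right hB2 _) _) _).trans ?_)
    have h7 : ENNReal.ofReal (12 * A) ^ p =
        ENNReal.ofReal 6 ^ p * ENNReal.ofReal A ^ p * ENNReal.ofReal 2 ^ p := by
      rw [← ENNReal.mul_rpow_of_nonneg _ _ hp0.le, ← ENNReal.mul_rpow_of_nonneg _ _ hp0.le,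
        ← ENNReal.ofReal_mul (by norm_num), ← ENNReal.ofReal_mul (by positivity)]
      congr 2; ring
    have h8 : (6 : ℝ≥0∞) ≤ ENNReal.ofReal 6 ^ p := by
      have : (6 : ℝ≥0∞) = ENNReal.ofReal 6 := by simp
      rw [this]
      conv_lhs => rw [← ENNReal.rpow_one (ENNReal.ofReal 6)]
      exact ENNReal.rpow_le_rpow_of_exponent_le (by simp) hp
    rw [h7]
    calc _ = 6 * ENNReal.ofReal A ^ p * ENNReal.ofReal 2 ^ p * v := by ring
      _ ≤ _ := by gcongr
  have h9 := (ENNReal.mul_le_mul_iff_left hv0 hvt).1 h6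
  rw [ENNReal.rpow_le_rpow_iff hp0] at h9
  exact (ENNReal.ofReal_le_ofReal_iff (by positivity)).1 h9

lemma Seminorm.le_of_measure_le (N : Seminorm ℝ F) {L H b : ℝ} (hL : 0 < L)
    (hLH : L ≤ 4 * H) (hNH : ∀ t, ‖t‖ = 1 → N t ≤ H)
    (hb : b < (L / (16 * H) / 2) ^ Module.finrank ℝ F)
    (h : volume {t : F | t ∈ Metric.closedBall 0 2 ∧ N t ≤ L / 4 * ‖t‖} ≤
      ENNReal.ofReal b * volume (Metric.closedBall (0 : F) 2)) {t : F} (ht : ‖t‖ = 1) :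
    L / 8 ≤ N t := by
  by_contra! hlt
  have hH : 0 < H := by linarith
  have hNle : ∀ s, N s ≤ H * ‖s‖ := by
    intro s
    rcases eq_or_ne s 0 with rfl | hs
    · simp
    have hs' : 0 < ‖s‖ := norm_pos_iff.2 hs
    have := hNH (‖s‖⁻¹ • s) (by rw [norm_smul, norm_inv, norm_norm, inv_mul_cancel₀ hs'.ne'])
    rw [map_smul_eq_mul, norm_inv, norm_norm] at this
    rwa [inv_mul_le_iff₀ hs', mul_comm] at this
  set ε := L / (16 * H) with hε
  have hε0 : 0 < ε := by positivity
  have hε4 : ε ≤ 1 / 4 := by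
    rw [hε, div_le_div_iff₀ (by positivity) (by norm_num)]; linarith
  have hεH : ε * H = L / 16 := by rw [hε]; field_simp
  have hsub : Metric.closedBall t ε ⊆ {t : F | t ∈ Metric.closedBall 0 2 ∧ N t ≤ L / 4 * ‖t‖} := by
    intro s hs
    rw [Metric.mem_closedBall, dist_eq_norm] at hs
    have h1 : ‖s‖ ≤ 2 := by
      have := norm_add_le t (s - t); rw [add_sub_cancel] at this; linarith
    have h2 : 3 / 4 ≤ ‖s‖ := by
      have := norm_sub_norm_le t s; rw [norm_sub_rev] at this; linarith
    refine ⟨by simpa using h1, ?_⟩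
    have h3 : N s ≤ N t + N (s - t) := by
      have := map_add_le_add N t (s - t); rwa [add_sub_cancel] at this
    have h4 : N (s - t) ≤ L / 16 := by
      rw [← hεH, mul_comm]; exact (hNle _).trans (by gcongr)
    nlinarith
  have h1 := (measure_mono hsub).trans h
  set v := volume (Metric.ball (0 : F) 1) with hv
  have hv0 : v ≠ 0 := (Metric.measure_ball_pos volume (0 : F) one_pos).ne'
  have hvt : v ≠ ∞ := measure_ball_lt_top.ne
  rw [Measure.addHaar_closedBall _ _ hε0.le, Measure.addHaar_closedBall _ _ (by norm_num),
    ← mul_assoc, ENNReal.mul_le_mul_iff_left hv0 hvt, ← ENNReal.ofReal_mul' (by positivity)] at h1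
  have h2 : b * 2 ^ Module.finrank ℝ F < ε ^ Module.finrank ℝ F := by
    rwa [div_pow, lt_div_iff₀ (by positivity)] at hb
  have h3 := (ENNReal.ofReal_le_ofReal_iff' ).1 h1
  rcases h3 with h3 | h3
  · linarith
  · exact absurd h3 (not_le.2 (by positivity))

end SeminormVolume

section Dichotomy

variable {E : Type*} [NormedAddCommGroup E] [InnerProductSpace ℝ E] [FiniteDimensional ℝ E]
  [MeasurableSpace E] [BorelSpace E] {ν : Measure E} [IsProbabilityMeasure ν] {p : ℝ}

lemma gaussMomentConst_le_one : gaussMomentConst ≤ 1 := by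
  unfold gaussMomentConst
  have : exp (-2) ≤ 1 := exp_le_one_iff.2 (by norm_num)
  linarith

/-- The norm comparison constant produced by the section argument. -/
def sectionConst : ℝ :=
  16 * (5 * exp (4 * (4 * log (4 * momentConst)) + 8) * 11) / gaussMomentConst

lemma sectionConst_pos : 0 < sectionConst := by
  have := gaussMomentConst_pos
  unfold sectionConst; positivity

lemma half_le_measure_closedBall {F : Type*} [NormedAddCommGroup F] [MeasurableSpace F]
    [BorelSpace F] {μ : Measure F} [IsProbabilityMeasure μ] {s : ℝ≥0∞} {R : ℝ} (hR : 0 < R)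
    (h : ∫⁻ y, ENNReal.ofReal ‖y‖ ^ (2 : ℝ) ∂μ ≤ s) (hs : 2 * s ≤ ENNReal.ofReal R ^ (2 : ℝ)) :
    1 / 2 ≤ μ (Metric.closedBall 0 R) := by
  have hR' : ENNReal.ofReal R ^ (2 : ℝ) ≠ 0 := by simp [hR]
  have h1 := mul_meas_ge_le_lintegral₀ (μ := μ) (f := fun y => ENNReal.ofReal ‖y‖ ^ (2 : ℝ))
    (by fun_prop) (ENNReal.ofReal R ^ (2 : ℝ))
  have h2 : (Metric.closedBall (0 : F) R)ᶜ ⊆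
      {y | ENNReal.ofReal R ^ (2 : ℝ) ≤ ENNReal.ofReal ‖y‖ ^ (2 : ℝ)} := by
    intro y hy
    simp only [Set.mem_compl_iff, mem_closedBall_zero_iff, not_le] at hy
    simp only [Set.mem_ofPred_eq]
    gcongr
  have h3 : μ (Metric.closedBall (0 : F) R)ᶜ ≤ 1 / 2 := by
    rw [← ENNReal.mul_le_mul_iff_right hR' (by finiteness)]
    calc _ ≤ s := (mul_le_mul_right (measure_mono h2) _).trans (h1.trans h)
      _ = 2 * s * (1 / 2) := by
        rw [mul_comm 2 s, mul_assoc, one_div, ENNReal.mul_inv_cancel (by norm_num) (by norm_num),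
          mul_one]
      _ ≤ _ := by gcongr
  have h4 := prob_add_prob_compl (μ := μ)
    (Metric.isClosed_closedBall (x := (0 : F)) (ε := R)).measurableSet
  by_contra! hlt
  have : μ (Metric.closedBall (0 : F) R) + μ (Metric.closedBall (0 : F) R)ᶜ < 1 := by
    calc _ < 1 / 2 + 1 / 2 := ENNReal.add_lt_add_of_lt_of_le (by finiteness) hlt h3
      _ = 1 := by simp [ENNReal.inv_two_add_inv_two]
  exact this.ne h4

lemma IsLogConcaveMeasure.moment_le_of_dirMoment_le (hν : IsLogConcaveMeasure ν) (hp : 2 ≤ p)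
    (hint : Integrable (fun x => ‖x‖ ^ p) ν) {W K ρ : ℝ} (hW : 0 < W) (hK : 0 < K)
    (hK' : 6 * pzConst ^ 2 * exp (-(gaussMomentConst ^ 2 * K ^ 2 / 80)) < gaussMomentConst / 2304)
    (hWeq : ∫⁻ x, ENNReal.ofReal ‖x‖ ^ p ∂ν = ENNReal.ofReal W ^ p)
    (hσ : ∀ z, dirMoment ν p z ≤ W / K * ‖z‖) (hρ0 : 0 < ρ)
    (hρ : ∫⁻ x, ENNReal.ofReal ‖x‖ ^ (2 : ℝ) ∂ν ≤ ENNReal.ofReal ρ ^ (2 : ℝ)) :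
    W ≤ sectionConst * ρ := by
  have hp0 : 0 < p := by linarith
  have hc := gaussMomentConst_pos
  have hc1 := gaussMomentConst_le_one
  have hz := pzConst_pos
  have hm := momentConst_pos
  have hm1 := one_le_momentConst
  have hsp : 0 < √p := sqrt_pos.2 hp0
  set k := ⌊p⌋₊ with hkdef
  have hkp : (k : ℝ) ≤ p := Nat.floor_le hp0.le
  have hpk : p ≤ 2 * k := by
    have h1 := Nat.lt_floor_add_one p
    have h2 : (1 : ℝ) ≤ k := by exact_mod_cast (Nat.one_le_floor_iff p).2 (by linarith)
    linarith
  have hk0 : k ≠ 0 := by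
    rintro h; rw [h] at hpk; norm_num at hpk; linarith
  have hk0' : (0 : ℝ) < k := by exact_mod_cast Nat.pos_of_ne_zero hk0
  obtain ⟨g, hg1, hg2, hg3⟩ := exists_gaussian_section hν hp hint hW hK hWeq hσ hρ0 hρ hk0
  set M := gaussMomentConst * √p * W with hM
  have hM0 : 0 < M := by positivity
  let N : Seminorm ℝ (EuclideanSpace ℝ (Fin k)) :=
    Seminorm.of (fun t => dirMoment ν p (∑ i, t i • g i))
      (fun s t => by
        have : ∑ i, (s + t) i • g i = ∑ i, s i • g i + ∑ i, t i • g i := by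
          simp [add_smul, Finset.sum_add_distrib]
        rw [this]
        exact dirMoment_add_le hp hint _ _)
      (fun c t => by
        have : ∑ i, (c • t) i • g i = c • ∑ i, t i • g i := by
          simp [mul_smul, Finset.smul_sum]
        rw [this, dirMoment_smul hp, Real.norm_eq_abs])
  have hNapp : ∀ t, N t = dirMoment ν p (∑ i, t i • g i) := fun t => rfl
  have hN : Measurable N := measurable_dirMoment.comp
    (by fun_prop : Measurable fun t : EuclideanSpace ℝ (Fin k) => ∑ i, t i • g i)
  have hfr : Module.finrank ℝ (EuclideanSpace ℝ (Fin k)) = k := by simp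
  have hup : ∀ t, ‖t‖ = 1 → N t ≤ 12 * (6 * √p * W) := fun t ht =>
    N.le_of_setLIntegral_le hN (by linarith) (by rw [hfr]; exact hkp) (by positivity) hg3 ht
  have hlow : ∀ t, ‖t‖ = 1 → M / 8 ≤ N t := by
    intro t ht
    refine N.le_of_measure_le (H := 12 * (6 * √p * W)) (b := 6 * (pzConst ^ (2 * p) *
      exp (-(gaussMomentConst ^ 2 * K ^ 2 / 80 * p)))) hM0 ?_ hup ?_ ?_ ht
    · rw [hM]
      have : 0 < √p * W := by positivity
      nlinarith
    · have e1 : M / (16 * (12 * (6 * √p * W))) / 2 = gaussMomentConst / 2304 := by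
        rw [hM]; field_simp; norm_num
      rw [e1, hfr]
      calc _ ≤ (6 : ℝ) ^ p * (pzConst ^ (2 * p) *
            exp (-(gaussMomentConst ^ 2 * K ^ 2 / 80 * p))) := by
            gcongr
            calc (6 : ℝ) = 6 ^ (1 : ℝ) := by simp
              _ ≤ 6 ^ p := rpow_le_rpow_of_exponent_le (by norm_num) (by linarith)
        _ = (6 * pzConst ^ 2 * exp (-(gaussMomentConst ^ 2 * K ^ 2 / 80))) ^ p := by
            rw [mul_rpow (by positivity) (by positivity), mul_rpow (by positivity) (by positivity),
              ← exp_mul, ← rpow_two pzConst, ← rpow_mul hz.le, neg_mul]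
            ring
        _ < (gaussMomentConst / 2304) ^ p := rpow_lt_rpow (by positivity) hK' hp0
        _ ≤ (gaussMomentConst / 2304) ^ (k : ℝ) :=
            rpow_le_rpow_of_exponent_ge (by positivity) (by linarith) hkp
        _ = _ := rpow_natCast _ _
    · refine hg2.trans_eq ?_
      rw [← mul_assoc, ENNReal.ofReal_mul (by norm_num : (0 : ℝ) ≤ 6), ← mul_assoc]
      congr 2
      rw [show (6 : ℝ) = 3 * 2 by norm_num, ENNReal.ofReal_mul (by norm_num)]
      simp
  -- the law of the section
  let T : E →ₗ[ℝ] EuclideanSpace ℝ (Fin k) :=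
    { toFun := fun x => WithLp.toLp 2 fun i => ⟪g i, x⟫
      map_add' := fun x y => by ext i; simp [inner_add_right]
      map_smul' := fun c x => by ext i; simp [inner_smul_right] }
  have hTapp : ∀ x i, T x i = ⟪g i, x⟫ := fun x i => rfl
  have hT : Measurable T := T.continuous_of_finiteDimensional.measurable
  have hνT := hν.map T hT
  have : IsProbabilityMeasure (ν.map T) := Measure.isProbabilityMeasure_map hT.aemeasurable
  have hinner : ∀ t x, ⟪t, T x⟫ = ⟪∑ i, t i • g i, x⟫ := by
    intro t x
    rw [sum_inner, PiLp.inner_apply]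
    simp [inner_smul_left, hTapp, mul_comm]
  have hball : 1 / 2 ≤ (ν.map T) (Metric.closedBall 0 (11 * √k * ρ)) := by
    refine half_le_measure_closedBall (s := 3 * (k * (18 * ENNReal.ofReal ρ ^ (2 : ℝ))))
      (by positivity) ?_ ?_
    · rw [lintegral_map (by fun_prop) hT]
      refine le_of_eq_of_le (lintegral_congr fun x => ?_) hg1
      rw [ENNReal.ofReal_rpow_of_nonneg (by positivity) (by norm_num), rpow_two,
        EuclideanSpace.real_norm_sq_eq, ENNReal.ofReal_sum_of_nonneg fun _ _ => by positivity]
      refine Finset.sum_congr rfl fun i _ => ?_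
      rw [ENNReal.ofReal_rpow_of_nonneg (by positivity) (by norm_num), rpow_two, sq_abs, hTapp]
    · rw [ENNReal.ofReal_mul (by positivity), ENNReal.mul_rpow_of_nonneg _ _ (by norm_num),
        ENNReal.ofReal_rpow_of_nonneg (p := 2) (by positivity : 0 ≤ 11 * √k) (by norm_num),
        rpow_two, mul_pow, sq_sqrt hk0'.le, ENNReal.ofReal_mul (by norm_num),
        ENNReal.ofReal_natCast]
      calc _ = 108 * k * ENNReal.ofReal ρ ^ (2 : ℝ) := by ring
        _ ≤ _ := by
          gcongr
          rw [show (108 : ℝ≥0∞) = ENNReal.ofReal 108 by simp]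
          exact ENNReal.ofReal_le_ofReal (by norm_num)
  have hlog : 0 ≤ log (4 * momentConst) := log_nonneg (by linarith)
  have hfin := hνT.le_of_forall_le_measure_inner (R := 11 * √k * ρ)
    (a := 4 * log (4 * momentConst)) (m := M / 8 / 2) (by rw [hfr]; omega) (by positivity)
    (by positivity) hball (by
      intro t ht
      have hpos : 0 < M / 8 := by positivity
      let Nt : Seminorm ℝ (EuclideanSpace ℝ (Fin k)) :=
        (normSeminorm ℝ ℝ).comp (innerₛₗ ℝ t)
      have hNt : ∀ y, Nt y = |⟪t, y⟫| := fun y => rfl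
      have hNtm : Measurable Nt := by
        simp_rw [funext hNt]; fun_prop
      have e1 : ∫⁻ y, ENNReal.ofReal (Nt y) ^ p ∂(ν.map T) = ENNReal.ofReal (N t) ^ p := by
        simp_rw [hNt]
        rw [lintegral_map (by fun_prop) hT, hNapp, ofReal_dirMoment_rpow hp hint]
        simp_rw [hinner]
      have h5 := hνT.le_measure_half_le Nt hNtm (p := p) (by linarith) hpos
        (by rw [e1]; gcongr; exact hlow t ht) (by rw [e1]; finiteness)
      refine le_trans (ENNReal.ofReal_le_ofReal ?_) h5
      rw [hfr, rpow_def_of_pos (by positivity)]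
      refine exp_le_exp.2 ?_
      nlinarith)
  have hkp' : √(k : ℝ) ≤ √p := sqrt_le_sqrt hkp
  unfold sectionConst
  rw [div_mul_eq_mul_div, le_div_iff₀ hc]
  set ex := exp (4 * (4 * log (4 * momentConst)) + 8) with hex
  have hex0 : 0 < ex := exp_pos _
  have h6 : gaussMomentConst * √p * W ≤ 16 * (5 * ex * 11) * ρ * √p := by
    calc _ ≤ 16 * (5 * ex * (11 * √k * ρ)) := by rw [hM] at hfin; linarith
      _ ≤ 16 * (5 * ex * (11 * √p * ρ)) := by gcongr
      _ = _ := by ring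
  refine le_of_mul_le_mul_right ?_ hsp
  linarith

end Dichotomy

/-- **Paouris' inequality**: strong moments of the Euclidean norm of a log-concave vector are
controlled by the second moment and the weak moments. -/
theorem exists_paouris_const : ∃ C : ℝ, 1 ≤ C ∧ ∀ (E : Type) [NormedAddCommGroup E]
    [InnerProductSpace ℝ E] [FiniteDimensional ℝ E] [MeasurableSpace E] [BorelSpace E]
    (ν : Measure E) [IsProbabilityMeasure ν], IsLogConcaveMeasure ν → ∀ p ρ σ : ℝ, 1 ≤ p →
    0 < ρ → 0 ≤ σ →
    ∫⁻ x, ENNReal.ofReal ‖x‖ ^ (2 : ℝ) ∂ν ≤ ENNReal.ofReal ρ ^ (2 : ℝ) →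
    (∀ z, ∫⁻ x, ENNReal.ofReal |⟪z, x⟫| ^ p ∂ν ≤ ENNReal.ofReal (σ * ‖z‖) ^ p) →
    ∫⁻ x, ENNReal.ofReal ‖x‖ ^ p ∂ν ≤ ENNReal.ofReal (C * (ρ + σ)) ^ p := by
  have hc := gaussMomentConst_pos
  have hz := pzConst_pos
  have hs := sectionConst_pos
  obtain ⟨K, hK, hK'⟩ : ∃ K : ℝ, 0 < K ∧ 6 * pzConst ^ 2 *
      exp (-(gaussMomentConst ^ 2 * K ^ 2 / 80)) < gaussMomentConst / 2304 := by
    set X := 6 * pzConst ^ 2 with hX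
    have hX0 : 0 < X := by positivity
    set y := X / (gaussMomentConst / 2304) with hy
    have hy0 : 0 < y := by positivity
    refine ⟨√(80 * y) / gaussMomentConst, by positivity, ?_⟩
    have e1 : gaussMomentConst ^ 2 * (√(80 * y) / gaussMomentConst) ^ 2 / 80 = y := by
      rw [div_pow, sq_sqrt (by positivity)]; field_simp
    rw [e1, exp_neg, ← div_eq_mul_inv, div_lt_iff₀ (exp_pos _)]
    calc X = gaussMomentConst / 2304 * y := by rw [hy]; field_simp
      _ < _ := by
        gcongr
        linarith [add_one_le_exp y]
  refine ⟨1 + K + sectionConst, by linarith, ?_⟩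
  intro E _ _ _ _ _ ν _ hν p ρ σ hp hρ0 hσ0 hρ hσ
  have hp0 : 0 < p := by linarith
  have hbig : ∀ W : ℝ, W ≤ ρ ∨ W ≤ K * σ ∨ W ≤ sectionConst * ρ →
      W ≤ (1 + K + sectionConst) * (ρ + σ) := by
    have h1 : 0 ≤ K * σ := by positivity
    have h2 : 0 ≤ K * ρ := by positivity
    have h3 : 0 ≤ sectionConst * ρ := by positivity
    have h4 : 0 ≤ sectionConst * σ := by positivity
    rintro W (h | h | h) <;> nlinarith
  rcases lt_or_ge p 2 with hp2 | hp2
  · refine (lintegral_rpow_le_of_exponent_le (by fun_prop) hp0 hp2.le hρ).trans ?_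
    gcongr
    exact hbig _ (Or.inl le_rfl)
  have hfin : ∫⁻ x, ENNReal.ofReal ‖x‖ ^ p ∂ν ≠ ∞ := by
    have := hν.lintegral_rpow_le (normSeminorm ℝ E) (by simpa using measurable_norm) (p := 2)
      (q := p) (by norm_num) hp2 hρ0.le hρ
    exact ne_top_of_le_ne_top (by finiteness) this
  obtain ⟨W, hW0, hW⟩ : ∃ W : ℝ, 0 ≤ W ∧
      ∫⁻ x, ENNReal.ofReal ‖x‖ ^ p ∂ν = ENNReal.ofReal W ^ p := by
    refine ⟨((∫⁻ x, ENNReal.ofReal ‖x‖ ^ p ∂ν) ^ (1 / p)).toReal, ENNReal.toReal_nonneg, ?_⟩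
    rw [ENNReal.ofReal_toReal (by finiteness), ← ENNReal.rpow_mul, one_div_mul_cancel hp0.ne',
      ENNReal.rpow_one]
  rw [hW]
  gcongr
  refine hbig W ?_
  by_cases hWσ : W ≤ K * σ
  · exact Or.inr (Or.inl hWσ)
  push Not at hWσ
  have hWpos : 0 < W := lt_of_le_of_lt (by positivity) hWσ
  have hint : Integrable (fun x => ‖x‖ ^ p) ν := by
    refine ⟨Measurable.aestronglyMeasurable (by fun_prop), ?_⟩
    rw [hasFiniteIntegral_iff_ofReal (.of_forall fun _ => by positivity)]
    refine lt_top_iff_ne_top.2 ?_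
    simpa only [ENNReal.ofReal_rpow_of_nonneg (norm_nonneg _) hp0.le] using hfin
  refine Or.inr (Or.inr (hν.moment_le_of_dirMoment_le hp2 hint hWpos hK hK' hW (fun z => ?_)
    hρ0 hρ))
  have h1 := hσ z
  rw [← ofReal_dirMoment_rpow hp2 hint, ENNReal.rpow_le_rpow_iff hp0,
    ENNReal.ofReal_le_ofReal_iff (by positivity)] at h1
  refine h1.trans ?_
  gcongr
  rw [le_div_iff₀ hK]; linarith

/-- A constant for which Paouris' inequality holds. -/
def paourisConst : ℝ := exists_paouris_const.choose

lemma one_le_paourisConst : 1 ≤ paourisConst := exists_paouris_const.choose_spec.1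

section LogConcaveCoordinates

variable {n : ℕ} {ν : Measure (EuclideanSpace ℝ (Fin n))} [IsProbabilityMeasure ν]

/-- The absolute value of a linear functional as a seminorm. -/
def innerSeminorm {E : Type*} [NormedAddCommGroup E] [InnerProductSpace ℝ E] (z : E) :
    Seminorm ℝ E :=
  (normSeminorm ℝ ℝ).comp (innerₛₗ ℝ z)

lemma innerSeminorm_apply {E : Type*} [NormedAddCommGroup E] [InnerProductSpace ℝ E] (z x : E) :
    innerSeminorm z x = |⟪z, x⟫| := rfl

lemma measurable_innerSeminorm {E : Type*} [NormedAddCommGroup E] [InnerProductSpace ℝ E]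
    [MeasurableSpace E] [OpensMeasurableSpace E] (z : E) : Measurable (innerSeminorm z) := by
  have : (innerSeminorm z : E → ℝ) = fun x => |⟪z, x⟫| := rfl
  rw [this]
  exact (by fun_prop : Continuous fun x => |⟪z, x⟫|).measurable

lemma innerSeminorm_single (i : Fin n) (x : EuclideanSpace ℝ (Fin n)) :
    innerSeminorm (EuclideanSpace.single i (1 : ℝ)) x = |x i| := by
  rw [innerSeminorm_apply, EuclideanSpace.inner_single_left]; simp

/-- The orthogonal projection onto a set of coordinates. -/
def coordProj (J : Finset (Fin n)) : EuclideanSpace ℝ (Fin n) →ₗ[ℝ] EuclideanSpace ℝ (Fin n) where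
  toFun x := WithLp.toLp 2 fun i => if i ∈ J then x i else 0
  map_add' x y := by ext i; by_cases h : i ∈ J <;> simp [h]
  map_smul' c x := by ext i; simp

lemma coordProj_apply (J : Finset (Fin n)) (x : EuclideanSpace ℝ (Fin n)) (i : Fin n) :
    coordProj J x i = if i ∈ J then x i else 0 := rfl

lemma measurable_coordProj (J : Finset (Fin n)) : Measurable (coordProj J) :=
  (coordProj J).continuous_of_finiteDimensional.measurable

lemma norm_coordProj_sq (J : Finset (Fin n)) (x : EuclideanSpace ℝ (Fin n)) :
    ‖coordProj J x‖ ^ 2 = ∑ i ∈ J, x i ^ 2 := by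
  rw [EuclideanSpace.real_norm_sq_eq]
  simp [coordProj_apply, ite_pow, Finset.sum_ite_mem]

lemma norm_coordProj_le (J : Finset (Fin n)) (x : EuclideanSpace ℝ (Fin n)) :
    ‖coordProj J x‖ ≤ ‖x‖ := by
  refine le_of_sq_le_sq ?_ (norm_nonneg _)
  rw [norm_coordProj_sq, EuclideanSpace.real_norm_sq_eq]
  exact Finset.sum_le_sum_of_subset_of_nonneg (Finset.subset_univ _) fun _ _ _ => sq_nonneg _

lemma inner_coordProj (J : Finset (Fin n)) (z x : EuclideanSpace ℝ (Fin n)) :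
    ⟪z, coordProj J x⟫ = ⟪coordProj J z, x⟫ := by
  simp [PiLp.inner_apply, coordProj_apply]

lemma lintegral_norm_coordProj (μ : Measure (EuclideanSpace ℝ (Fin n))) (J : Finset (Fin n)) :
    ∫⁻ x, ENNReal.ofReal ‖coordProj J x‖ ^ (2 : ℝ) ∂μ =
      ∑ i ∈ J, ∫⁻ x, ENNReal.ofReal |x i| ^ (2 : ℝ) ∂μ := by
  rw [← lintegral_finsetSum _ fun i _ => by fun_prop]
  refine lintegral_congr fun x => ?_
  rw [ENNReal.ofReal_rpow_of_nonneg (by positivity) (by norm_num), rpow_two, norm_coordProj_sq,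
    ENNReal.ofReal_sum_of_nonneg fun _ _ => by positivity]
  refine Finset.sum_congr rfl fun i _ => ?_
  rw [ENNReal.ofReal_rpow_of_nonneg (by positivity) (by norm_num), rpow_two, sq_abs]

/-- The threshold above which conditional second moments are large. -/
def condConst : ℝ := 2 * (exp 1 * paourisConst)

lemma condConst_pos : 0 < condConst := by
  have := one_le_paourisConst
  unfold condConst; positivity

lemma IsLogConcaveMeasure.lintegral_norm_coordProj_le (hν : IsLogConcaveMeasure ν)
    (h2 : ∀ i, ∫⁻ x, ENNReal.ofReal |x i| ^ (2 : ℝ) ∂ν ≤ 1) {q s : ℝ} (hq : 1 ≤ q) (hs : 0 ≤ s)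
    (hw : ∀ z, ∫⁻ x, ENNReal.ofReal |⟪z, x⟫| ^ q ∂ν ≤ ENNReal.ofReal (s * ‖z‖) ^ q)
    {q' : ℝ} (hq' : q ≤ q') {J : Finset (Fin n)} (hJ : J.Nonempty) :
    ∫⁻ x, ENNReal.ofReal ‖coordProj J x‖ ^ q' ∂ν ≤
      ENNReal.ofReal (paourisConst * (√J.card + momentConst * (q' / q) * s)) ^ q' := by
  have hq0 : 0 < q := by linarith
  have hm := momentConst_pos
  have hT := measurable_coordProj J
  have : IsProbabilityMeasure (ν.map (coordProj J)) :=
    Measure.isProbabilityMeasure_map hT.aemeasurable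
  have hJc : (0 : ℝ) < J.card := by exact_mod_cast hJ.card_pos
  rw [← lintegral_map (f := fun y => ENNReal.ofReal ‖y‖ ^ q') (by fun_prop) hT]
  refine exists_paouris_const.choose_spec.2 _ _ (hν.map (coordProj J) hT) q' _ _ (by linarith)
    (sqrt_pos.2 hJc) (by have : 0 ≤ q' / q := div_nonneg (by linarith) hq0.le
                         positivity) ?_ fun z => ?_
  · rw [lintegral_map (by fun_prop) hT, lintegral_norm_coordProj,
      ENNReal.ofReal_rpow_of_nonneg (by positivity) (by norm_num), rpow_two, sq_sqrt hJc.le,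
      ENNReal.ofReal_natCast]
    refine (Finset.sum_le_sum fun i _ => h2 i).trans_eq ?_
    simp
  · rw [lintegral_map (by fun_prop) hT]
    simp_rw [inner_coordProj]
    have h1 := hν.lintegral_rpow_le (innerSeminorm (coordProj J z)) (measurable_innerSeminorm _)
      hq hq' (m := s * ‖coordProj J z‖) (by positivity) (hw _)
    refine h1.trans ?_
    rw [mul_assoc (momentConst * (q' / q))]
    have : 0 ≤ q' / q := div_nonneg (by linarith) hq0.le
    gcongr
    · linarith
    · exact norm_coordProj_le J z

lemma cond_le_smul {α : Type*} [MeasurableSpace α] (μ : Measure α) (A : Set α) :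
    ProbabilityTheory.cond μ A ≤ (μ A)⁻¹ • μ := by
  refine Measure.le_iff.2 fun s _ => ?_
  rw [ProbabilityTheory.cond, Measure.smul_apply, Measure.smul_apply]
  exact mul_le_mul_right (Measure.restrict_le_self s) _

/-- Conditionally on a convex set, the large coordinates have controlled total second moment. -/
lemma IsLogConcaveMeasure.sum_sq_cond_le (hν : IsLogConcaveMeasure ν)
    (h2 : ∀ i, ∫⁻ x, ENNReal.ofReal |x i| ^ (2 : ℝ) ∂ν ≤ 1) {q s : ℝ} (hq : 2 ≤ q) (hs : 0 ≤ s)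
    (hw : ∀ z, ∫⁻ x, ENNReal.ofReal |⟪z, x⟫| ^ q ∂ν ≤ ENNReal.ofReal (s * ‖z‖) ^ q)
    {A : Set (EuclideanSpace ℝ (Fin n))} (hA : ν A ≠ 0) {a : Fin n → ℝ} (ha0 : ∀ i, 0 ≤ a i)
    (ha : ∀ i, ∫⁻ x, ENNReal.ofReal |x i| ^ (2 : ℝ) ∂(ProbabilityTheory.cond ν A) =
        ENNReal.ofReal (a i) ^ (2 : ℝ)) :
    ∑ i with condConst ≤ a i, a i ^ 2 ≤
      (condConst * momentConst * s) ^ 2 * (ν A).toReal ^ (-(2 / q)) := by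
  have hq0 : 0 < q := by linarith
  have hm := momentConst_pos
  have hcP := one_le_paourisConst
  have hc := condConst_pos
  set J : Finset (Fin n) := {i | condConst ≤ a i} with hJdef
  rcases J.eq_empty_or_nonempty with hJ | hJ
  · rw [hJ]; simp only [Finset.sum_empty]; positivity
  have : IsProbabilityMeasure (ProbabilityTheory.cond ν A) := cond_isProbabilityMeasure hA
  set P := (ν A).toReal with hP
  have hP0 : 0 < P := ENNReal.toReal_pos hA (measure_ne_top _ _)
  have hνA : ν A = ENNReal.ofReal P := (ENNReal.ofReal_toReal (measure_ne_top _ _)).symm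
  have hP1 : P ≤ 1 := ENNReal.toReal_le_of_le_ofReal (by norm_num) (by simpa using prob_le_one)
  set L := -log P with hL
  have hL0 : 0 ≤ L := by rw [hL]; linarith [log_nonpos hP0.le hP1]
  have hPL : P = exp (-L) := by rw [hL, neg_neg, exp_log hP0]
  set q' := max q L with hq'
  have hqq' : q ≤ q' := le_max_left _ _
  have hq'0 : 0 < q' := by linarith
  set σ := momentConst * (q' / q) * s with hσ
  have hσ0 : 0 ≤ σ := by positivity
  set D := exp 1 * (paourisConst * (√J.card + σ)) with hD
  have hcP0 : 0 < paourisConst := by linarith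
  have hD0 : 0 ≤ D := mul_nonneg (exp_pos _).le
    (mul_nonneg hcP0.le (add_nonneg (sqrt_nonneg _) hσ0))
  have h3 : ∫⁻ x, ENNReal.ofReal ‖coordProj J x‖ ^ q' ∂(ProbabilityTheory.cond ν A) ≤
      ENNReal.ofReal D ^ q' := by
    refine (lintegral_mono' (cond_le_smul ν A) le_rfl).trans ?_
    rw [lintegral_smul_measure, smul_eq_mul]
    refine (mul_le_mul_right (hν.lintegral_norm_coordProj_le h2 (by linarith) hs hw hqq' hJ)
      _).trans ?_
    rw [hD, ENNReal.ofReal_mul (exp_pos 1).le, ENNReal.mul_rpow_of_nonneg _ _ hq'0.le]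
    refine mul_le_mul_left ?_ _
    rw [hνA, ← ENNReal.ofReal_inv_of_pos hP0, ENNReal.ofReal_rpow_of_nonneg (by positivity) hq'0.le,
      hPL, ← exp_neg, neg_neg, ← exp_mul, one_mul]
    gcongr
    exact le_max_right _ _
  have h4 := lintegral_rpow_le_of_exponent_le (f := fun x => ENNReal.ofReal ‖coordProj J x‖)
    ((measurable_coordProj J).norm.ennreal_ofReal) (by norm_num : (0 : ℝ) < 2)
    (by linarith : (2 : ℝ) ≤ q') h3
  rw [lintegral_norm_coordProj] at h4
  have h5 : ∑ i ∈ J, a i ^ 2 ≤ D ^ 2 := by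
    rw [← ENNReal.ofReal_le_ofReal_iff (sq_nonneg D),
      ENNReal.ofReal_sum_of_nonneg fun _ _ => by positivity]
    calc _ = ∑ i ∈ J, ∫⁻ x, ENNReal.ofReal |x i| ^ (2 : ℝ) ∂(ProbabilityTheory.cond ν A) := by
          refine Finset.sum_congr rfl fun i _ => ?_
          rw [ha, ENNReal.ofReal_rpow_of_nonneg (ha0 i) (by norm_num), rpow_two]
      _ ≤ _ := h4
      _ = _ := by rw [ENNReal.ofReal_rpow_of_nonneg hD0 (by norm_num), rpow_two]
  have h6 : (J.card : ℝ) * condConst ^ 2 ≤ ∑ i ∈ J, a i ^ 2 := by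
    rw [← nsmul_eq_mul]
    refine Finset.card_nsmul_le_sum _ _ _ fun i hi => ?_
    have : condConst ≤ a i := by simpa [hJdef] using hi
    gcongr
  have h7 : D ^ 2 ≤ condConst ^ 2 / 2 * (J.card + σ ^ 2) := by
    have e1 : √(J.card : ℝ) ^ 2 = J.card := sq_sqrt (Nat.cast_nonneg _)
    have e2 : (√(J.card : ℝ) + σ) ^ 2 ≤ 2 * (J.card + σ ^ 2) := by
      nlinarith [sq_nonneg (√(J.card : ℝ) - σ)]
    calc D ^ 2 = condConst ^ 2 / 4 * (√(J.card : ℝ) + σ) ^ 2 := by rw [hD, condConst]; ring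
      _ ≤ condConst ^ 2 / 4 * (2 * (J.card + σ ^ 2)) := by gcongr
      _ = _ := by ring
  have h8 : ∑ i ∈ J, a i ^ 2 ≤ condConst ^ 2 * σ ^ 2 := by linarith
  refine h8.trans ?_
  have h9 : (q' / q) ^ 2 ≤ P ^ (-(2 / q)) := by
    have e1 : q' / q ≤ exp (L / q) := by
      rw [div_le_iff₀ hq0, hq', max_le_iff]
      have e2 : 1 ≤ exp (L / q) := one_le_exp (by positivity)
      have e3 := add_one_le_exp (L / q)
      refine ⟨by nlinarith, ?_⟩
      calc L = L / q * q := by field_simp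
        _ ≤ _ := by gcongr; linarith
    calc _ ≤ exp (L / q) ^ 2 := by gcongr
      _ = _ := by
        rw [hPL, ← exp_mul, ← exp_nat_mul]
        congr 1; push_cast; ring
  calc condConst ^ 2 * σ ^ 2 = (condConst * momentConst * s) ^ 2 * (q' / q) ^ 2 := by
        rw [hσ]; ring
    _ ≤ _ := by gcongr

end LogConcaveCoordinates

lemma tsum_min_dyadic_le {y : ℝ} (hy : 0 < y) :
    ∑' l : ℕ, ENNReal.ofReal (min ((2 ^ l * y) ^ 2) (1 / (2 ^ l * y) ^ 2)) ≤
      ENNReal.ofReal (10 / 3) := by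
  set g : ℕ → ℝ := fun l => (2 ^ l * y) ^ 2 / (1 + (2 ^ l * y) ^ 2) with hg
  have hterm : ∀ l : ℕ, min ((2 ^ l * y) ^ 2) (1 / (2 ^ l * y) ^ 2) ≤
      10 / 3 * (g (l + 1) - g l) := by
    intro l
    have e1 : g (l + 1) = 4 * (2 ^ l * y) ^ 2 / (1 + 4 * (2 ^ l * y) ^ 2) := by
      simp only [hg]; rw [pow_succ]; ring
    rw [e1]
    simp only [hg]
    have hu : 0 < (2 ^ l * y) ^ 2 := by positivity
    set u := (2 ^ l * y) ^ 2
    have e2 : 10 / 3 * (4 * u / (1 + 4 * u) - u / (1 + u)) =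
        10 * u / ((1 + 4 * u) * (1 + u)) := by field_simp; ring
    rw [e2]
    rcases le_total u 1 with h | h
    · refine (min_le_left _ _).trans ?_
      rw [le_div_iff₀ (by positivity)]
      nlinarith [mul_nonneg hu.le hu.le]
    · refine (min_le_right _ _).trans ?_
      rw [div_le_div_iff₀ hu (by positivity)]
      nlinarith
  refine ENNReal.tsum_le_of_sum_range_le fun N => ?_
  rw [← ENNReal.ofReal_sum_of_nonneg fun _ _ => by positivity]
  refine ENNReal.ofReal_le_ofReal ((Finset.sum_le_sum fun l _ => hterm l).trans ?_)
  rw [← Finset.mul_sum, Finset.sum_range_sub]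
  have h1 : g N ≤ 1 := by
    simp only [hg]; rw [div_le_one (by positivity)]; linarith
  have h0 : 0 ≤ g 0 := by simp only [hg]; positivity
  linarith

section LevelSums

variable {n : ℕ} {μ : Measure (EuclideanSpace ℝ (Fin n))} [IsProbabilityMeasure μ]

lemma IsLogConcaveMeasure.measure_abs_coord_ge_rpow_half_le (hμ : IsLogConcaveMeasure μ)
    {i : Fin n} {a : ℝ} (ha : 0 ≤ a)
    (h : ∫⁻ x, ENNReal.ofReal |x i| ^ (2 : ℝ) ∂μ = ENNReal.ofReal a ^ (2 : ℝ)) {m t : ℝ}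
    (hm : 2 ≤ m) (ht : 0 < t) :
    μ {x | t ≤ |x i|} ^ (1 / 2 : ℝ) ≤
      ENNReal.ofReal ((momentConst * (m / 2) * a / t) ^ (m / 2)) := by
  have hmc := momentConst_pos
  have hm0 : 0 < m := by linarith
  have h1 := hμ.lintegral_rpow_le (innerSeminorm (EuclideanSpace.single i (1 : ℝ)))
    (measurable_innerSeminorm _) (p := 2) (q := m) (by norm_num) hm ha
    (by simp_rw [innerSeminorm_single]; exact h.le)
  simp_rw [innerSeminorm_single] at h1
  have ht' : ENNReal.ofReal t ^ m ≠ 0 := by simp [ht]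
  have h2 : μ {x | t ≤ |x i|} ≤ ENNReal.ofReal (momentConst * (m / 2) * a / t) ^ m := by
    rw [ENNReal.ofReal_div_of_pos ht, ENNReal.div_rpow_of_nonneg _ _ hm0.le,
      ENNReal.le_div_iff_mul_le (Or.inl ht') (Or.inl (by finiteness)), mul_comm]
    refine le_trans ?_ ((mul_meas_ge_le_lintegral₀ (by fun_prop) (ENNReal.ofReal t ^ m)).trans h1)
    refine mul_le_mul_right (measure_mono fun x hx => ?_) _
    simp only [Set.mem_ofPred_eq] at hx ⊢
    gcongr
  calc _ ≤ (ENNReal.ofReal (momentConst * (m / 2) * a / t) ^ m) ^ (1 / 2 : ℝ) := by gcongr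
    _ = _ := by
      rw [← ENNReal.rpow_mul, ENNReal.ofReal_rpow_of_nonneg (by positivity) (by positivity)]
      congr 2; ring

/-- The weight of the `l`-th dyadic level in the decomposition of the `l_r`-norm. -/
def levelWeight (r S s₀ : ℝ) (l : ℕ) : ℝ :=
  min ((2 * (2 ^ l * s₀) / S) ^ r) ((2 * (2 ^ l * s₀) / S) ^ 2)

/-- The lowest level in the decomposition of the `l_r`-norm. -/
def baseLevel (r : ℝ) : ℝ := 4 * momentConst * r * condConst

lemma baseLevel_pos {r : ℝ} (hr : 0 < r) : 0 < baseLevel r := by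
  have := momentConst_pos
  have := condConst_pos
  unfold baseLevel; positivity

lemma IsLogConcaveMeasure.tsum_levelWeight_of_le (hμ : IsLogConcaveMeasure μ)
    {i : Fin n} {a : ℝ} (ha : 0 ≤ a)
    (h : ∫⁻ x, ENNReal.ofReal |x i| ^ (2 : ℝ) ∂μ = ENNReal.ofReal a ^ (2 : ℝ))
    (hac : a ≤ condConst) {r S : ℝ} (hr : 2 ≤ r) (hS : 0 < S) :
    ∑' l : ℕ, ENNReal.ofReal (levelWeight r S (baseLevel r) l) *
        μ {x | 2 ^ l * baseLevel r ≤ |x i|} ^ (1 / 2 : ℝ) ≤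
      ENNReal.ofReal ((baseLevel r / S) ^ r) := by
  have hmc := momentConst_pos
  have hcc := condConst_pos
  have hr0 : 0 < r := by linarith
  have hs := baseLevel_pos hr0
  have hterm : ∀ l : ℕ, ENNReal.ofReal (levelWeight r S (baseLevel r) l) *
      μ {x | 2 ^ l * baseLevel r ≤ |x i|} ^ (1 / 2 : ℝ) ≤
      ENNReal.ofReal ((baseLevel r / S) ^ r) * (2⁻¹ : ℝ≥0∞) ^ (l + 1) := by
    intro l
    have hl : (0 : ℝ) < 2 ^ l := by positivity
    have h1 := hμ.measure_abs_coord_ge_rpow_half_le ha h (m := 4 * r) (by linarith)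
      (by positivity : 0 < 2 ^ l * baseLevel r)
    refine (mul_le_mul' (ENNReal.ofReal_le_ofReal (min_le_left _ _)) h1).trans ?_
    have e2 : (2⁻¹ : ℝ≥0∞) ^ (l + 1) = ENNReal.ofReal ((1 / 2) ^ (l + 1)) := by
      rw [ENNReal.ofReal_pow (by norm_num), one_div, ENNReal.ofReal_inv_of_pos (by norm_num)]
      simp
    rw [e2, ← ENNReal.ofReal_mul (by positivity), ← ENNReal.ofReal_mul (by positivity)]
    refine ENNReal.ofReal_le_ofReal ?_
    have e3 : momentConst * (4 * r / 2) * a / (2 ^ l * baseLevel r) ≤ 1 / (2 * 2 ^ l) := by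
      rw [div_le_div_iff₀ (by positivity) (by positivity), baseLevel]
      have : 0 ≤ momentConst * r * 2 ^ l := by positivity
      nlinarith
    calc _ ≤ (2 * (2 ^ l * baseLevel r) / S) ^ r * (1 / (2 * 2 ^ l)) ^ (4 * r / 2) := by
          gcongr
      _ = (baseLevel r / S) ^ r * (1 / (2 * 2 ^ l)) ^ r := by
          rw [show 4 * r / 2 = r + r by ring, rpow_add (by positivity), ← mul_assoc,
            ← mul_rpow (by positivity) (by positivity)]
          congr 2; field_simp
      _ ≤ (baseLevel r / S) ^ r * (1 / (2 * 2 ^ l)) ^ (1 : ℝ) := by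
          gcongr ?_ * ?_
          refine rpow_le_rpow_of_exponent_ge (by positivity) ?_ (by linarith)
          rw [div_le_one (by positivity)]
          have : (1 : ℝ) ≤ 2 ^ l := one_le_pow₀ (by norm_num)
          linarith
      _ = _ := by
          rw [rpow_one, pow_succ, div_pow]; ring
  refine (ENNReal.tsum_le_tsum hterm).trans_eq ?_
  rw [ENNReal.tsum_mul_left, ENNReal.tsum_geometric_add_one, ENNReal.one_sub_inv_two, inv_inv,
    ENNReal.inv_mul_cancel (by norm_num) (by norm_num), mul_one]

lemma IsLogConcaveMeasure.tsum_levelWeight_le (hμ : IsLogConcaveMeasure μ)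
    {i : Fin n} {a : ℝ} (ha : 0 < a)
    (h : ∫⁻ x, ENNReal.ofReal |x i| ^ (2 : ℝ) ∂μ = ENNReal.ofReal a ^ (2 : ℝ))
    {r S s₀ : ℝ} (hS : 0 < S) (hs : 0 < s₀) :
    ∑' l : ℕ, ENNReal.ofReal (levelWeight r S s₀ l) *
        μ {x | 2 ^ l * s₀ ≤ |x i|} ^ (1 / 2 : ℝ) ≤
      ENNReal.ofReal (214 * momentConst ^ 2 * a ^ 2 / S ^ 2) := by
  have hmc := momentConst_pos
  set b := momentConst * (8 / 2) * a with hb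
  have hb0 : 0 < b := by positivity
  have hterm : ∀ l : ℕ, ENNReal.ofReal (levelWeight r S s₀ l) *
      μ {x | 2 ^ l * s₀ ≤ |x i|} ^ (1 / 2 : ℝ) ≤
      ENNReal.ofReal (4 * b ^ 2 / S ^ 2) *
        ENNReal.ofReal (min ((2 ^ l * (s₀ / b)) ^ 2) (1 / (2 ^ l * (s₀ / b)) ^ 2)) := by
    intro l
    have hl : (0 : ℝ) < 2 ^ l := by positivity
    have h1 := hμ.measure_abs_coord_ge_rpow_half_le ha.le h (m := 8) (by norm_num)
      (by positivity : 0 < 2 ^ l * s₀)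
    rw [← hb] at h1
    have h2 : μ {x | 2 ^ l * s₀ ≤ |x i|} ^ (1 / 2 : ℝ) ≤ ENNReal.ofReal 1 := by
      rw [ENNReal.ofReal_one]
      exact ENNReal.rpow_le_one prob_le_one (by norm_num)
    have h3 := le_min h2 h1
    rw [← ENNReal.ofReal_min] at h3
    refine (mul_le_mul' (ENNReal.ofReal_le_ofReal (min_le_right _ _)) h3).trans ?_
    rw [← ENNReal.ofReal_mul (by positivity), ← ENNReal.ofReal_mul (by positivity)]
    refine ENNReal.ofReal_le_ofReal (le_of_eq ?_)
    rw [mul_min_of_nonneg _ _ (by positivity), mul_min_of_nonneg _ _ (by positivity)]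
    have e8 : (8 / 2 : ℝ) = (4 : ℕ) := by norm_num
    rw [e8, rpow_natCast]
    congr 1
    · field_simp; norm_num
    · field_simp; norm_num
  refine (ENNReal.tsum_le_tsum hterm).trans ?_
  rw [ENNReal.tsum_mul_left]
  refine (mul_le_mul_right (tsum_min_dyadic_le (by positivity)) _).trans ?_
  rw [← ENNReal.ofReal_mul (by positivity)]
  refine ENNReal.ofReal_le_ofReal ?_
  rw [hb, div_mul_eq_mul_div]
  refine div_le_div_of_nonneg_right ?_ (by positivity)
  have : 0 ≤ momentConst ^ 2 * a ^ 2 := by positivity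
  nlinarith

end LevelSums

/-- Moments of a weighted sum of indicators, from a bound on one-step conditional sums. -/
lemma setLIntegral_tsum_indicator_pow_le {α ι : Type*} [MeasurableSpace α] [Countable ι]
    {μ : Measure α} (𝒞 : Set (Set α)) (hm : ∀ A ∈ 𝒞, MeasurableSet A)
    (hi : ∀ A ∈ 𝒞, ∀ B ∈ 𝒞, A ∩ B ∈ 𝒞) {B : ι → Set α} (hB : ∀ b, B b ∈ 𝒞) (c : ι → ℝ≥0∞)
    {D : ℝ≥0∞} {q : ℝ} (hq : 0 < q)
    (key : ∀ A ∈ 𝒞, μ A ≠ 0 → ∀ θ : ℝ, 1 / 2 ≤ θ → θ ≤ 1 →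
      ∑' b, c b * μ (A ∩ B b) ^ θ ≤ D * μ A ^ (θ - 2 / q)) (j : ℕ) (hj : (j : ℝ) ≤ q / 4)
    {A : Set α} (hA : A ∈ 𝒞) :
    ∫⁻ x in A, (∑' b, c b * (B b).indicator 1 x) ^ j ∂μ ≤ D ^ j * μ A ^ (1 - 2 * j / q) := by
  induction j generalizing A with
  | zero => simp
  | succ j ih =>
    by_cases hA0 : μ A = 0
    · rw [Measure.restrict_eq_zero.2 hA0]; simp
    have hj' : (j : ℝ) + 1 ≤ q / 4 := by exact_mod_cast hj
    have hVm : Measurable fun x => ∑' b, c b * (B b).indicator (1 : α → ℝ≥0∞) x :=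
      Measurable.tsum fun b =>
        (measurable_one.indicator (hm _ (hB b))).const_mul _
    set V := fun x => ∑' b, c b * (B b).indicator (1 : α → ℝ≥0∞) x with hV
    have h1 : ∀ x, V x ^ (j + 1) = ∑' b, c b * (B b).indicator (fun x => V x ^ j) x := by
      intro x
      rw [pow_succ', hV, ← ENNReal.tsum_mul_right]
      refine tsum_congr fun b => ?_
      by_cases hx : x ∈ B b <;> simp [hx]
    calc ∫⁻ x in A, V x ^ (j + 1) ∂μ
        = ∑' b, c b * ∫⁻ x in A ∩ B b, V x ^ j ∂μ := by
          simp_rw [h1]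
          rw [lintegral_tsum fun b =>
            (((hVm.pow_const j).indicator (hm _ (hB b))).const_mul _).aemeasurable]
          refine tsum_congr fun b => ?_
          rw [lintegral_const_mul _ ((hVm.pow_const j).indicator (hm _ (hB b))),
            lintegral_indicator (hm _ (hB b)), Measure.restrict_restrict (hm _ (hB b)),
            Set.inter_comm]
      _ ≤ ∑' b, D ^ j * (c b * μ (A ∩ B b) ^ (1 - 2 * j / q)) := by
          refine ENNReal.tsum_le_tsum fun b => ?_
          rw [mul_left_comm]
          exact mul_le_mul_right (ih (by linarith) (hi _ hA _ (hB b))) _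
      _ ≤ D ^ j * (D * μ A ^ (1 - 2 * j / q - 2 / q)) := by
          rw [ENNReal.tsum_mul_left]
          refine mul_le_mul_right (key A hA hA0 _ ?_ ?_) _
          · have : 2 * j / q ≤ 1 / 2 := by rw [div_le_iff₀ hq]; linarith
            linarith
          · have : 0 ≤ 2 * j / q := by positivity
            linarith
      _ = _ := by
          rw [pow_succ, mul_assoc]
          congr 3
          push_cast; ring

section LevelDecomposition

variable {n : ℕ} {ν : Measure (EuclideanSpace ℝ (Fin n))} [IsProbabilityMeasure ν]

/-- The half-space where a signed coordinate exceeds a dyadic level. -/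
def levelSet (s₀ : ℝ) (b : Fin n × Bool × ℕ) : Set (EuclideanSpace ℝ (Fin n)) :=
  {x | 2 ^ b.2.2 * s₀ ≤ (if b.2.1 then 1 else -1) * x b.1}

lemma convex_levelSet (s₀ : ℝ) (b : Fin n × Bool × ℕ) : Convex ℝ (levelSet s₀ b) :=
  convex_halfSpace_ge
    ((IsLinearMap.mk (fun x y => by simp [mul_add])
      (fun c x => by simp [mul_left_comm]) : IsLinearMap ℝ fun x : EuclideanSpace ℝ (Fin n) =>
        (if b.2.1 then (1 : ℝ) else -1) * x b.1)) _

lemma measurableSet_levelSet (s₀ : ℝ) (b : Fin n × Bool × ℕ) : MeasurableSet (levelSet s₀ b) :=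
  measurableSet_le (by fun_prop) (by fun_prop)

lemma levelSet_subset (s₀ : ℝ) (b : Fin n × Bool × ℕ) :
    levelSet s₀ b ⊆ {x | 2 ^ b.2.2 * s₀ ≤ |x b.1|} := by
  intro x hx
  refine le_trans (Set.mem_ofPred_eq ▸ hx : _ ≤ _) ?_
  split_ifs
  · rw [one_mul]; exact le_abs_self _
  · rw [neg_one_mul]; exact neg_le_abs _

/-- The growth constant in the moment bound for the level decomposition. -/
def levelConst : ℝ := 2 * (1 + 214 * momentConst ^ 2 * (condConst * momentConst) ^ 2)

lemma one_le_levelConst : 1 ≤ levelConst := by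
  have : 0 ≤ 214 * momentConst ^ 2 * (condConst * momentConst) ^ 2 := by positivity
  unfold levelConst; linarith

lemma IsLogConcaveMeasure.tsum_levelSet_le (hν : IsLogConcaveMeasure ν)
    (h2 : ∀ i, ∫⁻ x, ENNReal.ofReal |x i| ^ (2 : ℝ) ∂ν ≤ 1) {q r s S : ℝ} (hq : 2 ≤ q)
    (hr : 2 ≤ r) (hs : 0 ≤ s) (hS : 0 < S) (hsS : s ≤ S)
    (hn : n * (baseLevel r / S) ^ r ≤ 1)
    (hw : ∀ z, ∫⁻ x, ENNReal.ofReal |⟪z, x⟫| ^ q ∂ν ≤ ENNReal.ofReal (s * ‖z‖) ^ q)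
    {A : Set (EuclideanSpace ℝ (Fin n))} (hAc : Convex ℝ A) (hAm : MeasurableSet A)
    (hA : ν A ≠ 0) {θ : ℝ} (hθ : 1 / 2 ≤ θ) :
    ∑' b : Fin n × Bool × ℕ, ENNReal.ofReal (levelWeight r S (baseLevel r) b.2.2) *
        ν (A ∩ levelSet (baseLevel r) b) ^ θ ≤
      ENNReal.ofReal levelConst * ν A ^ (θ - 2 / q) := by
  have hq0 : 0 < q := by linarith
  have hmc := momentConst_pos
  have hcc := condConst_pos
  have hs0 := baseLevel_pos (by linarith : 0 < r)
  set μ := ProbabilityTheory.cond ν A with hμ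
  have : IsProbabilityMeasure μ := cond_isProbabilityMeasure hA
  have hμlc : IsLogConcaveMeasure μ := hν.cond hAc hAm
  have hAt : ν A ≠ ∞ := measure_ne_top _ _
  have hfin : ∀ i, ∫⁻ x, ENNReal.ofReal |x i| ^ (2 : ℝ) ∂μ ≠ ∞ := by
    intro i
    refine ne_top_of_le_ne_top ?_ (lintegral_mono' (cond_le_smul ν A) le_rfl)
    rw [lintegral_smul_measure, smul_eq_mul]
    have h3 : ∫⁻ x, ENNReal.ofReal |x i| ^ (2 : ℝ) ∂ν ≠ ∞ := ne_top_of_le_ne_top (by simp) (h2 i)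
    exact ENNReal.mul_ne_top (ENNReal.inv_ne_top.2 hA) h3
  have hex : ∀ i, ∃ a : ℝ, 0 ≤ a ∧
      ∫⁻ x, ENNReal.ofReal |x i| ^ (2 : ℝ) ∂μ = ENNReal.ofReal a ^ (2 : ℝ) := by
    intro i
    have := hfin i
    refine ⟨((∫⁻ x, ENNReal.ofReal |x i| ^ (2 : ℝ) ∂μ) ^ (1 / (2 : ℝ))).toReal,
      ENNReal.toReal_nonneg, ?_⟩
    rw [ENNReal.ofReal_toReal (by finiteness), ← ENNReal.rpow_mul,
      one_div_mul_cancel (by norm_num), ENNReal.rpow_one]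
  choose a ha0 ha using hex
  have hsum := hν.sum_sq_cond_le h2 hq hs hw hA ha0 ha
  set P := (ν A).toReal with hP
  have hP0 : 0 < P := ENNReal.toReal_pos hA hAt
  have hνA : ν A = ENNReal.ofReal P := (ENNReal.ofReal_toReal hAt).symm
  have hP1 : P ≤ 1 := ENNReal.toReal_le_of_le_ofReal (by norm_num) (by simpa using prob_le_one)
  set w : Fin n → ℕ → ℝ≥0∞ := fun i l => ENNReal.ofReal (levelWeight r S (baseLevel r) l) *
    μ {x | 2 ^ l * baseLevel r ≤ |x i|} ^ (1 / 2 : ℝ) with hwdef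
  have hcoord : ∀ i, ∑' l, w i l ≤ ENNReal.ofReal ((baseLevel r / S) ^ r +
      if condConst ≤ a i then 214 * momentConst ^ 2 * a i ^ 2 / S ^ 2 else 0) := by
    intro i
    split_ifs with hi
    · refine (hμlc.tsum_levelWeight_le (by linarith) (ha i) hS hs0).trans
        (ENNReal.ofReal_le_ofReal ?_)
      have : 0 ≤ (baseLevel r / S) ^ r := by positivity
      linarith
    · rw [add_zero]
      exact hμlc.tsum_levelWeight_of_le (ha0 i) (ha i) (not_le.1 hi).le hr hS
  have htot : ∑' b : Fin n × Bool × ℕ, w b.1 b.2.2 ≤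
      ENNReal.ofReal (levelConst * P ^ (-(2 / q))) := by
    rw [ENNReal.tsum_prod', tsum_fintype]
    have e1 : ∀ i, ∑' b : Bool × ℕ, w i b.2 = 2 * ∑' l, w i l := by
      intro i
      rw [ENNReal.tsum_prod', tsum_fintype]; simp [two_mul]
    simp_rw [e1]
    rw [← Finset.mul_sum]
    calc _ ≤ 2 * ∑ i, ENNReal.ofReal ((baseLevel r / S) ^ r +
          if condConst ≤ a i then 214 * momentConst ^ 2 * a i ^ 2 / S ^ 2 else 0) := by
          gcongr with i; exact hcoord i
      _ = ENNReal.ofReal (2 * (n * (baseLevel r / S) ^ r + 214 * momentConst ^ 2 / S ^ 2 *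
          ∑ i with condConst ≤ a i, a i ^ 2)) := by
          rw [← ENNReal.ofReal_sum_of_nonneg fun i _ => by split_ifs <;> positivity,
            ENNReal.ofReal_mul (by norm_num : (0 : ℝ) ≤ 2), Finset.sum_add_distrib,
            ← Finset.sum_filter, Finset.mul_sum]
          simp only [Finset.sum_const, Finset.card_univ, Fintype.card_fin, nsmul_eq_mul,
            ENNReal.ofReal_ofNat]
          congr 4
          ext i; ring
      _ ≤ _ := by
          refine ENNReal.ofReal_le_ofReal ?_
          have hPq : 1 ≤ P ^ (-(2 / q)) :=
            one_le_rpow_of_pos_of_le_one_of_nonpos hP0 hP1 (by simp; positivity)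
          have e2 : 214 * momentConst ^ 2 / S ^ 2 * ∑ i with condConst ≤ a i, a i ^ 2 ≤
              214 * momentConst ^ 2 * (condConst * momentConst) ^ 2 * P ^ (-(2 / q)) := by
            calc _ ≤ 214 * momentConst ^ 2 / S ^ 2 *
                  ((condConst * momentConst * S) ^ 2 * P ^ (-(2 / q))) := by
                  gcongr
                  refine hsum.trans ?_
                  gcongr
              _ = _ := by field_simp
          unfold levelConst
          linarith
  calc _ ≤ ∑' b : Fin n × Bool × ℕ, ν A ^ θ * w b.1 b.2.2 := by
        refine ENNReal.tsum_le_tsum fun b => ?_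
        rw [hwdef, mul_left_comm]
        refine mul_le_mul_right ?_ _
        rw [← cond_mul_eq_inter hAm, mul_comm, ENNReal.mul_rpow_of_nonneg _ _ (by linarith)]
        refine mul_le_mul_right ?_ _
        refine (ENNReal.rpow_le_rpow_of_exponent_ge prob_le_one hθ).trans ?_
        gcongr
        exact levelSet_subset _ _
    _ ≤ ν A ^ θ * ENNReal.ofReal (levelConst * P ^ (-(2 / q))) := by
        rw [ENNReal.tsum_mul_left]; gcongr
    _ = _ := by
        have hlc := one_le_levelConst
        rw [ENNReal.ofReal_mul (by linarith), ← ENNReal.ofReal_rpow_of_pos hP0, ← hνA,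
          mul_left_comm, ← ENNReal.rpow_add _ _ hA hAt, ← sub_eq_add_neg]

lemma lrNorm_nonneg (r : ℝ) (x : EuclideanSpace ℝ (Fin n)) : 0 ≤ lrNorm r x := by
  unfold lrNorm; positivity

lemma measurable_lrNorm (r : ℝ) : Measurable (lrNorm (n := n) r) := by
  unfold lrNorm; fun_prop

/-- An `l_r` norm is controlled by a sum that is quadratic for large coordinates only. -/
lemma lrNorm_sq_le {r S : ℝ} (hr : 2 ≤ r) (hS : 0 < S) (x : EuclideanSpace ℝ (Fin n)) :
    lrNorm r x ^ 2 ≤ S ^ 2 * (1 + ∑ i, min ((|x i| / S) ^ r) ((|x i| / S) ^ 2)) := by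
  set V := ∑ i, min ((|x i| / S) ^ r) ((|x i| / S) ^ 2) with hV
  have hr0 : 0 < r := by linarith
  have hfi : ∀ i, 0 ≤ min ((|x i| / S) ^ r) ((|x i| / S) ^ 2) := fun i => by positivity
  have hV0 : 0 ≤ V := Finset.sum_nonneg fun i _ => hfi i
  have hterm : ∀ i, (|x i| / S) ^ r ≤
      min ((|x i| / S) ^ r) ((|x i| / S) ^ 2) * (1 + V) ^ ((r - 2) / 2) := by
    intro i
    have hle : min ((|x i| / S) ^ r) ((|x i| / S) ^ 2) ≤ V :=
      Finset.single_le_sum (f := fun i => min ((|x i| / S) ^ r) ((|x i| / S) ^ 2))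
        (fun i _ => hfi i) (Finset.mem_univ i)
    have hu0 : 0 ≤ |x i| / S := by positivity
    set u := |x i| / S
    rcases le_total u 1 with h | h
    · have : min (u ^ r) (u ^ 2) = u ^ r := by
        refine min_eq_left ?_
        rcases hu0.eq_or_lt with h0 | h0
        · simp [← h0, hr0.ne']
        · rw [← rpow_natCast]
          exact rpow_le_rpow_of_exponent_ge h0 h (by simpa using hr)
      rw [this]
      refine le_mul_of_one_le_right (by positivity) (one_le_rpow (by linarith) (by linarith))
    · have : min (u ^ r) (u ^ 2) = u ^ 2 := by
        refine min_eq_right ?_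
        rw [← rpow_natCast]
        exact rpow_le_rpow_of_exponent_le h (by simpa using hr)
      rw [this] at hle ⊢
      calc u ^ r = u ^ 2 * (u ^ 2) ^ ((r - 2) / 2) := by
            rw [← rpow_natCast, ← rpow_mul hu0, ← rpow_add (by linarith)]
            congr 1; push_cast; ring
        _ ≤ _ := by gcongr; linarith
  have hsum : ∑ i, (|x i| / S) ^ r ≤ (1 + V) ^ (r / 2) := by
    calc _ ≤ V * (1 + V) ^ ((r - 2) / 2) := by
          rw [hV, Finset.sum_mul]; exact Finset.sum_le_sum fun i _ => hterm i
      _ ≤ (1 + V) * (1 + V) ^ ((r - 2) / 2) := by gcongr; linarith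
      _ = _ := by
          rw [← rpow_one_add' (by linarith) (by linarith)]
          congr 1; ring
  have h2 : lrNorm r x ≤ S * (1 + V) ^ (1 / 2 : ℝ) := by
    calc lrNorm r x = (S ^ r * ∑ i, (|x i| / S) ^ r) ^ (1 / r) := by
          unfold lrNorm
          rw [Finset.mul_sum]
          congr 1
          refine Finset.sum_congr rfl fun i _ => ?_
          rw [← mul_rpow hS.le (by positivity)]
          field_simp
      _ ≤ (S ^ r * (1 + V) ^ (r / 2)) ^ (1 / r) := by gcongr
      _ = _ := by
          rw [mul_rpow (by positivity) (by positivity), ← rpow_mul hS.le,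
            ← rpow_mul (by positivity)]
          field_simp
          simp
  calc lrNorm r x ^ 2 ≤ (S * (1 + V) ^ (1 / 2 : ℝ)) ^ 2 := by
        gcongr; exact lrNorm_nonneg r x
    _ = _ := by
        rw [mul_pow, ← sqrt_eq_rpow, sq_sqrt (by linarith)]

lemma sum_min_le_tsum_levelSet {r S : ℝ} (hr : 2 ≤ r) (hS : 0 < S)
    (hn : n * (baseLevel r / S) ^ r ≤ 1) (x : EuclideanSpace ℝ (Fin n)) :
    ENNReal.ofReal (∑ i, min ((|x i| / S) ^ r) ((|x i| / S) ^ 2)) ≤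
      1 + ∑' b : Fin n × Bool × ℕ, ENNReal.ofReal (levelWeight r S (baseLevel r) b.2.2) *
        (levelSet (baseLevel r) b).indicator 1 x := by
  have hs0 := baseLevel_pos (by linarith : 0 < r)
  set s₀ := baseLevel r
  set G : Fin n × Bool × ℕ → ℝ≥0∞ := fun b => ENNReal.ofReal (levelWeight r S s₀ b.2.2) *
        (levelSet s₀ b).indicator 1 x with hG
  have hterm : ∀ i, ENNReal.ofReal (min ((|x i| / S) ^ r) ((|x i| / S) ^ 2)) ≤
      ENNReal.ofReal ((s₀ / S) ^ r) + ∑' c : Bool × ℕ, G (i, c) := by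
    intro i
    rcases lt_or_ge |x i| s₀ with h | h
    · refine le_add_right (ENNReal.ofReal_le_ofReal ((min_le_left _ _).trans ?_))
      gcongr
    · obtain ⟨l, hl1, hl2⟩ := exists_nat_pow_near (x := |x i| / s₀) (y := 2)
        (by rwa [one_le_div hs0]) (by norm_num)
      rw [le_div_iff₀ hs0] at hl1
      rw [div_lt_iff₀ hs0] at hl2
      refine le_add_left (le_trans ?_ (ENNReal.le_tsum (decide (0 ≤ x i), l)))
      have hmem : x ∈ levelSet s₀ (i, decide (0 ≤ x i), l) := by
        refine Set.mem_ofPred_eq ▸ (hl1.trans (le_of_eq ?_))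
        by_cases h0 : 0 ≤ x i
        · simp [h0, abs_of_nonneg]
        · simp [h0, abs_of_neg (not_le.1 h0)]
      simp only [hG, Set.indicator_of_mem hmem, Pi.one_apply, mul_one]
      have hle : |x i| ≤ 2 * (2 ^ l * s₀) := by rw [pow_succ] at hl2; linarith
      unfold levelWeight
      gcongr
  calc _ = ∑ i, ENNReal.ofReal (min ((|x i| / S) ^ r) ((|x i| / S) ^ 2)) :=
        ENNReal.ofReal_sum_of_nonneg fun i _ => by positivity
    _ ≤ ∑ i : Fin n, (ENNReal.ofReal ((s₀ / S) ^ r) + ∑' c : Bool × ℕ, G (i, c)) :=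
        Finset.sum_le_sum fun i _ => hterm i
    _ = ENNReal.ofReal (n * (s₀ / S) ^ r) + ∑' b, G b := by
        rw [Finset.sum_add_distrib, ENNReal.tsum_prod', tsum_fintype]
        simp [ENNReal.ofReal_mul]
    _ ≤ _ := by
        gcongr
        simpa using ENNReal.ofReal_le_ofReal hn

lemma IsLogConcaveMeasure.lintegral_lrNorm_rpow_le (hν : IsLogConcaveMeasure ν)
    (h2 : ∀ i, ∫⁻ x, ENNReal.ofReal |x i| ^ (2 : ℝ) ∂ν ≤ 1) {r s S : ℝ} {k : ℕ} (hk : 1 ≤ k)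
    (hr : 2 ≤ r) (hs : 0 ≤ s) (hS : 0 < S) (hsS : s ≤ S)
    (hn : n * (baseLevel r / S) ^ r ≤ 1)
    (hw : ∀ z, ∫⁻ x, ENNReal.ofReal |⟪z, x⟫| ^ (4 * k : ℝ) ∂ν ≤
      ENNReal.ofReal (s * ‖z‖) ^ (4 * k : ℝ)) :
    ∫⁻ x, ENNReal.ofReal (lrNorm r x) ^ (2 * k : ℝ) ∂ν ≤
      ENNReal.ofReal (3 * √levelConst * S) ^ (2 * k : ℝ) := by
  have hk' : (1 : ℝ) ≤ k := by exact_mod_cast hk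
  have hL := one_le_levelConst
  set V : EuclideanSpace ℝ (Fin n) → ℝ≥0∞ := fun x =>
    ∑' b : Fin n × Bool × ℕ, ENNReal.ofReal (levelWeight r S (baseLevel r) b.2.2) *
        (levelSet (baseLevel r) b).indicator 1 x with hV
  have hVm : Measurable V := Measurable.tsum fun b =>
    (measurable_one.indicator (measurableSet_levelSet _ b)).const_mul _
  have hVk : ∫⁻ x, V x ^ k ∂ν ≤ ENNReal.ofReal levelConst ^ k := by
    have := setLIntegral_tsum_indicator_pow_le (μ := ν)
      {A : Set (EuclideanSpace ℝ (Fin n)) | Convex ℝ A ∧ MeasurableSet A}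
      (fun A hA => hA.2) (fun A hA B hB => ⟨hA.1.inter hB.1, hA.2.inter hB.2⟩)
      (B := levelSet (baseLevel r))
      (fun b => ⟨convex_levelSet _ b, measurableSet_levelSet _ b⟩)
      (fun b => ENNReal.ofReal (levelWeight r S (baseLevel r) b.2.2))
      (D := ENNReal.ofReal levelConst) (q := 4 * k) (by linarith)
      (fun A hA hA0 θ hθ _ => hν.tsum_levelSet_le h2 (by linarith) hr hs hS hsS hn hw hA.1 hA.2
        hA0 hθ) k (by linarith) (A := Set.univ) ⟨convex_univ, MeasurableSet.univ⟩
    simpa using this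
  have hpt : ∀ x, ENNReal.ofReal (lrNorm r x) ^ (2 * k : ℝ) ≤
      ENNReal.ofReal (S ^ 2) ^ k * (4 ^ k + 2 ^ k * V x ^ k) := by
    intro x
    calc ENNReal.ofReal (lrNorm r x) ^ (2 * k : ℝ)
        = ENNReal.ofReal (lrNorm r x ^ 2) ^ k := by
          rw [ENNReal.ofReal_pow (lrNorm_nonneg r x), ← pow_mul]
          exact_mod_cast ENNReal.rpow_natCast _ (2 * k)
      _ ≤ (ENNReal.ofReal (S ^ 2) * (2 + V x)) ^ k := by
          gcongr
          refine (ENNReal.ofReal_le_ofReal (lrNorm_sq_le hr hS x)).trans ?_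
          rw [ENNReal.ofReal_mul (by positivity), ENNReal.ofReal_add zero_le_one
            (Finset.sum_nonneg fun i _ => by positivity), ENNReal.ofReal_one]
          refine mul_le_mul_right
            ((add_le_add_right (sum_min_le_tsum_levelSet hr hS hn x) 1).trans ?_) _
          rw [← add_assoc, one_add_one_eq_two]
      _ ≤ _ := by
          rw [mul_pow]
          gcongr
          rcases le_total (V x) 2 with h | h
          · refine le_add_right (pow_le_pow_left' ((add_le_add_right h 2).trans ?_) k)
            norm_num
          · refine le_add_left ?_
            rw [← mul_pow, two_mul]
            exact pow_le_pow_left' (add_le_add_left h _) k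
  calc _ ≤ ∫⁻ x, ENNReal.ofReal (S ^ 2) ^ k * (4 ^ k + 2 ^ k * V x ^ k) ∂ν :=
        lintegral_mono hpt
    _ = ENNReal.ofReal (S ^ 2) ^ k * (4 ^ k + 2 ^ k * ∫⁻ x, V x ^ k ∂ν) := by
        rw [lintegral_const_mul _ (by fun_prop), lintegral_add_left (by fun_prop),
          lintegral_const_mul _ (by fun_prop)]
        simp
    _ ≤ ENNReal.ofReal (S ^ 2) ^ k * (4 ^ k + 2 ^ k * ENNReal.ofReal levelConst ^ k) := by
        gcongr
    _ ≤ ENNReal.ofReal (S ^ 2) ^ k * (9 ^ k * ENNReal.ofReal levelConst ^ k) := by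
        refine mul_le_mul_right ?_ _
        have h1 : (1 : ℝ≥0∞) ≤ ENNReal.ofReal levelConst ^ k :=
          one_le_pow₀ (by simpa using hL)
        have h2' : (4 : ℝ≥0∞) ^ k + 2 ^ k ≤ 9 ^ k := by
          have : 4 ^ k + 2 ^ k ≤ 9 ^ k := by
            calc 4 ^ k + 2 ^ k ≤ (4 + 2) ^ k :=
                pow_add_pow_le (by norm_num) (by norm_num) (by omega)
              _ ≤ _ := Nat.pow_le_pow_left (by norm_num) k
          exact_mod_cast this
        calc (4 : ℝ≥0∞) ^ k + 2 ^ k * ENNReal.ofReal levelConst ^ k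
            ≤ 4 ^ k * ENNReal.ofReal levelConst ^ k + 2 ^ k * ENNReal.ofReal levelConst ^ k :=
              add_le_add_left (le_mul_of_one_le_right' h1) _
          _ ≤ _ := by rw [← add_mul]; exact mul_le_mul_left h2' _
    _ = ENNReal.ofReal ((3 * √levelConst * S) ^ 2) ^ k := by
        rw [mul_pow, mul_pow, sq_sqrt (by linarith), ENNReal.ofReal_mul (by positivity),
          ENNReal.ofReal_mul (by positivity)]
        norm_num
        ring
    _ = _ := by
        rw [ENNReal.ofReal_pow (by positivity), ← pow_mul]
        exact_mod_cast (ENNReal.rpow_natCast _ (2 * k)).symm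

end LevelDecomposition

section LrMoments

variable {n : ℕ} {ν : Measure (EuclideanSpace ℝ (Fin n))} [IsProbabilityMeasure ν]

/-- The constant in the moment bound for `l_r`-norms. -/
def lrConst : ℝ := 3 * √levelConst * (4 * momentConst * condConst + 8 * momentConst)

lemma lrConst_pos : 0 < lrConst := by
  have := momentConst_pos
  have := condConst_pos
  have := one_le_levelConst
  unfold lrConst; positivity

lemma IsLogConcaveMeasure.lintegral_lrNorm_rpow_le_of_inner (hν : IsLogConcaveMeasure ν)
    (h2 : ∀ i, ∫⁻ x, ENNReal.ofReal |x i| ^ (2 : ℝ) ∂ν ≤ 1) (hn : 0 < n) {r p σ : ℝ}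
    (hr : 2 ≤ r) (hp : 1 ≤ p) (hσ : 0 ≤ σ)
    (hw : ∀ z, ∫⁻ x, ENNReal.ofReal |⟪z, x⟫| ^ p ∂ν ≤ ENNReal.ofReal (σ * ‖z‖) ^ p) :
    ∫⁻ x, ENNReal.ofReal (lrNorm r x) ^ p ∂ν ≤
      ENNReal.ofReal (lrConst * (r * (n : ℝ) ^ (1 / r) + σ)) ^ p := by
  have hmc := momentConst_pos
  have hcc := condConst_pos
  have hr0 : 0 < r := by linarith
  have hs0 := baseLevel_pos hr0
  have hn0 : (0 : ℝ) < n := by exact_mod_cast hn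
  have hN : (0 : ℝ) < (n : ℝ) ^ (1 / r) := by positivity
  set k := ⌈p⌉₊
  have hpk : p ≤ k := Nat.le_ceil p
  have hkp : (k : ℝ) < p + 1 := Nat.ceil_lt_add_one (by linarith)
  have hk : 1 ≤ k := by
    have : (1 : ℝ) ≤ k := hp.trans hpk
    exact_mod_cast this
  set s := momentConst * 8 * σ with hs
  have hs' : 0 ≤ s := by positivity
  set S := baseLevel r * (n : ℝ) ^ (1 / r) + s with hS
  have hS0 : 0 < S := by positivity
  have hq : ∀ z, ∫⁻ x, ENNReal.ofReal |⟪z, x⟫| ^ (4 * k : ℝ) ∂ν ≤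
      ENNReal.ofReal (s * ‖z‖) ^ (4 * k : ℝ) := by
    intro z
    have := hν.lintegral_rpow_le (innerSeminorm z) (measurable_innerSeminorm z) hp
      (by linarith : p ≤ 4 * k) (by positivity) (hw z)
    simp_rw [innerSeminorm_apply] at this
    have h8 : 4 * (k : ℝ) / p ≤ 8 := by
      rw [div_le_iff₀ (by linarith)]
      linarith
    refine this.trans (ENNReal.rpow_le_rpow (ENNReal.ofReal_le_ofReal ?_) (by positivity))
    rw [hs, mul_assoc (momentConst * 8)]
    gcongr
  have hnS : n * (baseLevel r / S) ^ r ≤ 1 := by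
    calc n * (baseLevel r / S) ^ r ≤ n * (((n : ℝ) ^ (1 / r))⁻¹) ^ r := by
          gcongr
          rw [div_le_iff₀ hS0, inv_mul_eq_div, le_div_iff₀ hN]
          linarith
      _ = 1 := by
          rw [inv_rpow hN.le, ← rpow_mul hn0.le, one_div_mul_cancel hr0.ne', rpow_one,
            mul_inv_cancel₀ hn0.ne']
  have h3 := hν.lintegral_lrNorm_rpow_le h2 hk hr hs' hS0 (by rw [hS]; nlinarith) hnS hq
  refine (lintegral_rpow_le_of_exponent_le ((measurable_lrNorm r).ennreal_ofReal)
    (by linarith) (by linarith : p ≤ 2 * k) h3).trans ?_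
  refine ENNReal.rpow_le_rpow (ENNReal.ofReal_le_ofReal ?_) (by linarith)
  rw [lrConst, mul_assoc (3 * √levelConst)]
  refine mul_le_mul_of_nonneg_left ?_ (by positivity)
  rw [hS, hs, baseLevel]
  nlinarith [mul_pos hmc (mul_pos hr0 hN), mul_nonneg (mul_pos hmc hcc).le hσ]

end LrMoments

section Bochner

variable {α : Type*} [MeasurableSpace α] {μ : Measure α} {f : α → ℝ} {M p : ℝ}

lemma integral_rpow_eq_toReal (hf : Measurable f) (hf0 : ∀ x, 0 ≤ f x) (hp : 0 < p) :
    ∫ x, f x ^ p ∂μ = (∫⁻ x, ENNReal.ofReal (f x) ^ p ∂μ).toReal := by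
  rw [integral_eq_lintegral_of_nonneg_ae (ae_of_all _ fun x => rpow_nonneg (hf0 x) p)
    (hf.pow_const p).aestronglyMeasurable]
  simp_rw [ENNReal.ofReal_rpow_of_nonneg (hf0 _) hp.le]

lemma integral_rpow_one_div_le (hf : Measurable f) (hf0 : ∀ x, 0 ≤ f x) (hp : 0 < p)
    (hM : 0 ≤ M) (h : ∫⁻ x, ENNReal.ofReal (f x) ^ p ∂μ ≤ ENNReal.ofReal M ^ p) :
    (∫ x, f x ^ p ∂μ) ^ (1 / p) ≤ M := by
  rw [integral_rpow_eq_toReal hf hf0 hp]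
  calc _ ≤ ((ENNReal.ofReal M ^ p).toReal) ^ (1 / p) := by
        gcongr
        finiteness
    _ = M := by
        rw [← ENNReal.toReal_rpow, ENNReal.toReal_ofReal hM, ← rpow_mul hM,
          mul_one_div_cancel hp.ne', rpow_one]

lemma lintegral_ofReal_rpow_le (hf : Measurable f) (hf0 : ∀ x, 0 ≤ f x) (hp : 0 < p)
    (hfin : ∫⁻ x, ENNReal.ofReal (f x) ^ p ∂μ ≠ ∞) (h : (∫ x, f x ^ p ∂μ) ^ (1 / p) ≤ M) :
    ∫⁻ x, ENNReal.ofReal (f x) ^ p ∂μ ≤ ENNReal.ofReal M ^ p := by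
  rw [integral_rpow_eq_toReal hf hf0 hp] at h
  have hM : 0 ≤ M := le_trans (by positivity) h
  rw [← ENNReal.ofReal_toReal hfin, ENNReal.ofReal_rpow_of_nonneg hM hp.le]
  refine ENNReal.ofReal_le_ofReal ?_
  calc _ = (((∫⁻ x, ENNReal.ofReal (f x) ^ p ∂μ).toReal) ^ (1 / p)) ^ p := by
        rw [← rpow_mul ENNReal.toReal_nonneg, one_div_mul_cancel hp.ne', rpow_one]
    _ ≤ _ := by gcongr

end Bochner

section RandomVector

variable {n : ℕ} {μ : Measure Ω} {X : Ω → EuclideanSpace ℝ (Fin n)}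

lemma IsIsotropic.lintegral_coord (h : IsIsotropic μ X) (hX : Measurable X) (i : Fin n) :
    ∫⁻ x, ENNReal.ofReal |x i| ^ (2 : ℝ) ∂μ.map X = 1 := by
  have h1 : ∫ ω, X ω i * X ω i ∂μ = 1 := by simpa using h.2 i i
  have hint : Integrable (fun ω => X ω i * X ω i) μ := by
    by_contra hc
    rw [integral_undef hc] at h1
    exact zero_ne_one h1
  rw [lintegral_map (by fun_prop) hX]
  have := ofReal_integral_eq_lintegral_ofReal hint
    (ae_of_all _ fun ω => mul_self_nonneg (X ω i))
  rw [h1, ENNReal.ofReal_one] at this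
  rw [this]
  refine lintegral_congr fun ω => ?_
  rw [ENNReal.ofReal_rpow_of_nonneg (abs_nonneg _) zero_le_two, rpow_two, sq_abs, sq]

lemma IsLogConcave.exists_lintegral_norm_le [IsProbabilityMeasure μ] (h : IsLogConcave μ X)
    (hX : Measurable X) (hi : IsIsotropic μ X) {p : ℝ} (hp : 0 < p) :
    ∃ M : ℝ, 0 ≤ M ∧ ∫⁻ ω, ENNReal.ofReal ‖X ω‖ ^ p ∂μ ≤ ENNReal.ofReal M ^ p := by
  have : IsProbabilityMeasure (μ.map X) := Measure.isProbabilityMeasure_map hX.aemeasurable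
  have hν := h.isLogConcaveMeasure_map hX
  have h2 : ∫⁻ x, ENNReal.ofReal ‖x‖ ^ (2 : ℝ) ∂μ.map X ≤ ENNReal.ofReal √n ^ (2 : ℝ) := by
    have h3 : ∀ x : EuclideanSpace ℝ (Fin n), ENNReal.ofReal ‖x‖ ^ (2 : ℝ) =
        ∑ i, ENNReal.ofReal |x i| ^ (2 : ℝ) := by
      intro x
      simp_rw [ENNReal.ofReal_rpow_of_nonneg (norm_nonneg _) zero_le_two,
        ENNReal.ofReal_rpow_of_nonneg (abs_nonneg _) zero_le_two, rpow_two, sq_abs]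
      rw [EuclideanSpace.real_norm_sq_eq, ENNReal.ofReal_sum_of_nonneg fun i _ => sq_nonneg _]
    simp_rw [h3]
    rw [lintegral_finsetSum _ fun i _ => by fun_prop]
    simp_rw [hi.lintegral_coord hX]
    rw [ENNReal.ofReal_rpow_of_nonneg (by positivity) zero_le_two, rpow_two,
      sq_sqrt (by positivity)]
    simp
  have h4 := hν.lintegral_rpow_le (normSeminorm ℝ _) (by exact measurable_norm) one_le_two
    (by linarith : (2 : ℝ) ≤ p + 2) (sqrt_nonneg _) h2
  have h5 := lintegral_rpow_le_of_exponent_le (by exact measurable_norm.ennreal_ofReal) hp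
    (by linarith : p ≤ p + 2) h4
  have hmc := momentConst_pos
  refine ⟨_, ?_, le_trans (le_of_eq ?_) h5⟩
  · positivity
  · rw [lintegral_map (by exact (measurable_norm.ennreal_ofReal).pow_const p) hX]
    rfl

lemma IsLogConcave.lintegral_inner_le [IsProbabilityMeasure μ] (h : IsLogConcave μ X)
    (hX : Measurable X) (hi : IsIsotropic μ X) {p : ℝ} (hp : 0 < p)
    (z : EuclideanSpace ℝ (Fin n)) :
    ∫⁻ x, ENNReal.ofReal |⟪z, x⟫| ^ p ∂μ.map X ≤ ENNReal.ofReal (sigmaX μ X p * ‖z‖) ^ p := by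
  obtain ⟨M, hM0, hM⟩ := h.exists_lintegral_norm_le hX hi hp
  have hle : ∀ z, ∫⁻ ω, ENNReal.ofReal |⟪z, X ω⟫| ^ p ∂μ ≤ ENNReal.ofReal (‖z‖ * M) ^ p := by
    intro z
    calc _ ≤ ∫⁻ ω, ENNReal.ofReal ‖z‖ ^ p * ENNReal.ofReal ‖X ω‖ ^ p ∂μ := by
          refine lintegral_mono fun ω => ?_
          rw [← ENNReal.mul_rpow_of_nonneg _ _ hp.le, ← ENNReal.ofReal_mul (norm_nonneg _)]
          gcongr
          exact abs_real_inner_le_norm _ _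
      _ ≤ _ := by
          rw [lintegral_const_mul _ (by fun_prop), ENNReal.ofReal_mul (norm_nonneg _),
            ENNReal.mul_rpow_of_nonneg _ _ hp.le]
          gcongr
  have hmeas : ∀ z, Measurable fun ω => |⟪z, X ω⟫| := fun z =>
    (by fun_prop : Continuous fun x => |⟪z, x⟫|).measurable.comp hX
  have hbdd : BddAbove (Set.range fun t : {t : EuclideanSpace ℝ (Fin n) // ‖t‖ = 1} =>
      (∫ ω, |⟪t.1, X ω⟫| ^ p ∂μ) ^ (1 / p)) := by
    refine ⟨M, ?_⟩
    rintro _ ⟨t, rfl⟩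
    refine integral_rpow_one_div_le (hmeas _) (fun _ => abs_nonneg _) hp hM0 ?_
    simpa [t.2] using hle t.1
  rw [lintegral_map (by fun_prop) hX]
  refine lintegral_ofReal_rpow_le (hmeas z) (fun _ => abs_nonneg _) hp
    (ne_top_of_le_ne_top (by finiteness) (hle z)) ?_
  rcases eq_or_ne z 0 with rfl | hz
  · simp [hp.ne']
  have hz' : 0 < ‖z‖ := norm_pos_iff.2 hz
  have ht : ‖(‖z‖⁻¹ • z)‖ = 1 := by rw [norm_smul, norm_inv, norm_norm, inv_mul_cancel₀ hz'.ne']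
  have hσ := le_ciSup hbdd ⟨‖z‖⁻¹ • z, ht⟩
  calc (∫ ω, |⟪z, X ω⟫| ^ p ∂μ) ^ (1 / p)
      = (‖z‖ ^ p * ∫ ω, |⟪‖z‖⁻¹ • z, X ω⟫| ^ p ∂μ) ^ (1 / p) := by
        rw [← integral_const_mul]
        congr 2
        ext ω
        rw [← mul_rpow hz'.le (abs_nonneg _), real_inner_smul_left, abs_mul, abs_inv, abs_norm,
          mul_inv_cancel_left₀ hz'.ne']
    _ = ‖z‖ * (∫ ω, |⟪‖z‖⁻¹ • z, X ω⟫| ^ p ∂μ) ^ (1 / p) := by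
        rw [mul_rpow (by positivity) (integral_nonneg fun _ => by positivity), ← rpow_mul hz'.le,
          mul_one_div_cancel hp.ne', rpow_one]
    _ ≤ ‖z‖ * sigmaX μ X p := by gcongr; exact hσ
    _ = _ := mul_comm _ _

lemma sigmaX_nonneg (μ : Measure Ω) (X : Ω → EuclideanSpace ℝ (Fin n)) (p : ℝ) :
    0 ≤ sigmaX μ X p :=
  Real.iSup_nonneg fun _ => rpow_nonneg (integral_nonneg fun _ => by positivity) _

end RandomVector

/-- **Theorem 2.** There is a universal constant `C > 0` such that for every `r ≥ 2`, every
isotropic log-concave random vector `X` in `ℝⁿ` and every `p ≥ 1`,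
`(E‖X‖_r^p)^(1/p) ≤ C·(r·n^(1/r) + σ_X(p))`. -/
theorem lr_paouris :
    ∃ C : ℝ, 0 < C ∧
      ∀ (Ω : Type) (_ : MeasurableSpace Ω) (μ : Measure Ω), IsProbabilityMeasure μ →
      ∀ (n : ℕ) (r : ℝ), 2 ≤ r →
      ∀ X : Ω → EuclideanSpace ℝ (Fin n), Measurable X →
      IsLogConcave μ X → IsIsotropic μ X →
      ∀ p : ℝ, 1 ≤ p →
        (∫ ω, lrNorm r (X ω) ^ p ∂μ) ^ (1 / p) ≤
          C * (r * (n : ℝ) ^ (1 / r) + sigmaX μ X p) := by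
  refine ⟨lrConst, lrConst_pos, ?_⟩
  intro Ω _ μ _ n r hr X hX hlc hiso p hp
  have hp0 : 0 < p := by linarith
  have hσ := sigmaX_nonneg μ X p
  have hpos := lrConst_pos
  refine integral_rpow_one_div_le ((measurable_lrNorm r).comp hX) (fun _ => lrNorm_nonneg r _)
    hp0 (by positivity) ?_
  rcases n.eq_zero_or_pos with rfl | hn
  · simp [lrNorm, hp0, (by linarith : r ≠ 0)]
  have : IsProbabilityMeasure (μ.map X) := Measure.isProbabilityMeasure_map hX.aemeasurable
  rw [← lintegral_map (f := fun x => ENNReal.ofReal (lrNorm r x) ^ p)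
    ((measurable_lrNorm r).ennreal_ofReal.pow_const p) hX]
  exact (hlc.isLogConcaveMeasure_map hX).lintegral_lrNorm_rpow_le_of_inner
    (fun i => (hiso.lintegral_coord hX i).le) hn hr hp hσ
    fun z => hlc.lintegral_inner_le hX hiso hp0 z

end
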